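/- If the Riemann Hypothesis is true, then for all real x ≥ 101, |ψ(x) - x| ≤ (√x · log x · (log x - log log x)) / (8π), where ψ is the Chebyshev psi function. -/

import Mathlib

open Real Finset

noncomputable def chebyshevPsi (x : ℝ) : ℝ :=
  ∑ n ∈ Finset.range (⌊x⌋₊ + 1), ArithmeticFunction.vonMangoldt n

namespace PB
open Complex Metric in
lemma bc_logDeriv {g : ℂ → ℂ} (hg : Differentiable ℂ g) {R M : ℝ} (hR : 0 < R) (hM : 0 < M)
    (h0 : ∀ z ∈ ball (0:ℂ) R, g z ≠ 0) (hb : ∀ z ∈ ball (0:ℂ) R, ‖g z‖ ≤ ‖g 0‖ * Real.exp M)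
    (hd : deriv g 0 = 0) {w : ℂ} (hw : ‖w‖ < R / 4) :
    ‖deriv g w / g w‖ ≤ 32 * M * ‖w‖ / R ^ 2 := by
  have h00 : (0:ℂ) ∈ ball (0:ℂ) R := by simpa using hR
  have hg' : Differentiable ℂ (deriv g) := hg.contDiff (n := 2) |>.differentiable_deriv_two
  have hq : DifferentiableOn ℂ (fun z => deriv g z / g z) (ball 0 R) := by
    intro z hz
    exact ((hg' z).div (hg z) (h0 z hz)).differentiableWithinAt
  obtain ⟨l0, hl0⟩ := hq.isExactOn_ball
  set l : ℂ → ℂ := fun z => l0 z - l0 0 with hl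
  have hld : ∀ z ∈ ball (0:ℂ) R, HasDerivAt l (deriv g z / g z) z := fun z hz =>
    (hl0 z hz).sub_const _
  have hldiff : DifferentiableOn ℂ l (ball 0 R) := fun z hz =>
    (hld z hz).differentiableAt.differentiableWithinAt
  have hexp : ∀ z ∈ ball (0:ℂ) R, g z = g 0 * cexp (l z) := by
    have hc : ∀ z ∈ ball (0:ℂ) R, HasDerivAt (fun z => g z * cexp (-(l z))) 0 z := by
      intro z hz
      have h1 := (hg z).hasDerivAt.mul ((hld z hz).neg.cexp)
      refine h1.congr_deriv ?_
      have := h0 z hz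
      have h9 : g z * (deriv g z / g z) = deriv g z := by field_simp
      simp only [Pi.neg_apply]
      linear_combination -cexp (-(l z)) * h9
    intro z hz
    have h2 := (convex_ball (0:ℂ) R).is_const_of_fderivWithin_eq_zero (𝕜 := ℂ)
      (f := fun z => g z * cexp (-(l z)))
      (fun z hz => (hc z hz).differentiableAt.differentiableWithinAt)
      (fun z hz => by
        rw [fderivWithin_of_isOpen isOpen_ball hz]
        have := (hc z hz).hasFDerivAt.fderiv
        rw [this]; ext; simp) hz h00
    have hl00 : l 0 = 0 := by simp [hl]
    simp only [hl00, neg_zero, Complex.exp_zero, mul_one] at h2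
    rw [← h2, mul_assoc, ← Complex.exp_add]; simp
  have hg0 := h0 0 h00
  have hre : ∀ z ∈ ball (0:ℂ) R, (l z).re ≤ M := by
    intro z hz
    have h1 := hb z hz
    rw [hexp z hz, norm_mul, Complex.norm_exp] at h1
    have := le_of_mul_le_mul_left h1 (norm_pos_iff.2 hg0)
    exact Real.exp_le_exp.1 this
  have hbc : ∀ z : ℂ, ‖z‖ ≤ R / 2 → ‖l z‖ ≤ 2 * M := by
    intro z hz
    have hz' : z ∈ ball (0:ℂ) R := by simp; linarith
    refine (borelCaratheodory_zero hM hldiff hre hR hz' (by simp [hl])).trans ?_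
    rw [div_le_iff₀ (by linarith)]
    nlinarith
  have hq1 : ∀ z : ℂ, ‖z‖ < R / 4 → ‖deriv g z / g z‖ ≤ 8 * M / R := by
    intro z hz
    have hz' : z ∈ ball (0:ℂ) R := by simp; linarith
    have h3 : closedBall z (R/4) ⊆ ball 0 R := by
      intro y hy
      simp only [mem_closedBall, mem_ball, dist_eq_norm, sub_zero] at *
      have : ‖y‖ ≤ ‖y - z‖ + ‖z‖ := by simpa using norm_add_le (y - z) z
      linarith
    have h4 := norm_deriv_le_of_forall_mem_sphere_norm_le (f := l) (c := z) (R := R/4) (C := 2 * M)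
      (by linarith) (DifferentiableOn.diffContOnCl (by
        rw [closure_ball _ (by linarith)]
        exact hldiff.mono h3)) (by
        intro y hy
        apply hbc
        simp only [mem_sphere, dist_eq_norm] at hy
        have : ‖y‖ ≤ ‖y - z‖ + ‖z‖ := by simpa using norm_add_le (y - z) z
        linarith)
    rw [(hld z hz').deriv] at h4
    refine h4.trans (le_of_eq ?_)
    field_simp; ring
  have h5 := dist_le_div_mul_dist_of_mapsTo_ball (f := fun z => deriv g z / g z) (c := 0)
    (R₁ := R/4) (R₂ := 8 * M / R) (z := w)
    (hq.mono (ball_subset_ball (by linarith))) (by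
      intro z hz
      simp only [mem_ball, dist_zero_right] at hz
      simpa [hd] using hq1 z hz) (by simpa using hw)
  simp only [hd, zero_div, dist_zero_right] at h5
  refine h5.trans (le_of_eq ?_)
  field_simp; ring

lemma div_pow_entire {f : ℂ → ℂ} (hf : Differentiable ℂ f) (ρ : ℂ) (hne : analyticOrderAt f ρ ≠ ⊤) :
    ∃ g : ℂ → ℂ, Differentiable ℂ g ∧ g ρ ≠ 0 ∧
      ∀ z, f z = (z - ρ) ^ (analyticOrderNatAt f ρ) * g z := by
  have key : ∀ n : ℕ, ∀ f : ℂ → ℂ, Differentiable ℂ f → analyticOrderAt f ρ = n →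
      ∃ g : ℂ → ℂ, Differentiable ℂ g ∧ g ρ ≠ 0 ∧ ∀ z, f z = (z - ρ) ^ n * g z := by
    intro n
    induction n with
    | zero =>
      intro f hf h
      refine ⟨f, hf, ?_, by simp⟩
      exact (hf.analyticAt ρ).analyticOrderAt_eq_zero.1 (by simpa using h)
    | succ n ih =>
      intro f hf h
      have hz : f ρ = 0 := by
        by_contra h'
        have := (hf.analyticAt ρ).analyticOrderAt_eq_zero.2 h'
        rw [this] at h; norm_cast at h
      have hd : Differentiable ℂ (dslope f ρ) := by
        rw [← differentiableOn_univ] at hf ⊢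
        exact (Complex.differentiableOn_dslope Filter.univ_mem).2 hf
      have hfe : ∀ z, f z = (z - ρ) * dslope f ρ z := by
        intro z
        have := sub_smul_dslope f ρ z
        simpa [hz] using this.symm
      have hord : analyticOrderAt (dslope f ρ) ρ = n := by
        have h1 : f = (fun z => z - ρ) * dslope f ρ := by
          ext z; simpa using hfe z
        have h2 : analyticOrderAt (fun z : ℂ => z - ρ) ρ = 1 := by
          have ha : AnalyticAt ℂ (fun z : ℂ => z) ρ := analyticAt_id
          have := ha.analyticOrderAt_sub_eq_one_of_deriv_ne_zero (by simp)
          simpa only using this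
        rw [h1, analyticOrderAt_mul (by fun_prop) (hd.analyticAt ρ), h2] at h
        push_cast at h
        rw [add_comm] at h
        exact ENat.add_left_injective_of_ne_top (n := 1) (by simp) h
      obtain ⟨g, hg, hg0, hge⟩ := ih _ hd hord
      exact ⟨g, hg, hg0, fun z => by rw [hfe, hge, pow_succ]; ring⟩
  exact key _ f hf (by rw [Nat.cast_analyticOrderNatAt hne])

lemma div_zeros {f : ℂ → ℂ} (hf : Differentiable ℂ f) (hne : ∀ z, analyticOrderAt f z ≠ ⊤)
    (S : Finset ℂ) :
    ∃ g : ℂ → ℂ, Differentiable ℂ g ∧ (∀ ρ ∈ S, g ρ ≠ 0) ∧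
      ∀ z, f z = (∏ ρ ∈ S, (z - ρ) ^ (analyticOrderNatAt f ρ)) * g z := by
  classical
  induction S using Finset.induction_on with
  | empty => exact ⟨f, hf, by simp, by simp⟩
  | insert a S ha ih =>
    obtain ⟨g, hg, hg0, hge⟩ := ih
    have hQ : Differentiable ℂ (fun z : ℂ => ∏ ρ ∈ S, (z - ρ) ^ (analyticOrderNatAt f ρ)) := by
      fun_prop
    have hord : analyticOrderAt f a = analyticOrderAt g a := by
      have h1 : f = (fun z : ℂ => ∏ ρ ∈ S, (z - ρ) ^ (analyticOrderNatAt f ρ)) * g := by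
        ext z; simpa using hge z
      have h2 : analyticOrderAt (fun z : ℂ => ∏ ρ ∈ S, (z - ρ) ^ (analyticOrderNatAt f ρ)) a = 0 := by
        rw [(hQ.analyticAt a).analyticOrderAt_eq_zero, Finset.prod_ne_zero_iff]
        intro ρ hρ
        apply pow_ne_zero
        rw [sub_ne_zero]
        rintro rfl; exact ha hρ
      conv_lhs => rw [h1]
      rw [analyticOrderAt_mul (hQ.analyticAt a) (hg.analyticAt a), h2, zero_add]
    have hordN : analyticOrderNatAt g a = analyticOrderNatAt f a := by
      simp [analyticOrderNatAt, hord]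
    obtain ⟨k, hk, hk0, hke⟩ := div_pow_entire hg a (hord ▸ hne a)
    refine ⟨k, hk, ?_, ?_⟩
    · intro ρ hρ
      rcases Finset.mem_insert.1 hρ with rfl | h
      · exact hk0
      · intro h'
        apply hg0 ρ h
        rw [hke, h', mul_zero]
    · intro z
      rw [hge, hke, Finset.prod_insert ha, hordN]; ring
end PB

namespace PB
open Complex Metric Filter Topology

lemma finite_zeros {f : ℂ → ℂ} (hf : Differentiable ℂ f) (h0 : f 0 ≠ 0) (R : ℝ) :
    (closedBall (0:ℂ) R ∩ {z | f z = 0}).Finite := by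
  by_contra hinf
  have hinf' : (closedBall (0:ℂ) R ∩ {z | f z = 0}).Infinite := hinf
  obtain ⟨z, hz, hacc⟩ := hinf'.exists_accPt_of_subset_isCompact (isCompact_closedBall (0:ℂ) R)
    Set.inter_subset_left
  have hfr : ∃ᶠ y in 𝓝[≠] z, f y = 0 := by
    have := (accPt_iff_frequently_nhdsNE.1 hacc)
    exact this.mono (fun y hy => hy.2)
  have ha : AnalyticOnNhd ℂ f Set.univ := fun y _ => hf.analyticAt y
  have := ha.eqOn_zero_of_preconnected_of_frequently_eq_zero isPreconnected_univ (Set.mem_univ z) hfr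
  exact h0 (this (Set.mem_univ 0))

/-- quantitative Landau step -/
lemma landau {f : ℂ → ℂ} (hf : Differentiable ℂ f) (h0 : f 0 ≠ 0) (hev : ∀ z, f (-z) = f z)
    {R A : ℝ} (hR : 0 < R) (hA : Real.log ‖f 0‖ < A) (hb : ∀ z : ℂ, ‖z‖ = 3 * R → ‖f z‖ ≤ Real.exp A)
    (S : Finset ℂ) (hS : ∀ z, z ∈ S ↔ ‖z‖ ≤ R ∧ f z = 0) {w : ℂ} (hw : ‖w‖ < R / 4) (hfw : f w ≠ 0) :
    ‖deriv f w / f w - ∑ ρ ∈ S, (analyticOrderNatAt f ρ : ℂ) / (w - ρ)‖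
      ≤ 32 * (A - Real.log ‖f 0‖) * ‖w‖ / R ^ 2 := by
  classical
  have hne : ∀ z, analyticOrderAt f z ≠ ⊤ := by
    intro z hz
    have ha : AnalyticOnNhd ℂ f Set.univ := fun y _ => hf.analyticAt y
    have h1 := analyticOrderAt_eq_top.1 hz
    have := ha.eqOn_zero_of_preconnected_of_eventuallyEq_zero isPreconnected_univ (Set.mem_univ z) h1
    exact h0 (this (Set.mem_univ 0))
  obtain ⟨g, hg, hgS, hfg⟩ := div_zeros hf hne S
  set m := analyticOrderNatAt f with hm
  set Q : ℂ → ℂ := fun z => ∏ ρ ∈ S, (z - ρ) ^ m ρ with hQ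
  have hQd : Differentiable ℂ Q := by simp only [hQ]; fun_prop
  have hf0 : ∀ ρ ∈ S, ρ ≠ 0 := by
    rintro ρ hρ rfl; exact h0 ((hS 0).1 hρ).2
  have hgz : ∀ z ∈ ball (0:ℂ) R, g z ≠ 0 := by
    intro z hz h
    have hz0 : f z = 0 := by rw [hfg, h, mul_zero]
    exact hgS z ((hS z).2 ⟨by simpa using (mem_ball_zero_iff.1 hz).le, hz0⟩) h
  have hQ0 : Q 0 ≠ 0 := by
    rw [hQ]; simp only [Finset.prod_ne_zero_iff]
    intro ρ hρ; apply pow_ne_zero; simpa using hf0 ρ hρ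
  have hlog : ∀ z, f z ≠ 0 → deriv f z / f z = ∑ ρ ∈ S, (m ρ : ℂ) / (z - ρ) + deriv g z / g z := by
    intro z hz
    have hfz := hfg z
    have hQz : Q z ≠ 0 := by intro h; apply hz; rw [hfz]; exact mul_eq_zero_of_left h _
    have hgz : g z ≠ 0 := by intro h; apply hz; rw [hfz, h, mul_zero]
    have h1 : f = fun z => Q z * g z := by ext z; exact hfg z
    have h2 : logDeriv f z = logDeriv Q z + logDeriv g z := by
      conv_lhs => rw [h1]
      exact logDeriv_mul z hQz hgz (hQd z) (hg z)
    have h3 : logDeriv Q z = ∑ ρ ∈ S, (m ρ : ℂ) / (z - ρ) := by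
      rw [hQ, logDeriv_prod (f := fun (ρ z : ℂ) => (z - ρ) ^ m ρ)]
      · refine Finset.sum_congr rfl fun ρ hρ => ?_
        rw [logDeriv_fun_pow (by fun_prop)]
        simp [logDeriv_apply, div_eq_mul_inv]
      · intro ρ hρ
        exact (Finset.prod_ne_zero_iff.1 hQz) ρ hρ
      · intro ρ hρ; fun_prop
    rw [← logDeriv_apply, h2, h3, logDeriv_apply]
  have hsym : ∑ ρ ∈ S, (m ρ : ℂ) / (0 - ρ) = 0 := by
    have hmn : ∀ ρ, m (-ρ) = m ρ := by
      intro ρ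
      have h1 : f ∘ (fun z => -z) = f := by ext z; exact hev z
      have h2 := analyticOrderAt_comp_of_deriv_ne_zero (f := f) (g := fun z : ℂ => -z) (z₀ := ρ)
        (by fun_prop) (by simp)
      rw [h1] at h2
      simp only [hm, analyticOrderNatAt, h2]
    have h3 : ∑ ρ ∈ S, (m ρ : ℂ) / (0 - ρ) = ∑ ρ ∈ S, (m ρ : ℂ) / (0 - (-ρ)) := by
      refine Finset.sum_bij' (fun ρ _ => -ρ) (fun ρ _ => -ρ) ?_ ?_ ?_ ?_ ?_
      · intro ρ hρ; rw [hS] at hρ ⊢; simpa [hev] using hρ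
      · intro ρ hρ; rw [hS] at hρ ⊢; simpa [hev] using hρ
      · simp
      · simp
      · intro ρ hρ; simp [hmn]
    have h4 : ∑ ρ ∈ S, (m ρ : ℂ) / (0 - (-ρ)) = - ∑ ρ ∈ S, (m ρ : ℂ) / (0 - ρ) := by
      rw [← Finset.sum_neg_distrib]
      refine Finset.sum_congr rfl fun ρ hρ => ?_
      simp [div_neg]
    rw [h4] at h3
    linear_combination h3 / 2
  have hdf0 : deriv f 0 = 0 := by
    have h1 : deriv (fun z => f (-z)) 0 = deriv f 0 := by simp only [hev]
    rw [deriv_comp_neg] at h1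
    simp only [neg_zero] at h1
    linear_combination -h1 / 2
  have hg00 : g 0 ≠ 0 := hgz 0 (by simpa using hR)
  have hdg : deriv g 0 = 0 := by
    have := hlog 0 h0
    rw [hdf0, hsym] at this
    simp only [zero_div, zero_add] at this
    have h2 := this.symm
    rw [div_eq_zero_iff] at h2
    tauto
  have hgf : ‖g 0‖ * ‖Q 0‖ = ‖f 0‖ := by rw [hfg 0, norm_mul, mul_comm]
  have hbound : ∀ z ∈ ball (0:ℂ) R, ‖g z‖ ≤ ‖g 0‖ * Real.exp (A - Real.log ‖f 0‖) := by
    intro z hz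
    have hgoal : ‖g 0‖ * Real.exp (A - Real.log ‖f 0‖) = Real.exp A / ‖Q 0‖ := by
      rw [Real.exp_sub, Real.exp_log (norm_pos_iff.2 h0), ← hgf]
      have := norm_pos_iff.2 hQ0
      have := norm_pos_iff.2 hg00
      field_simp
    rw [hgoal]
    refine norm_le_of_forall_mem_frontier_norm_le (U := ball 0 (3*R)) isBounded_ball
      hg.diffContOnCl ?_ (subset_closure (ball_subset_ball (by linarith) hz))
    intro y hy
    rw [frontier_ball _ (by positivity), mem_sphere_zero_iff_norm] at hy
    rw [le_div_iff₀ (norm_pos_iff.2 hQ0)]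
    have hQy : ‖Q 0‖ ≤ ‖Q y‖ := by
      simp only [hQ, norm_prod, norm_pow]
      refine Finset.prod_le_prod (fun _ _ => by positivity) fun ρ hρ => ?_
      refine pow_le_pow_left₀ (norm_nonneg _) ?_ _
      have h1 := ((hS ρ).1 hρ).1
      have h2 : ‖y‖ - ‖ρ‖ ≤ ‖y - ρ‖ := norm_sub_norm_le _ _
      simp only [zero_sub, norm_neg]; linarith
    calc ‖g y‖ * ‖Q 0‖ ≤ ‖g y‖ * ‖Q y‖ := by gcongr
      _ = ‖f y‖ := by rw [hfg y, norm_mul, mul_comm]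
      _ ≤ _ := hb y hy
  have := bc_logDeriv hg hR (sub_pos.2 hA) hgz hbound hdg hw
  rw [hlog w hfw]
  simpa using this
end PB

namespace PB
open Complex Metric Filter Topology

lemma partial_fraction {f : ℂ → ℂ} (hf : Differentiable ℂ f) (h0 : f 0 ≠ 0)
    (hev : ∀ z, f (-z) = f z) {C : ℝ}
    (hgr : ∀ z : ℂ, 1 ≤ ‖z‖ → ‖f z‖ ≤ Real.exp (C * ‖z‖ ^ (3/2 : ℝ)))
    (hre : ∀ z, f z = 0 → z.re = 0) {w : ℝ} (hw : 0 < w) :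
    HasSum (fun γ : ℝ => (analyticOrderNatAt f (γ * I) : ℝ) * (w / (w ^ 2 + γ ^ 2)))
      (deriv f w / f w).re := by
  classical
  have hfw : f w ≠ 0 := by
    intro h
    have := hre _ h
    simp at this; linarith
  set F : ℝ → ℝ := fun γ : ℝ => (analyticOrderNatAt f (γ * I) : ℝ) * (w / (w ^ 2 + γ ^ 2)) with hF
  have hF0 : ∀ γ, 0 ≤ F γ := fun γ => by simp only [hF]; positivity
  set S : ℕ → Finset ℂ := fun n => (finite_zeros hf h0 n).toFinset with hS
  have hSm : ∀ n z, z ∈ S n ↔ ‖z‖ ≤ (n:ℝ) ∧ f z = 0 := by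
    intro n z; simp [hS]
  set T : ℕ → Finset ℝ := fun n => (S n).image Complex.im with hT
  have hmul : ∀ z, f z = 0 → (z.im : ℂ) * I = z := by
    intro z hz
    apply Complex.ext <;> simp [hre z hz]
  have hTm : ∀ n γ, γ ∈ T n ↔ |γ| ≤ (n:ℝ) ∧ f (γ * I) = 0 := by
    intro n γ
    simp only [hT, Finset.mem_image, hSm]
    constructor
    · rintro ⟨z, ⟨h1, h2⟩, rfl⟩
      rw [hmul z h2]
      exact ⟨(Complex.abs_im_le_norm z).trans h1, h2⟩
    · rintro ⟨h1, h2⟩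
      exact ⟨γ * I, ⟨by simpa using h1, h2⟩, by simp⟩
  have hsum : ∀ n, ∑ γ ∈ T n, F γ = (∑ ρ ∈ S n, (analyticOrderNatAt f ρ : ℂ) / (w - ρ)).re := by
    intro n
    rw [hT]
    rw [Finset.sum_image]
    · rw [Complex.re_sum]
      refine Finset.sum_congr rfl fun ρ hρ => ?_
      have h1 := hmul ρ ((hSm n ρ).1 hρ).2
      simp only [hF]
      rw [h1]
      conv_rhs => rw [← h1]
      rw [h1, ← mul_one_div (analyticOrderNatAt f ρ : ℂ), ← Complex.ofReal_natCast, Complex.re_ofReal_mul]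
      congr 1
      rw [one_div, Complex.inv_re]
      simp [Complex.normSq_apply, hre ρ ((hSm n ρ).1 hρ).2]
      ring
    · intro a ha b hb hab
      have h1 := hmul a ((hSm n a).1 ha).2
      have h2 := hmul b ((hSm n b).1 hb).2
      rw [← h1, ← h2, hab]
  have hlim : Tendsto (fun n => ∑ γ ∈ T n, F γ) atTop (𝓝 (deriv f w / f w).re) := by
    set D := Real.log ‖f 0‖ with hD
    set C1 : ℝ := |C| + |D| + 1 with hC1
    have hC1p : 1 ≤ C1 := by have := abs_nonneg C; have := abs_nonneg D; linarith
    have hbd : ∀ᶠ n : ℕ in atTop, ‖∑ γ ∈ T n, F γ - (deriv f w / f w).re‖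
        ≤ 64 * C1 * 3 ^ (3/2:ℝ) * w * ((n:ℝ) ^ (-(1/2) : ℝ)) := by
      filter_upwards [eventually_gt_atTop ⌈4 * w⌉₊, eventually_ge_atTop 1] with n hn hn1
      have hn1' : (1:ℝ) ≤ n := by exact_mod_cast hn1
      have hnw : 4 * w < n := lt_of_le_of_lt (Nat.le_ceil _) (by exact_mod_cast hn)
      have hp1 : (1:ℝ) ≤ (3 * (n:ℝ)) ^ (3/2:ℝ) := Real.one_le_rpow (by linarith) (by norm_num)
      have h := landau hf h0 hev (R := n) (A := C1 * (3 * n) ^ (3/2:ℝ)) (by linarith)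
        (by
          have : D ≤ |D| := le_abs_self D
          have := abs_nonneg C
          nlinarith)
        (by
          intro z hz
          refine (hgr z (by rw [hz]; linarith)).trans ?_
          rw [hz]
          apply Real.exp_le_exp.2
          have : C ≤ C1 := by have := le_abs_self C; have := abs_nonneg D; linarith
          gcongr)
        (S n) (hSm n) (w := (w:ℂ)) (by simp [abs_of_pos hw]; linarith) hfw
      rw [hsum, ← Complex.sub_re]
      refine (Complex.abs_re_le_norm _).trans ?_
      rw [norm_sub_rev]
      refine h.trans ?_
      rw [Complex.norm_real, Real.norm_of_nonneg hw.le, Real.mul_rpow (by norm_num) (by linarith)]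
      have e1 : (n:ℝ) ^ (-(1/2) : ℝ) = (n:ℝ) ^ (3/2:ℝ) / (n:ℝ)^2 := by
        rw [← Real.rpow_natCast, ← Real.rpow_sub (by linarith)]; norm_num
      rw [e1]
      have e2 : -Real.log ‖f 0‖ ≤ C1 * (3 ^ (3/2:ℝ) * (n:ℝ) ^ (3/2:ℝ)) := by
        rw [← Real.mul_rpow (by norm_num) (by linarith)]
        have : -D ≤ |D| := neg_le_abs D
        have := abs_nonneg C
        nlinarith
      have hn2 : (0:ℝ) < (n:ℝ)^2 := by positivity
      rw [mul_div_assoc', div_le_div_iff_of_pos_right hn2]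
      nlinarith
    rw [tendsto_iff_norm_sub_tendsto_zero]
    refine squeeze_zero' (Eventually.of_forall fun _ => norm_nonneg _) hbd ?_
    have : Tendsto (fun n : ℕ => (n:ℝ) ^ (-(1/2) : ℝ)) atTop (𝓝 0) :=
      (tendsto_rpow_neg_atTop (by norm_num : (0:ℝ) < 1/2)).comp tendsto_natCast_atTop_atTop
    simpa using this.const_mul (64 * C1 * 3 ^ (3/2:ℝ) * w)
  have hTmono : Monotone T := by
    intro a b hab γ hγ
    rw [hTm] at hγ ⊢
    exact ⟨hγ.1.trans (by exact_mod_cast hab), hγ.2⟩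
  have hsmono : Monotone (fun n => ∑ γ ∈ T n, F γ) := fun a b hab =>
    Finset.sum_le_sum_of_subset_of_nonneg (hTmono hab) (fun i _ _ => hF0 i)
  refine hasSum_of_isLUB_of_nonneg _ hF0 ⟨?_, ?_⟩
  · rintro _ ⟨s, rfl⟩
    obtain ⟨n, hn⟩ : ∃ n : ℕ, ∀ γ ∈ s, |γ| ≤ (n:ℝ) := by
      obtain ⟨B, hB⟩ := (s.finite_toSet.image (fun γ : ℝ => |γ|)).bddAbove
      obtain ⟨n, hn⟩ := exists_nat_ge B
      exact ⟨n, fun γ hγ => (hB ⟨γ, hγ, rfl⟩).trans hn⟩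
    have h1 : ∑ γ ∈ s, F γ ≤ ∑ γ ∈ T n, F γ := by
      have h2 : ∑ γ ∈ s, F γ = ∑ γ ∈ s.filter (fun γ : ℝ => f (γ * I) = 0), F γ := by
        rw [Finset.sum_filter]
        refine Finset.sum_congr rfl fun γ hγ => ?_
        split_ifs with h
        · rfl
        · have : analyticOrderNatAt f (γ * I) = 0 := by
            by_contra h'
            exact h (apply_eq_zero_of_analyticOrderNatAt_ne_zero h')
          simp [hF, this]
      rw [h2]
      refine Finset.sum_le_sum_of_subset_of_nonneg ?_ (fun i _ _ => hF0 i)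
      intro γ hγ
      rw [Finset.mem_filter] at hγ
      rw [hTm]; exact ⟨hn γ hγ.1, hγ.2⟩
    exact h1.trans (hsmono.ge_of_tendsto hlim n)
  · intro b hb
    refine le_of_tendsto hlim (Eventually.of_forall fun n => hb ⟨T n, rfl⟩)
end PB

namespace PB
open Complex Filter Topology MeasureTheory HurwitzZeta

noncomputable def fm : ℝ → ℂ := (hurwitzEvenFEPair 0).f_modif

lemma one_le_evenKernel {t : ℝ} (ht : 0 < t) : 1 ≤ evenKernel 0 t := by
  have h := hasSum_int_evenKernel 0 ht
  have h2 := sum_le_hasSum {0} (fun i _ => (Real.exp_pos _).le) h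
  simpa using h2

lemma fm_nonneg {t : ℝ} (ht : 0 < t) : ∃ r : ℝ, 0 ≤ r ∧ fm t = r := by
  unfold fm WeakFEPair.f_modif
  simp only [Pi.add_apply]
  rcases lt_trichotomy t 1 with h | h | h
  · rw [Set.indicator_of_notMem (by simpa using h.le), Set.indicator_of_mem (by exact ⟨ht, h⟩)]
    refine ⟨evenKernel 0 t - t ^ (-(1/2:ℝ)), ?_, ?_⟩
    · rw [evenKernel_functional_equation, ← evenKernel_eq_cosKernel_of_zero, Real.rpow_neg ht.le]
      have h1 := one_le_evenKernel (t := 1 / t) (by positivity)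
      have : 0 < t ^ (1/2:ℝ) := by positivity
      rw [sub_nonneg, one_div (t ^ (1/2:ℝ))]
      exact le_mul_of_one_le_right (by positivity) h1
    · simp [hurwitzEvenFEPair]
  · subst h
    refine ⟨0, le_rfl, by simp⟩
  · rw [Set.indicator_of_mem (by simpa using h), Set.indicator_of_notMem (by simp [h.le])]
    refine ⟨evenKernel 0 t - 1, ?_, ?_⟩
    · have := one_le_evenKernel ht; linarith
    · simp [hurwitzEvenFEPair]

/-- the majorant -/
noncomputable def KK (σ : ℝ) : ℝ := (∫ t : ℝ in Set.Ioi 0, t ^ (σ / 2 - 1) * ‖fm t‖) / 2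

lemma Z0_eq (s : ℂ) : completedRiemannZeta₀ s = mellin fm (s / 2) / 2 := rfl

lemma fm_conv (s : ℂ) : MellinConvergent fm s :=
  ((hurwitzEvenFEPair 0).isStrongFEPair_toStrongFEPair.hasMellin s).1

lemma KK_int (σ : ℝ) : IntegrableOn (fun t : ℝ => t ^ (σ / 2 - 1) * ‖fm t‖) (Set.Ioi 0) := by
  have := (fm_conv ((σ / 2 : ℝ) : ℂ)).norm
  refine (integrableOn_congr_fun (fun t ht => ?_) measurableSet_Ioi).1 this
  have ht' : 0 < t := ht
  simp only [norm_smul]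
  rw [Complex.norm_cpow_eq_rpow_re_of_pos ht']
  simp

lemma norm_Z0_le (s : ℂ) : ‖completedRiemannZeta₀ s‖ ≤ KK s.re := by
  rw [Z0_eq, norm_div, KK]
  simp only [Complex.norm_ofNat]
  gcongr
  unfold mellin
  refine (norm_integral_le_integral_norm _).trans (le_of_eq ?_)
  refine setIntegral_congr_fun measurableSet_Ioi fun t ht => ?_
  have ht' : 0 < t := ht
  simp only [norm_smul]
  rw [Complex.norm_cpow_eq_rpow_re_of_pos ht']
  simp

lemma KK_eq (σ : ℝ) : (KK σ : ℂ) = completedRiemannZeta₀ σ := by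
  rw [Z0_eq, KK, mellin]
  push_cast
  congr 1
  rw [← integral_complex_ofReal]
  refine setIntegral_congr_fun measurableSet_Ioi fun t ht => ?_
  have ht' : 0 < t := ht
  obtain ⟨r, hr, hrt⟩ := fm_nonneg ht'
  simp only [hrt, Complex.norm_real, Real.norm_of_nonneg hr, smul_eq_mul]
  push_cast
  rw [Complex.ofReal_cpow ht'.le]
  push_cast; rfl

lemma KK_symm (σ : ℝ) : KK (1 - σ) = KK σ := by
  have : ((KK (1 - σ) : ℝ) : ℂ) = (KK σ : ℝ) := by
    rw [KK_eq, KK_eq]; push_cast; exact completedRiemannZeta₀_one_sub _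
  exact_mod_cast this

lemma KK_half_le : KK (1/2) ≤ KK 1 := by
  have h : KK (1/2) ≤ (KK 0 + KK 1) / 2 := by
    unfold KK
    have h1 : ∫ t : ℝ in Set.Ioi 0, t ^ ((1/2:ℝ) / 2 - 1) * ‖fm t‖ ≤
        ∫ t : ℝ in Set.Ioi 0, ((1/2) * (t ^ ((0:ℝ) / 2 - 1) * ‖fm t‖) + (1/2) * (t ^ ((1:ℝ) / 2 - 1) * ‖fm t‖)) := by
      refine setIntegral_mono_on (KK_int _) (((KK_int 0).const_mul _).add ((KK_int 1).const_mul _))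
        measurableSet_Ioi fun t ht => ?_
      have ht' : 0 < t := ht
      have h2 : t ^ ((1/2:ℝ) / 2 - 1) ≤ (1/2) * t ^ ((0:ℝ)/2 - 1) + (1/2) * t ^ ((1:ℝ)/2-1) := by
        have e1 : t ^ ((1/2:ℝ) / 2 - 1) = t ^ (-1/2:ℝ) * t ^ (-1/4:ℝ) := by
          rw [← Real.rpow_add ht']; norm_num
        have e2 : t ^ ((0:ℝ) / 2 - 1) = t ^ (-1/2:ℝ) * t ^ (-1/2:ℝ) := by
          rw [← Real.rpow_add ht']; norm_num
        have e3 : t ^ ((1:ℝ) / 2 - 1) = t ^ (-1/4:ℝ) * t ^ (-1/4:ℝ) := by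
          rw [← Real.rpow_add ht']; norm_num
        rw [e1, e2, e3]
        nlinarith [sq_nonneg (t ^ (-1/2:ℝ) - t ^ (-1/4:ℝ))]
      have := norm_nonneg (fm t)
      nlinarith
    rw [integral_add ((KK_int 0).const_mul _) ((KK_int 1).const_mul _), integral_const_mul,
      integral_const_mul] at h1
    linarith
  have h2 := KK_symm 0
  rw [sub_zero] at h2
  linarith

lemma KK_le {σ A : ℝ} (h1 : σ ≤ A) (h2 : 1 - A ≤ σ) : KK σ ≤ 2 * KK A := by
  have h : KK σ ≤ KK A + KK (1 - A) := by
    unfold KK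
    have h1 : ∫ t : ℝ in Set.Ioi 0, t ^ (σ / 2 - 1) * ‖fm t‖ ≤
        ∫ t : ℝ in Set.Ioi 0, ((t ^ (A / 2 - 1) * ‖fm t‖) + (t ^ ((1-A) / 2 - 1) * ‖fm t‖)) := by
      refine setIntegral_mono_on (KK_int _) ((KK_int A).add (KK_int (1-A)))
        measurableSet_Ioi fun t ht => ?_
      have ht' : 0 < t := ht
      have h2 : t ^ (σ / 2 - 1) ≤ t ^ (A/2 - 1) + t ^ ((1-A)/2-1) := by
        have p1 : 0 < t ^ (A/2 - 1) := by positivity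
        have p2 : 0 < t ^ ((1-A)/2-1) := by positivity
        rcases le_total 1 t with h | h
        · have := Real.rpow_le_rpow_of_exponent_le h (by linarith : σ / 2 - 1 ≤ A/2-1)
          linarith
        · have := Real.rpow_le_rpow_of_exponent_ge ht' h (by linarith : (1-A)/2 - 1 ≤ σ / 2 - 1)
          linarith
      have := norm_nonneg (fm t)
      nlinarith
    rw [integral_add (KK_int A) (KK_int (1-A))] at h1
    linarith
  rw [KK_symm] at h
  linarith

lemma Gamma_bd {x : ℝ} (hx : 1 ≤ x) : Real.Gamma x ≤ Real.exp (2 * (x + 1) ^ (3/2:ℝ)) := by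
  have h1 : Real.Gamma x ≤ Real.Gamma (x + 1) := by
    rw [Real.Gamma_add_one (by linarith)]
    exact le_mul_of_one_le_left (Real.Gamma_pos_of_pos (by linarith)).le hx
  have hn : x ≤ (⌈x⌉₊ : ℝ) := Nat.le_ceil x
  have hn2 : (⌈x⌉₊ : ℝ) < x + 1 := Nat.ceil_lt_add_one (by linarith)
  have h2 : Real.Gamma (x + 1) ≤ Real.Gamma ((⌈x⌉₊ : ℝ) + 1) :=
    Real.Gamma_strictMonoOn_Ici.monotoneOn (by simp; linarith) (by simp; linarith) (by linarith)
  rw [Real.Gamma_nat_eq_factorial] at h2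
  have h3 : ((Nat.factorial ⌈x⌉₊ : ℕ) : ℝ) ≤ (⌈x⌉₊ : ℝ) ^ (⌈x⌉₊) := by
    exact_mod_cast Nat.factorial_le_pow _
  have h4 : (⌈x⌉₊ : ℝ) ^ (⌈x⌉₊) ≤ (x+1) ^ (x + 1) := by
    rw [← Real.rpow_natCast]
    calc (⌈x⌉₊ : ℝ) ^ (⌈x⌉₊ : ℝ) ≤ (x+1) ^ (⌈x⌉₊ : ℝ) := by gcongr
      _ ≤ _ := Real.rpow_le_rpow_of_exponent_le (by linarith) hn2.le
  have h5 : (x+1) ^ (x + 1) ≤ Real.exp (2 * (x + 1) ^ (3/2:ℝ)) := by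
    rw [Real.rpow_def_of_pos (by linarith)]
    apply Real.exp_le_exp.2
    have h6 := Real.log_le_rpow_div (x := x+1) (by linarith) (ε := 1/2) (by norm_num)
    have h7 : (x + 1) ^ (3/2:ℝ) = (x+1)^(1/2:ℝ) * (x+1) := by
      rw [← Real.rpow_add_one (by linarith)]; norm_num
    rw [h7]
    have : Real.log (x+1) * (x+1) ≤ ((x+1)^(1/2:ℝ) / (1/2)) * (x+1) := by gcongr
    linarith
  linarith

end PB

namespace PB
open Complex Filter Topology MeasureTheory HurwitzZeta

noncomputable def xiF (w : ℂ) : ℂ := 1 + (w + 1/2) * (w - 1/2) * completedRiemannZeta₀ (w + 1/2)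

lemma xiF_diff : Differentiable ℂ xiF := by
  unfold xiF
  have := differentiable_completedZeta₀
  fun_prop

lemma xiF_even (w : ℂ) : xiF (-w) = xiF w := by
  unfold xiF
  rw [show -w + 1/2 = 1 - (w + 1/2) by ring, completedRiemannZeta₀_one_sub]
  ring

lemma xiF_eq {s : ℂ} (h0 : s ≠ 0) (h1 : s ≠ 1) :
    xiF (s - 1/2) = s * (s - 1) * completedRiemannZeta s := by
  unfold xiF
  rw [completedRiemannZeta_eq, show s - 1/2 + 1/2 = s by ring]
  have : 1 - s ≠ 0 := sub_ne_zero.2 (Ne.symm h1)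
  field_simp
  ring

lemma xiF_zero_zeta {w : ℂ} (h : xiF w = 0) : riemannZeta (w + 1/2) = 0 := by
  have h0 : w + 1/2 ≠ 0 := by
    intro h'; unfold xiF at h; rw [h'] at h; simp at h
  have h1 : w + 1/2 ≠ 1 := by
    intro h'; unfold xiF at h
    have : w - 1/2 = 0 := by linear_combination h'
    rw [this] at h; simp at h
  have := xiF_eq h0 h1
  rw [show w + 1/2 - 1/2 = w by ring, h] at this
  have h2 : completedRiemannZeta (w + 1/2) = 0 := by
    have h3 : w + 1/2 - 1 ≠ 0 := sub_ne_zero.2 h1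
    have := this.symm
    simp only [mul_eq_zero] at this
    tauto
  rw [riemannZeta_def_of_ne_zero h0, h2, zero_div]

lemma xiF_zero_re (hRH : RiemannHypothesis) {w : ℂ} (h : xiF w = 0) : w.re = 0 := by
  have hz := xiF_zero_zeta h
  have h1 : w + 1/2 ≠ 1 := by
    intro h'; unfold xiF at h
    have : w - 1/2 = 0 := by linear_combination h'
    rw [this] at h; simp at h
  by_cases ht : ∃ n : ℕ, w + 1/2 = -2 * (n + 1)
  · exfalso
    obtain ⟨n, hn⟩ := ht
    have h2 : xiF (-w) = 0 := by rw [xiF_even, h]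
    have hz2 := xiF_zero_zeta h2
    refine riemannZeta_ne_zero_of_one_le_re ?_ hz2
    have : -w + 1/2 = ((2 * (n + 1) + 1 : ℝ) : ℂ) := by push_cast; linear_combination -hn
    rw [this, Complex.ofReal_re]
    have : (0:ℝ) ≤ n := Nat.cast_nonneg n
    linarith
  · have := hRH _ hz ht h1
    simp at this
    linarith

lemma xiF_zero_bound {γ : ℝ} (h : xiF (γ * I) = 0) : 1 ≤ (1/4 + γ ^ 2) * KK 1 := by
  unfold xiF at h
  have h1 : (γ * I + 1/2) * (γ * I - 1/2) = -((1/4 + γ^2 : ℝ) : ℂ) := by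
    push_cast
    linear_combination (γ:ℂ)^2 * I_sq
  rw [h1] at h
  have h2 : (1:ℂ) = ((1/4 + γ^2 : ℝ) : ℂ) * completedRiemannZeta₀ (γ * I + 1/2) := by
    linear_combination h
  have h3 := congrArg norm h2
  rw [norm_one, norm_mul, Complex.norm_real, Real.norm_of_nonneg (by positivity)] at h3
  have h4 := norm_Z0_le (γ * I + 1/2)
  have h5 : ((γ:ℂ) * I + 1/2).re = 1/2 := by simp
  rw [h5] at h4
  have h6 := h4.trans KK_half_le
  calc 1 = (1/4 + γ^2) * ‖completedRiemannZeta₀ (γ * I + 1/2)‖ := h3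
    _ ≤ _ := by gcongr

lemma KK_one : KK 1 = (Real.eulerMascheroniConstant - Real.log (4 * π)) / 2 + 1 := by
  have h : ((KK 1 : ℝ) : ℂ) = (((Real.eulerMascheroniConstant - Real.log (4 * π)) / 2 + 1 : ℝ) : ℂ) := by
    rw [KK_eq]
    push_cast
    rw [completedRiemannZeta₀_one]
    rw [Complex.ofReal_log (by positivity)]
    push_cast; rfl
  exact_mod_cast h

lemma xiF_growth : ∃ C : ℝ, ∀ z : ℂ, 1 ≤ ‖z‖ → ‖xiF z‖ ≤ Real.exp (C * ‖z‖ ^ (3/2 : ℝ)) := by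
  set ζ2 : ℝ := ∑' n : ℕ, 1 / ((n:ℝ) + 1) ^ 2 with hζ2
  have hsum : Summable (fun n : ℕ => 1 / ((n:ℝ) + 1) ^ 2) := by
    have := (summable_nat_add_iff 1).2 (Real.summable_one_div_nat_pow.2 (by norm_num : 1 < 2))
    simpa using this
  have hz0 : 0 ≤ ζ2 := tsum_nonneg fun n => by positivity
  have hK : ∀ A : ℝ, 3 ≤ A → KK A ≤ Real.Gamma (A/2) * ζ2 + 1 := by
    intro A hA
    have h1 : ((KK A : ℝ) : ℂ) = completedRiemannZeta A + 1 / A + 1 / (1 - A) := by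
      rw [KK_eq, completedRiemannZeta_eq]; ring
    have hA0 : (A:ℂ) ≠ 0 := by exact_mod_cast (by linarith : A ≠ 0)
    have h2 : completedRiemannZeta A = Gammaℝ A * riemannZeta A := by
      rw [riemannZeta_def_of_ne_zero hA0]
      have : Gammaℝ A ≠ 0 := Gammaℝ_ne_zero_of_re_pos (by simp; linarith)
      field_simp
    have h3 : ‖riemannZeta A‖ ≤ ζ2 := by
      rw [zeta_eq_tsum_one_div_nat_add_one_cpow (by simp; linarith)]
      have hn : ∀ n : ℕ, ‖1 / ((n:ℂ) + 1) ^ (A:ℂ)‖ ≤ 1 / ((n:ℝ) + 1) ^ 2 := by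
        intro n
        rw [norm_div, norm_one]
        have e : ((n:ℂ) + 1) = (((n:ℝ) + 1 : ℝ) : ℂ) := by push_cast; rfl
        rw [e, Complex.norm_cpow_eq_rpow_re_of_pos (by positivity), Complex.ofReal_re]
        have : ((n:ℝ) + 1) ^ 2 ≤ ((n:ℝ) + 1) ^ A := by
          rw [← Real.rpow_natCast]
          apply Real.rpow_le_rpow_of_exponent_le (by linarith [(Nat.cast_nonneg n : (0:ℝ) ≤ n)])
          norm_num; linarith
        gcongr
      exact tsum_of_norm_bounded hsum.hasSum hn
    have h4 : ‖Gammaℝ A‖ ≤ Real.Gamma (A/2) := by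
      rw [Gammaℝ_def, norm_mul]
      have e1 : ‖(π:ℂ) ^ (-(A:ℂ)/2)‖ ≤ 1 := by
        rw [Complex.norm_cpow_eq_rpow_re_of_pos Real.pi_pos]
        apply Real.rpow_le_one_of_one_le_of_nonpos (by linarith [Real.pi_gt_three])
        simp; linarith
      have e2 : ‖Complex.Gamma ((A:ℂ)/2)‖ = Real.Gamma (A/2) := by
        rw [show (A:ℂ)/2 = ((A/2:ℝ):ℂ) by push_cast; rfl, Complex.Gamma_ofReal, Complex.norm_real,
          Real.norm_of_nonneg (Real.Gamma_pos_of_pos (by linarith)).le]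
      rw [e2]
      exact mul_le_of_le_one_left (Real.Gamma_pos_of_pos (by linarith)).le e1
    have h5 : KK A = (completedRiemannZeta A).re + 1 / A + 1 / (1 - A) := by
      have := congrArg Complex.re h1
      rw [Complex.ofReal_re] at this
      rw [this]
      have e : (1:ℂ) / A + 1 / (1 - A) = ((1 / A + 1 / (1 - A) : ℝ) : ℂ) := by push_cast; rfl
      rw [add_assoc, e, Complex.add_re, Complex.ofReal_re]; ring
    have h6 : (completedRiemannZeta A).re ≤ Real.Gamma (A/2) * ζ2 := by
      refine (Complex.re_le_norm _).trans ?_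
      rw [h2, norm_mul]
      exact mul_le_mul h4 h3 (norm_nonneg _) ((norm_nonneg _).trans h4)
    have h7 : 1 / A ≤ 1 := by rw [div_le_one (by linarith)]; linarith
    have h8 : 1 / (1 - A) ≤ 0 := by apply div_nonpos_of_nonneg_of_nonpos <;> linarith
    linarith
  refine ⟨2 * 3 ^ (3/2:ℝ) + 2 + (1 + 8 * (ζ2 + 1)), fun z hz => ?_⟩
  set r := ‖z‖ with hr
  have hKr := hK (r + 2) (by linarith)
  have hG := Gamma_bd (x := (r+2)/2) (by linarith)
  have h1 : ‖completedRiemannZeta₀ (z + 1/2)‖ ≤ 2 * KK (r + 2) := by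
    refine (norm_Z0_le _).trans (KK_le ?_ ?_)
    · have := Complex.re_le_norm z
      simp; linarith
    · have := (abs_le.1 (Complex.abs_re_le_norm z)).1
      simp; linarith
  have hrp : r ≤ r ^ (3/2:ℝ) := by
    conv_lhs => rw [← Real.rpow_one r]
    exact Real.rpow_le_rpow_of_exponent_le hz (by norm_num)
  have h2 : Real.Gamma ((r+2)/2) ≤ Real.exp (2 * 3 ^ (3/2:ℝ) * r ^ (3/2:ℝ)) := by
    refine hG.trans (Real.exp_le_exp.2 ?_)
    rw [mul_assoc, ← Real.mul_rpow (by norm_num) (by linarith)]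
    have : (r+2)/2+1 ≤ 3 * r := by linarith
    gcongr
  set E := Real.exp (2 * 3 ^ (3/2:ℝ) * r ^ (3/2:ℝ)) with hE
  have hE1 : 1 ≤ E := Real.one_le_exp (by positivity)
  have h3 : KK (r+2) ≤ (ζ2 + 1) * E := by nlinarith
  have h4 : ‖xiF z‖ ≤ 1 + (2 * r) ^ 2 * (2 * ((ζ2 + 1) * E)) := by
    unfold xiF
    refine (norm_add_le _ _).trans ?_
    rw [norm_one, norm_mul, norm_mul]
    have a1 : ‖z + 1/2‖ ≤ 2 * r := by
      refine (norm_add_le _ _).trans ?_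
      norm_num; linarith
    have a2 : ‖z - 1/2‖ ≤ 2 * r := by
      refine (norm_sub_le _ _).trans ?_
      norm_num; linarith
    have a3 : ‖completedRiemannZeta₀ (z + 1/2)‖ ≤ 2 * ((ζ2 + 1) * E) := by linarith
    have : ‖z + 1/2‖ * ‖z - 1/2‖ ≤ (2*r)^2 := by
      rw [sq]; gcongr
    gcongr
  have hr2 : r ^ 2 ≤ Real.exp (2 * r ^ (3/2:ℝ)) := by
    have b1 : r ≤ Real.exp r := by linarith [Real.add_one_le_exp r]
    calc r ^ 2 ≤ (Real.exp r) ^ 2 := by gcongr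
      _ = Real.exp (2 * r) := by rw [← Real.exp_nat_mul]; norm_num
      _ ≤ _ := Real.exp_le_exp.2 (by linarith)
  have hc : 1 + 8 * (ζ2 + 1) ≤ Real.exp ((1 + 8 * (ζ2 + 1)) * r ^ (3/2:ℝ)) := by
    have b1 : 1 + 8 * (ζ2 + 1) ≤ Real.exp (1 + 8 * (ζ2 + 1)) := by
      linarith [Real.add_one_le_exp (1 + 8 * (ζ2 + 1))]
    refine b1.trans (Real.exp_le_exp.2 ?_)
    have : 1 ≤ r ^ (3/2:ℝ) := by linarith
    exact le_mul_of_one_le_right (by positivity) this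
  have h5 : 1 + (2 * r) ^ 2 * (2 * ((ζ2 + 1) * E)) ≤ E * r ^ 2 * (1 + 8 * (ζ2 + 1)) := by
    have : 1 ≤ E * r ^ 2 := by nlinarith
    nlinarith
  rw [add_mul, add_mul, Real.exp_add, Real.exp_add, ← hE]
  calc ‖xiF z‖ ≤ E * r ^ 2 * (1 + 8 * (ζ2 + 1)) := h4.trans h5
    _ ≤ _ := by gcongr

end PB

namespace PB
open Complex Filter Topology

lemma harm_bd : harmonic 512 ≤ 6.8167 := by
  decide +kernel

lemma gamma_bd : Real.eulerMascheroniConstant ≤ 0.5785 := by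
  have h := Real.eulerMascheroniConstant_lt_eulerMascheroniSeq' 512
  unfold Real.eulerMascheroniSeq' at h
  rw [if_neg (by norm_num)] at h
  have h2 := harm_bd
  generalize harmonic 512 = q at h h2
  have h2 : (q : ℝ) ≤ ((6.8167 : ℚ) : ℝ) := by exact_mod_cast h2
  have h3 : Real.log (512:ℕ) = 9 * Real.log 2 := by
    rw [show ((512:ℕ):ℝ) = 2 ^ 9 by norm_num, Real.log_pow]; norm_num
  rw [h3] at h
  have := Real.log_two_gt_d9
  norm_num at h2
  linarith

lemma logpi_bd : 1.1446 ≤ Real.log π := by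
  rw [Real.le_log_iff_exp_le (by positivity)]
  have e := Real.exp_one_lt_d9
  have h1 : Real.exp 1.1446 = Real.exp 1 * Real.exp 0.1446 := by
    rw [← Real.exp_add]; norm_num
  have h2 := Real.exp_bound' (x := 0.1446) (by norm_num) (by norm_num) (n := 5) (by norm_num)
  norm_num [Finset.sum_range_succ, Nat.factorial] at h2
  have h3 := Real.exp_pos 0.1446
  have := Real.pi_gt_d4
  norm_num at h1 h3 ⊢
  rw [h1]
  nlinarith

lemma log4pi_bd : 2.53089 ≤ Real.log (4 * π) := by
  rw [Real.log_mul (by norm_num) (by positivity), show (4:ℝ) = 2 ^ 2 by norm_num, Real.log_pow]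
  have := Real.log_two_gt_d9
  have := logpi_bd
  push_cast
  linarith

lemma KK_one_le : KK 1 ≤ 0.02381 := by
  rw [KK_one]
  have := gamma_bd
  have := log4pi_bd
  linarith

lemma KK_one_nonneg : 0 ≤ KK 1 := by
  unfold KK
  apply div_nonneg _ (by norm_num)
  refine MeasureTheory.setIntegral_nonneg measurableSet_Ioi fun t ht => ?_
  have : (0:ℝ) < t := ht
  positivity

noncomputable def mm (γ : ℝ) : ℝ := (analyticOrderNatAt xiF (γ * I) : ℝ)

lemma mm_nonneg (γ : ℝ) : 0 ≤ mm γ := Nat.cast_nonneg _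

noncomputable def hh (w : ℝ) : ℝ := (deriv xiF w / xiF w).re

lemma mm_ne {γ : ℝ} (h : mm γ ≠ 0) : 40 ≤ γ ^ 2 := by
  have h1 : xiF (γ * I) = 0 := by
    apply apply_eq_zero_of_analyticOrderNatAt_ne_zero
    intro h'; apply h; simp [mm, h']
  have h2 := xiF_zero_bound h1
  have h3 := KK_one_le
  by_contra h4
  push Not at h4
  have := KK_one_nonneg
  nlinarith [sq_nonneg γ]

lemma xiF_zero_ne : xiF 0 ≠ 0 := by
  intro h
  have h2 := xiF_zero_bound (γ := 0) (by simpa using h)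
  have h3 := KK_one_le
  norm_num at h2
  linarith

lemma hh_sum (hRH : RiemannHypothesis) {w : ℝ} (hw : 0 < w) :
    HasSum (fun γ : ℝ => mm γ * (w / (w ^ 2 + γ ^ 2))) (hh w) := by
  obtain ⟨C, hC⟩ := xiF_growth
  exact partial_fraction xiF_diff xiF_zero_ne xiF_even hC (fun z hz => xiF_zero_re hRH hz) hw

lemma hh_half : hh (1/2) = KK 1 := by
  have h1 : HasDerivAt xiF (completedRiemannZeta₀ 1) ((1/2:ℝ):ℂ) := by
    unfold xiF
    have hz := (differentiable_completedZeta₀ ((((1/2:ℝ):ℂ)) + 1/2)).hasDerivAt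
    have h2 : HasDerivAt (fun w : ℂ => w + 1/2) 1 (((1/2:ℝ):ℂ)) := (hasDerivAt_id _).add_const _
    have h3 : HasDerivAt (fun w : ℂ => w - 1/2) 1 (((1/2:ℝ):ℂ)) := (hasDerivAt_id _).sub_const _
    have h4 := ((h2.mul h3).mul (hz.comp_add_const _ _)).const_add 1
    refine h4.congr_deriv ?_
    push_cast
    norm_num
  unfold hh
  rw [h1.deriv]
  have h5 : xiF ((1/2:ℝ):ℂ) = 1 := by unfold xiF; push_cast; simp
  rw [h5, div_one]
  have := KK_eq 1
  push_cast at this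
  rw [← this, Complex.ofReal_re]

lemma mm_sq_summable (hRH : RiemannHypothesis) : Summable (fun γ : ℝ => mm γ / γ ^ 2) ∧
    ∑' γ : ℝ, mm γ / γ ^ 2 ≤ 0.04792 := by
  have h1 := (hh_sum hRH (w := 1/2) (by norm_num)).mul_left 2.0125
  have hle : ∀ γ : ℝ, mm γ / γ ^ 2 ≤ 2.0125 * (mm γ * ((1/2) / ((1/2) ^ 2 + γ ^ 2))) := by
    intro γ
    by_cases h : mm γ = 0
    · simp [h]
    · have h2 := mm_ne h
      have h3 : 1 / γ ^ 2 ≤ 2.0125 * ((1/2) / ((1/2) ^ 2 + γ ^ 2)) := by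
        rw [mul_div_assoc', div_le_div_iff₀ (by linarith) (by positivity)]
        nlinarith
      calc mm γ / γ ^ 2 = mm γ * (1 / γ ^ 2) := by ring
        _ ≤ mm γ * (2.0125 * ((1/2) / ((1/2) ^ 2 + γ ^ 2))) := mul_le_mul_of_nonneg_left h3 (mm_nonneg γ)
        _ = _ := by ring
  have hs : Summable (fun γ : ℝ => mm γ / γ ^ 2) :=
    Summable.of_nonneg_of_le (fun γ => div_nonneg (mm_nonneg γ) (sq_nonneg γ)) hle h1.summable
  refine ⟨hs, (hs.tsum_le_tsum hle h1.summable).trans ?_⟩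
  rw [h1.tsum_eq, hh_half]
  have := KK_one_le
  linarith
end PB

namespace PB
open Complex Filter Topology MeasureTheory

/-- `g` has (real) Laplace transform `G` on `s ≥ 4`. -/
def Lp (g G : ℝ → ℝ) : Prop := ContinuousOn g (Set.Ici 0) ∧
  (∃ C, ∀ u, 0 ≤ u → |g u| ≤ C * Real.exp (2 * u)) ∧
  ∀ s, 4 ≤ s → ∫ u in Set.Ioi (0:ℝ), Real.exp (-s * u) * g u = G s

lemma exp_int {a : ℝ} (ha : a < 0) : IntegrableOn (fun u : ℝ => Real.exp (a * u)) (Set.Ioi 0) :=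
  integrableOn_exp_mul_Ioi ha 0

lemma lap_int {g : ℝ → ℝ} (hc : ContinuousOn g (Set.Ici 0)) {C : ℝ}
    (hC : ∀ u, 0 ≤ u → |g u| ≤ C * Real.exp (2 * u)) {s : ℝ} (hs : 4 ≤ s) :
    IntegrableOn (fun u => Real.exp (-s * u) * g u) (Set.Ioi 0) := by
  refine Integrable.mono' (g := fun u => C * Real.exp ((2 - s) * u)) ?_ ?_ ?_
  · exact (exp_int (by linarith)).const_mul C
  · apply ContinuousOn.aestronglyMeasurable _ measurableSet_Ioi
    exact ContinuousOn.mul (by fun_prop) (hc.mono Set.Ioi_subset_Ici_self)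
  · refine (ae_restrict_iff' measurableSet_Ioi).2 (Eventually.of_forall fun u hu => ?_)
    have hu : (0:ℝ) < u := hu
    rw [norm_mul, Real.norm_eq_abs, Real.norm_eq_abs, abs_of_pos (Real.exp_pos _),
      show (2 - s) * u = -s * u + 2 * u by ring, Real.exp_add]
    nlinarith [hC u hu.le, Real.exp_pos (-s * u)]

lemma Lp.int {g G : ℝ → ℝ} (h : Lp g G) {s : ℝ} (hs : 4 ≤ s) :
    IntegrableOn (fun u => Real.exp (-s * u) * g u) (Set.Ioi 0) := by
  obtain ⟨hc, ⟨C, hC⟩, -⟩ := h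
  exact lap_int hc hC hs

lemma Lp.add {g G f F : ℝ → ℝ} (h : Lp g G) (k : Lp f F) :
    Lp (fun u => g u + f u) (fun s => G s + F s) := by
  refine ⟨h.1.add k.1, ?_, fun s hs => ?_⟩
  · obtain ⟨-, ⟨C, hC⟩, -⟩ := h
    obtain ⟨-, ⟨D, hD⟩, -⟩ := k
    refine ⟨C + D, fun u hu => (abs_add_le _ _).trans ?_⟩
    linarith [hC u hu, hD u hu]
  · simp only [mul_add]
    rw [integral_add (h.int hs) (k.int hs), h.2.2 s hs, k.2.2 s hs]

lemma Lp.smul {g G : ℝ → ℝ} (h : Lp g G) (a : ℝ) :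
    Lp (fun u => a * g u) (fun s => a * G s) := by
  refine ⟨continuousOn_const.mul h.1, ?_, fun s hs => ?_⟩
  · obtain ⟨-, ⟨C, hC⟩, -⟩ := h
    refine ⟨|a| * C, fun u hu => ?_⟩
    rw [abs_mul, mul_assoc]
    exact mul_le_mul_of_nonneg_left (hC u hu) (abs_nonneg _)
  · simp only [mul_left_comm _ a]
    rw [integral_const_mul, h.2.2 s hs]

lemma Lp.congr {g G F : ℝ → ℝ} (h : Lp g G) (e : ∀ s, 4 ≤ s → G s = F s) : Lp g F :=
  ⟨h.1, h.2.1, fun s hs => (h.2.2 s hs).trans (e s hs)⟩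

lemma Lp.tsum {ι : Type*} [Countable ι] {f F : ι → ℝ → ℝ} {a : ι → ℝ} (ha : Summable a)
    (h : ∀ i, Lp (f i) (F i)) (hb : ∀ i u, 0 ≤ u → |f i u| ≤ a i * Real.exp (2 * u)) :
    Lp (fun u => ∑' i, f i u) (fun s => ∑' i, F i s) := by
  have hs : ∀ u, 0 ≤ u → Summable (fun i => f i u) := fun u hu =>
    Summable.of_norm_bounded (ha.mul_right _) (fun i => hb i u hu)
  refine ⟨?_, ⟨∑' i, a i, fun u hu => ?_⟩, fun s hs4 => ?_⟩
  · have h1 : ContinuousOn (fun u => ∑' i, Real.exp (-2 * u) * f i u) (Set.Ici 0) := by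
      refine continuousOn_tsum (u := a) (fun i => ContinuousOn.mul (by fun_prop) (h i).1) ha ?_
      intro i u hu
      have hu : 0 ≤ u := hu
      rw [norm_mul, Real.norm_eq_abs, Real.norm_eq_abs, abs_of_pos (Real.exp_pos _)]
      calc _ ≤ Real.exp (-2 * u) * (a i * Real.exp (2 * u)) :=
            mul_le_mul_of_nonneg_left (hb i u hu) (Real.exp_pos _).le
        _ = a i * (Real.exp (-2 * u) * Real.exp (2 * u)) := by ring
        _ = a i := by rw [← Real.exp_add]; simp
    have h2 : ContinuousOn (fun u => Real.exp (2 * u) * ∑' i, Real.exp (-2 * u) * f i u)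
      (Set.Ici 0) := ContinuousOn.mul (by fun_prop) h1
    refine h2.congr fun u hu => ?_
    simp only
    rw [tsum_mul_left, ← mul_assoc, ← Real.exp_add]; simp
  · calc |∑' i, f i u| ≤ ∑' i, |f i u| := by
          have := norm_tsum_le_tsum_norm (f := fun i => f i u) ((hs u hu).abs)
          simpa using this
      _ ≤ ∑' i, a i * Real.exp (2 * u) :=
          (hs u hu).abs.tsum_le_tsum (fun i => hb i u hu) (ha.mul_right _)
      _ = _ := tsum_mul_right
  · have hI : ∀ i, ∫ u in Set.Ioi (0:ℝ), Real.exp (-s * u) * f i u = F i s :=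
      fun i => (h i).2.2 s hs4
    have key := hasSum_integral_of_summable_integral_norm (μ := volume.restrict (Set.Ioi (0:ℝ)))
      (F := fun i u => Real.exp (-s * u) * f i u) (fun i => (h i).int hs4) ?_
    · simp only [hI] at key
      simp only
      rw [key.tsum_eq]
      refine integral_congr_ae (Eventually.of_forall fun u => ?_)
      simp only
      rw [tsum_mul_left]
    · refine Summable.of_nonneg_of_le (fun i => integral_nonneg fun u => norm_nonneg _) (fun i => ?_)
        (ha.mul_right (∫ u in Set.Ioi (0:ℝ), Real.exp ((2 - s) * u)))
      rw [← integral_const_mul]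
      refine setIntegral_mono_on ((h i).int hs4).norm ((exp_int (by linarith)).const_mul _)
        measurableSet_Ioi fun u hu => ?_
      have hu : (0:ℝ) < u := hu
      rw [norm_mul, Real.norm_eq_abs, Real.norm_eq_abs, abs_of_pos (Real.exp_pos _),
        show (2 - s) * u = -s * u + 2 * u by ring, Real.exp_add]
      nlinarith [hb i u hu.le, Real.exp_pos (-s * u)]

lemma Lp.exp (c a : ℂ) (ha : a.re ≤ 2) :
    Lp (fun u => (c * Complex.exp (a * u)).re) (fun s => (c / (s - a)).re) := by
  refine ⟨by fun_prop, ⟨‖c‖, fun u hu => ?_⟩, fun s hs => ?_⟩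
  · refine (Complex.abs_re_le_norm _).trans ?_
    rw [norm_mul, Complex.norm_exp]
    gcongr
    simpa using mul_le_mul_of_nonneg_right ha hu
  · have hre : (a - s).re < 0 := by simp; linarith
    have h1 := integral_exp_mul_complex_Ioi hre 0
    have h2 : IntegrableOn (fun u : ℝ => c * Complex.exp ((a - s) * u)) (Set.Ioi 0) :=
      (integrableOn_exp_mul_complex_Ioi hre 0).const_mul c
    have h3 : ∀ u : ℝ, Real.exp (-s * u) * (c * Complex.exp (a * u)).re =
        (c * Complex.exp ((a - s) * u)).re := by
      intro u
      rw [← Complex.re_ofReal_mul, Complex.ofReal_exp]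
      congr 1
      rw [mul_left_comm, ← Complex.exp_add]
      congr 2
      push_cast; ring
    simp only [h3]
    have h4 := integral_re h2
    simp only [RCLike.re_eq_complex_re] at h4
    rw [h4, integral_const_mul, h1]
    have h5 : (a - s : ℂ) ≠ 0 := by
      intro h; rw [h] at hre; simp at hre
    have h6 : (s - a : ℂ) ≠ 0 := by
      intro h; apply h5; linear_combination -h
    congr 1
    simp
    field_simp
    ring

lemma Lp.ramp {l : ℝ} (hl : 0 ≤ l) :
    Lp (fun u => max (u - l) 0) (fun s => Real.exp (-s * l) / s ^ 2) := by
  refine ⟨by fun_prop, ⟨1, fun u hu => ?_⟩, fun s hs => ?_⟩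
  · rw [abs_of_nonneg (le_max_right _ _)]
    apply max_le
    · have := Real.add_one_le_exp (2 * u); linarith
    · positivity
  · have h0 : ∫ u in Set.Ioi (0:ℝ), Real.exp (-s * u) * max (u - l) 0 =
        ∫ u in Set.Ioi l, Real.exp (-s * u) * (u - l) := by
      rw [← integral_indicator measurableSet_Ioi, ← integral_indicator measurableSet_Ioi]
      congr 1
      funext u
      by_cases h1 : l < u
      · rw [Set.indicator_of_mem (show u ∈ Set.Ioi 0 from lt_of_le_of_lt hl h1),
          Set.indicator_of_mem (show u ∈ Set.Ioi l from h1), max_eq_left (by linarith)]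
      · rw [Set.indicator_of_notMem (show u ∉ Set.Ioi l from h1)]
        have : max (u - l) 0 = 0 := max_eq_right (by linarith)
        simp [Set.indicator, this]
    rw [h0]
    have hs0 : s ≠ 0 := by linarith
    have h1 : ∀ u : ℝ, HasDerivAt (fun u => -Real.exp (-s * u) * ((u - l) / s + 1 / s ^ 2))
        (Real.exp (-s * u) * (u - l)) u := by
      intro u
      have e : HasDerivAt (fun u : ℝ => Real.exp (-s * u)) (Real.exp (-s * u) * (-s * 1)) u :=
        ((hasDerivAt_id u).const_mul (-s)).exp
      have f : HasDerivAt (fun u : ℝ => (u - l) / s + 1 / s ^ 2) (1 / s) u :=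
        (((hasDerivAt_id u).sub_const l).div_const s).add_const _
      refine (e.neg.mul f).congr_deriv ?_
      simp only [Pi.neg_apply]
      field_simp
      ring
    have h2 : Tendsto (fun u => -Real.exp (-s * u) * ((u - l) / s + 1 / s ^ 2)) atTop (𝓝 0) := by
      have e1 : Tendsto (fun u : ℝ => Real.exp (-s * u)) atTop (𝓝 0) := by
        refine Real.tendsto_exp_atBot.comp ?_
        exact Tendsto.const_mul_atTop_of_neg (by linarith) tendsto_id
      have e2 : Tendsto (fun u : ℝ => u * Real.exp (-s * u)) atTop (𝓝 0) := by
        have := Real.tendsto_pow_mul_exp_neg_atTop_nhds_zero 1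
        have h3 := (this.comp (Tendsto.const_mul_atTop (show 0 < s by linarith) tendsto_id)).const_mul (1/s)
        rw [mul_zero] at h3
        refine h3.congr fun u => ?_
        simp
        field_simp
      have := (e2.const_mul (-1/s)).add (e1.const_mul (l / s - 1 / s ^ 2))
      simp only [mul_zero, add_zero] at this
      refine this.congr fun u => ?_
      field_simp
      ring
    rw [integral_Ioi_of_hasDerivAt_of_nonneg' (fun u _ => h1 u) ?_ h2]
    · simp; ring
    · intro u hu
      have : l < u := hu
      have := Real.exp_pos (-s * u)
      have : 0 < u - l := by linarith
      positivity

lemma Lp.unique {g f G : ℝ → ℝ} (h : Lp g G) (k : Lp f G) {u : ℝ} (hu : 0 ≤ u) : g u = f u := by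
  have hd := h.add (k.smul (-1))
  obtain ⟨hc, ⟨C, hC⟩, hL⟩ := hd
  set d : ℝ → ℝ := fun u => g u + -1 * f u with hd
  -- φ
  let φ : ℝ → ℝ := fun t => if t ≤ 0 then 0 else d (-Real.log t) * t ^ 3
  have hφe : ∀ u : ℝ, φ (Real.exp (-u)) = d u * Real.exp (-3 * u) := by
    intro u
    simp only [φ, if_neg (not_le.2 (Real.exp_pos (-u))), Real.log_exp, neg_neg]
    rw [← Real.exp_nat_mul]; congr 2; push_cast; ring
  have hb : ∀ t ∈ Set.Icc (0:ℝ) 1, |φ t| ≤ C * t := by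
    intro t ht
    rcases ht.1.eq_or_lt with rfl | h0
    · simp [φ]
    · have h1 := hC (-Real.log t) (by have := Real.log_nonpos ht.1 ht.2; linarith)
      simp only [φ, if_neg (not_le.2 h0)]
      rw [abs_mul, abs_of_pos (pow_pos h0 3)]
      have h2 : Real.exp (2 * -Real.log t) = (t ^ 2)⁻¹ := by
        rw [show 2 * -Real.log t = -(Real.log (t ^ 2)) by rw [Real.log_pow]; push_cast; ring,
          Real.exp_neg, Real.exp_log (by positivity)]
      rw [h2] at h1
      calc _ ≤ C * (t ^ 2)⁻¹ * t ^ 3 := by gcongr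
        _ = C * t := by field_simp
  have hC0 : 0 ≤ C := by
    have := hb 1 (by simp)
    have := abs_nonneg (φ 1)
    linarith
  have hφc : ContinuousOn φ (Set.Icc 0 1) := by
    intro t ht
    rcases ht.1.eq_or_lt with rfl | h0
    · have e : φ 0 = 0 := by simp [φ]
      unfold ContinuousWithinAt
      rw [e]
      refine squeeze_zero_norm' (a := fun t => C * t) ?_ ?_
      · exact eventually_mem_nhdsWithin.mono fun t ht => hb t ht
      · have : ContinuousWithinAt (fun t : ℝ => C * t) (Set.Icc 0 1) 0 := by fun_prop
        simpa [ContinuousWithinAt] using this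
    · have h1 : ContinuousOn (fun t : ℝ => d (-Real.log t) * t ^ 3) (Set.Ioc 0 1) := by
        refine ContinuousOn.mul (hc.comp (ContinuousOn.neg
          (Real.continuousOn_log.mono ?_)) ?_) (by fun_prop)
        · intro t ht; exact ht.1.ne'
        · intro t ht
          have := Real.log_nonpos ht.1.le ht.2
          simp only [Set.mem_Ici]; linarith
      have h2 : ContinuousOn φ (Set.Ioc 0 1) := h1.congr fun t ht => by
        simp only [φ, if_neg (not_le.2 ht.1)]
      have h3 := h2 t ⟨h0, ht.2⟩
      refine h3.mono_of_mem_nhdsWithin ?_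
      refine mem_nhdsWithin.2 ⟨Set.Ioi 0, isOpen_Ioi, h0, ?_⟩
      rintro x ⟨hx1, hx2⟩
      exact ⟨hx1, hx2.2⟩
  have hI : ∀ s, 4 ≤ s → IntegrableOn (fun u => Real.exp (-s * u) * d u) (Set.Ioi 0) :=
    fun s hs => lap_int hc hC hs
  have hz : ∀ s, 4 ≤ s → ∫ u in Set.Ioi (0:ℝ), Real.exp (-s * u) * d u = 0 := by
    intro s hs; rw [hL s hs]; ring
  have hmon : ∀ u (n : ℕ), (φ (Real.exp (-u)) * Real.exp (-u)) * (Real.exp (-u)) ^ n =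
      Real.exp (-(n + 4 : ℝ) * u) * d u := by
    intro u n
    rw [hφe, mul_assoc, mul_assoc, ← Real.exp_nat_mul, ← Real.exp_add, ← Real.exp_add, mul_comm]
    congr 2; ring
  have hpoly : ∀ p : Polynomial ℝ,
      IntegrableOn (fun u => (φ (Real.exp (-u)) * Real.exp (-u)) * p.eval (Real.exp (-u))) (Set.Ioi 0) ∧
      ∫ u in Set.Ioi (0:ℝ), (φ (Real.exp (-u)) * Real.exp (-u)) * p.eval (Real.exp (-u)) = 0 := by
    intro p
    induction p using Polynomial.induction_on' with
    | add p q hp hq =>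
      simp only [Polynomial.eval_add, mul_add]
      refine ⟨hp.1.add hq.1, ?_⟩
      rw [integral_add hp.1 hq.1, hp.2, hq.2, add_zero]
    | monomial n a =>
      simp only [Polynomial.eval_monomial, mul_left_comm _ a, hmon]
      have h4 : (4:ℝ) ≤ n + 4 := by have := Nat.cast_nonneg (α := ℝ) n; linarith
      refine ⟨(hI _ h4).const_mul a, ?_⟩
      rw [integral_const_mul, hz _ h4, mul_zero]
  have hexp : ∀ u ∈ Set.Ioi (0:ℝ), Real.exp (-u) ∈ Set.Icc (0:ℝ) 1 := fun u hu =>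
    ⟨(Real.exp_pos _).le, Real.exp_le_one_iff.2 (by have : (0:ℝ) < u := hu; linarith)⟩
  have hφcont : ContinuousOn (fun u : ℝ => φ (Real.exp (-u))) (Set.Ioi 0) :=
    hφc.comp (by fun_prop) hexp
  have hE : IntegrableOn (fun u : ℝ => Real.exp (-u)) (Set.Ioi 0) := by
    simpa using exp_int (a := -1) (by norm_num)
  have hE1 : ∫ u in Set.Ioi (0:ℝ), Real.exp (-u) = 1 := by simpa using integral_exp_neg_Ioi_zero
  have hφ2 : IntegrableOn (fun u => φ (Real.exp (-u)) * Real.exp (-u) * φ (Real.exp (-u)))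
      (Set.Ioi 0) := by
    refine Integrable.mono' (hE.const_mul (C * C)) ?_ ?_
    · exact ContinuousOn.aestronglyMeasurable
        ((hφcont.mul (by fun_prop)).mul hφcont) measurableSet_Ioi
    · refine (ae_restrict_iff' measurableSet_Ioi).2 (Eventually.of_forall fun u hu => ?_)
      have h1 := hb _ (hexp u hu)
      have h2 := hexp u hu
      have h3 : |φ (Real.exp (-u))| ≤ C := h1.trans (by nlinarith [h2.2])
      rw [norm_mul, norm_mul, Real.norm_eq_abs, Real.norm_eq_abs, abs_of_pos (Real.exp_pos _)]
      nlinarith [abs_nonneg (φ (Real.exp (-u))), Real.exp_pos (-u), mul_le_mul h3 h3 (abs_nonneg _) hC0]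
  have hsq : ∫ u in Set.Ioi (0:ℝ), φ (Real.exp (-u)) * Real.exp (-u) * φ (Real.exp (-u)) ≤ 0 := by
    refine le_of_forall_pos_le_add fun ε hε => ?_
    obtain ⟨p, hp⟩ := exists_polynomial_near_of_continuousOn 0 1 φ hφc (ε / (C + 1)) (by positivity)
    have h1 := hpoly p
    have h2 : ∫ u in Set.Ioi (0:ℝ), φ (Real.exp (-u)) * Real.exp (-u) * φ (Real.exp (-u)) =
        ∫ u in Set.Ioi (0:ℝ), (φ (Real.exp (-u)) * Real.exp (-u) * φ (Real.exp (-u)) -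
          (φ (Real.exp (-u)) * Real.exp (-u)) * p.eval (Real.exp (-u))) := by
      rw [integral_sub hφ2 h1.1, h1.2, sub_zero]
    rw [h2, zero_add]
    calc _ ≤ ∫ u in Set.Ioi (0:ℝ), ε * Real.exp (-u) := by
          refine setIntegral_mono_on (hφ2.sub h1.1) (hE.const_mul ε) measurableSet_Ioi fun u hu => ?_
          have h3 := hb _ (hexp u hu)
          have h2 := hexp u hu
          have h3 : |φ (Real.exp (-u))| ≤ C := h3.trans (by nlinarith [h2.2])
          have h4 := (hp _ h2).le
          have h5 : |φ (Real.exp (-u))| * |Polynomial.eval (Real.exp (-u)) p - φ (Real.exp (-u))| ≤ C * (ε / (C+1)) :=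
            mul_le_mul h3 h4 (abs_nonneg _) hC0
          have h6 : C * (ε / (C+1)) ≤ ε := by
            rw [mul_div_assoc', div_le_iff₀ (by positivity)]; nlinarith
          rw [← abs_mul] at h5
          have h7 := neg_abs_le (φ (Real.exp (-u)) * (Polynomial.eval (Real.exp (-u)) p - φ (Real.exp (-u))))
          nlinarith [Real.exp_pos (-u)]
      _ = ε := by rw [integral_const_mul, hE1, mul_one]
  have hnn : ∀ u, 0 ≤ φ (Real.exp (-u)) * Real.exp (-u) * φ (Real.exp (-u)) := fun u => by
    nlinarith [mul_nonneg (sq_nonneg (φ (Real.exp (-u)))) (Real.exp_pos (-u)).le]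
  have h0 : ∫ u in Set.Ioi (0:ℝ), φ (Real.exp (-u)) * Real.exp (-u) * φ (Real.exp (-u)) = 0 :=
    le_antisymm hsq (integral_nonneg hnn)
  rw [integral_eq_zero_iff_of_nonneg (fun u => hnn u) hφ2] at h0
  have hae : d =ᵐ[volume.restrict (Set.Ioi 0)] fun _ => 0 := by
    filter_upwards [h0] with u h
    simp only [hφe, Pi.zero_apply, mul_eq_zero, (Real.exp_pos _).ne', or_false] at h
    simpa using h
  have hEq : Set.EqOn d (fun _ => 0) (Set.Ioi 0) :=
    Measure.eqOn_open_of_ae_eq hae isOpen_Ioi (hc.mono Set.Ioi_subset_Ici_self) continuousOn_const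
  have hEq2 : Set.EqOn d (fun _ => 0) (Set.Ici 0) := by
    have := hEq.of_subset_closure hc continuousOn_const Set.Ioi_subset_Ici_self
      (by rw [closure_Ioi])
    exact this
  have := hEq2 hu
  simp only [hd] at this
  linarith
end PB

namespace PB
open Complex Filter Topology MeasureTheory

noncomputable def DG (x : ℝ) : ℝ := deriv (Real.log ∘ Real.Gamma) x

lemma lG_rec (x : ℝ) (hx : 0 < x) :
    (Real.log ∘ Real.Gamma) (x + 1) = (Real.log ∘ Real.Gamma) x + Real.log x := by
  simp only [Function.comp_apply,
    Real.Gamma_add_one hx.ne', Real.log_mul hx.ne' (Real.Gamma_pos_of_pos hx).ne', add_comm]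

lemma lG_diff {x : ℝ} (hx : 0 < x) : DifferentiableAt ℝ (Real.log ∘ Real.Gamma) x := by
  refine ((Real.differentiableAt_Gamma ?_).log (Real.Gamma_ne_zero ?_)) <;>
  exact fun m ↦ ne_of_gt (by have := Nat.cast_nonneg (α := ℝ) m; linarith)

lemma DG_rec (x : ℝ) (hx : 0 < x) : DG (x + 1) = DG x + 1 / x := by
  unfold DG
  rw [← deriv_comp_add_const, one_div, ← Real.deriv_log,
    ← deriv_add (lG_diff <| by positivity) (Real.differentiableAt_log hx.ne')]
  apply EventuallyEq.deriv_eq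
  filter_upwards [eventually_gt_nhds hx] using lG_rec

lemma DG_lb {x : ℝ} (hx : 0 < x) : Real.log x ≤ DG (x + 1) := by
  refine (le_of_eq ?_).trans <| Real.convexOn_log_Gamma.slope_le_deriv (Set.mem_Ioi.mpr hx)
    (by simp; positivity) (by linarith : x < x + 1) (lG_diff <| by positivity)
  rw [slope_def_field, show x + 1 - x = (1 : ℝ) by ring, div_one, lG_rec x hx, add_sub_cancel_left]

lemma DG_ub {x : ℝ} (hx : 0 < x) : DG x ≤ Real.log x := by
  refine (Real.convexOn_log_Gamma.deriv_le_slope (Set.mem_Ioi.mpr hx)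
    (by simp; positivity) (by linarith : x < x + 1) (lG_diff hx)).trans (le_of_eq ?_)
  rw [slope_def_field, show x + 1 - x = (1 : ℝ) by ring, div_one, lG_rec x hx, add_sub_cancel_left]

lemma DG_one : DG 1 = -Real.eulerMascheroniConstant := by
  unfold DG
  rw [Function.comp_def, deriv.log (Real.hasDerivAt_Gamma_one.differentiableAt) (by simp),
    Real.hasDerivAt_Gamma_one.deriv, Real.Gamma_one, div_one]

lemma DG_mul (x : ℝ) (hx : 0 < x) (n : ℕ) :
    DG (x + n) = DG x + ∑ k ∈ Finset.range n, 1 / (x + k) := by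
  induction n with
  | zero => simp
  | succ n ih =>
    rw [Finset.sum_range_succ, ← add_assoc, ← ih, ← DG_rec _ (by positivity)]
    congr 1; push_cast; ring

lemma DG_diff_tendsto (x : ℝ) (hx : 0 < x) :
    Tendsto (fun n : ℕ => DG (x + n) - Real.log n) atTop (𝓝 0) := by
  have hlog : ∀ c : ℝ, Tendsto (fun n : ℕ => Real.log (c + n) - Real.log n) atTop (𝓝 0) := by
    intro c
    have h1 : Tendsto (fun n : ℕ => (c / n + 1 : ℝ)) atTop (𝓝 (0 + 1)) :=
      (tendsto_const_div_atTop_nhds_zero_nat c).add_const 1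
    have h2 := h1.log (by norm_num)
    simp only [zero_add, Real.log_one] at h2
    refine h2.congr' ?_
    have h3 : ∀ᶠ n : ℕ in atTop, 0 < c + n :=
      (tendsto_atTop_add_const_left _ c tendsto_natCast_atTop_atTop).eventually_gt_atTop 0
    filter_upwards [eventually_gt_atTop 0, h3] with n hn hc
    have hn : (0:ℝ) < n := by exact_mod_cast hn
    rw [← Real.log_div hc.ne' hn.ne']
    congr 1; field_simp
  refine tendsto_of_tendsto_of_tendsto_of_le_of_le' (hlog (x - 1)) (hlog x) ?_ ?_
  · filter_upwards [eventually_gt_atTop 0] with n hn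
    have hn : (1:ℝ) ≤ n := by exact_mod_cast hn
    have := DG_lb (x := x - 1 + n) (by linarith)
    rw [show x - 1 + n + 1 = x + n by ring] at this
    linarith
  · filter_upwards with n
    have := DG_ub (x := x + n) (by positivity)
    linarith

lemma DG_sum (x : ℝ) (hx : 0 ≤ x) :
    HasSum (fun k : ℕ => 1 / (k + 1 : ℝ) - 1 / (x + (k + 1))) (DG (1 + x) + Real.eulerMascheroniConstant) := by
  rw [hasSum_iff_tendsto_nat_of_nonneg]
  · have h1 := (DG_diff_tendsto 1 (by norm_num)).sub (DG_diff_tendsto (1 + x) (by linarith))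
    have h2 := h1.const_add (DG (1 + x) + Real.eulerMascheroniConstant)
    simp only [sub_zero, add_zero] at h2
    refine h2.congr fun n => ?_
    rw [DG_mul 1 (by norm_num), DG_mul (1 + x) (by linarith), DG_one, Finset.sum_sub_distrib]
    have e1 : ∑ k ∈ Finset.range n, 1 / (1 + (k:ℝ)) = ∑ k ∈ Finset.range n, 1 / ((k:ℝ) + 1) :=
      Finset.sum_congr rfl fun k _ => by rw [add_comm]
    have e2 : ∑ k ∈ Finset.range n, 1 / (1 + x + (k:ℝ)) = ∑ k ∈ Finset.range n, 1 / (x + ((k:ℝ) + 1)) :=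
      Finset.sum_congr rfl fun k _ => by congr 1; ring
    rw [e1, e2]; ring
  · intro k
    rw [sub_nonneg]
    exact one_div_le_one_div_of_le (by positivity) (by linarith)

/-- `ψ(y) ≤ log y - 1/(2y)` -/
lemma DG_ub2 {y : ℝ} (hy : 0 < y) : DG y ≤ Real.log y - 1 / (2 * y) := by
  let f : ℕ → ℝ := fun n => Real.log (y + n) - 1 / (2 * (y + n)) - DG (y + n)
  have hanti : Antitone f := by
    refine antitone_nat_of_succ_le fun n => ?_
    simp only [f]
    set z : ℝ := y + n with hz
    have hz0 : 0 < z := by positivity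
    rw [show y + ((n + 1 : ℕ) : ℝ) = z + 1 by push_cast; ring, DG_rec z hz0]
    -- log(z+1) - log z ≤ (1/z + 1/(z+1))/2
    have h1 : Real.log (z + 1) - Real.log z ≤ (1 / z + 1 / (z + 1)) / 2 := by
      have key : ∀ t : ℝ, 0 ≤ t → Real.log (1 + t) ≤ (t + t / (1 + t)) / 2 := by
        intro t ht
        have hm : MonotoneOn (fun t : ℝ => (t + t / (1 + t)) / 2 - Real.log (1 + t)) (Set.Ici 0) := by
          have hd : ∀ t : ℝ, 0 ≤ t → HasDerivAt (fun t : ℝ => (t + t / (1 + t)) / 2 - Real.log (1 + t))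
              ((1 + (1 * (1 + t) - t * 1) / (1 + t) ^ 2) / 2 - 1 / (1 + t)) t := by
            intro t ht
            have h0 : HasDerivAt (fun t : ℝ => 1 + t) 1 t := (hasDerivAt_id t).const_add 1
            exact (((hasDerivAt_id t).add ((hasDerivAt_id t).div h0 (by positivity))).div_const 2).sub
              (h0.log (by positivity))
          refine monotoneOn_of_deriv_nonneg (convex_Ici 0) ?_ ?_ ?_
          · exact fun t ht => (hd t ht).continuousAt.continuousWithinAt
          · exact fun t ht => (hd t (interior_subset ht)).differentiableAt.differentiableWithinAt
          · intro t ht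
            have ht : 0 ≤ t := interior_subset ht
            rw [(hd t ht).deriv]
            have : (1 + (1 * (1 + t) - t * 1) / (1 + t) ^ 2) / 2 - 1 / (1 + t) = t ^ 2 / (2 * (1 + t) ^ 2) := by
              field_simp; ring
            rw [this]; positivity
        have := hm (Set.mem_Ici.2 le_rfl) (Set.mem_Ici.2 ht) ht
        simp at this
        linarith
      have h2 := key (1 / z) (by positivity)
      rw [← Real.log_div (by positivity) hz0.ne', show (z + 1) / z = 1 + 1 / z by field_simp]
      refine h2.trans (le_of_eq ?_)
      field_simp
    have h3 : 1 / (2 * (z + 1)) = (1 / (z + 1)) / 2 := by field_simp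
    have h4 : 1 / (2 * z) = (1 / z) / 2 := by field_simp
    rw [h3, h4]; linarith
  have hlim : Tendsto f atTop (𝓝 0) := by
    have h1 := DG_diff_tendsto y hy
    have h2 : Tendsto (fun n : ℕ => Real.log (y + n) - Real.log n) atTop (𝓝 0) := by
      have h3 := DG_diff_tendsto y hy
      have h4 := DG_diff_tendsto (y+1) (by linarith)
      refine tendsto_of_tendsto_of_tendsto_of_le_of_le h3 h4 ?_ ?_
      · intro n
        have := DG_ub (x := y + n) (by positivity)
        simp only; linarith
      · intro n
        have := DG_lb (x := y + n) (by positivity)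
        rw [show y + n + 1 = y + 1 + n by ring] at this
        simp only; linarith
    have h5 : Tendsto (fun n : ℕ => 1 / (2 * (y + n))) atTop (𝓝 0) := by
      refine tendsto_const_nhds.div_atTop ?_
      exact (tendsto_atTop_add_const_left _ y tendsto_natCast_atTop_atTop).const_mul_atTop (by norm_num)
    have := (h2.sub h5).sub h1
    simp only [sub_zero] at this
    refine this.congr fun n => ?_
    simp only [f]; ring
  have := hanti.le_of_tendsto hlim 0
  simp only [f, Nat.cast_zero, add_zero] at this
  linarith

lemma logDeriv_Gamma_real {x : ℝ} (hx : 0 < x) : logDeriv Complex.Gamma x = (DG x : ℂ) := by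
  have hne : ∀ m : ℕ, (x:ℂ) ≠ -m := by
    intro m h
    have := congrArg Complex.re h
    simp at this
    have := Nat.cast_nonneg (α := ℝ) m; linarith
  have hne' : ∀ m : ℕ, x ≠ -m := by
    intro m h
    have := Nat.cast_nonneg (α := ℝ) m; linarith
  have h1 := (Complex.differentiableAt_Gamma x hne).hasDerivAt.comp_ofReal
  have h2 : HasDerivAt (fun y : ℝ => Complex.Gamma y) ((deriv Real.Gamma x : ℝ) : ℂ) x := by
    have := ((Real.differentiableAt_Gamma hne').hasDerivAt).ofReal_comp
    refine this.congr_of_eventuallyEq (Eventually.of_forall fun y => ?_)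
    exact Complex.Gamma_ofReal y
  rw [logDeriv_apply, h1.unique h2, Complex.Gamma_ofReal]
  unfold DG
  rw [Function.comp_def, deriv.log (Real.differentiableAt_Gamma hne') (Real.Gamma_pos_of_pos hx).ne']
  push_cast; rfl

noncomputable def VM (s : ℝ) : ℝ := ∑' n : ℕ, ArithmeticFunction.vonMangoldt n * Real.exp (-s * Real.log n)

lemma VM_term (s : ℝ) (n : ℕ) : LSeries.term (fun n => (ArithmeticFunction.vonMangoldt n : ℂ)) s n =
    ((ArithmeticFunction.vonMangoldt n * Real.exp (-s * Real.log n) : ℝ) : ℂ) := by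
  rcases eq_or_ne n 0 with rfl | hn
  · simp
  · have hn0 : (0:ℝ) < n := by positivity
    rw [LSeries.term_of_ne_zero hn, mul_comm (-s), show Real.log n * -s = Real.log n * (-s) by ring,
      ← Real.rpow_def_of_pos hn0]
    push_cast
    rw [Complex.ofReal_cpow hn0.le]
    push_cast
    rw [Complex.cpow_neg, div_eq_mul_inv]

lemma VM_summable {s : ℝ} (hs : 1 < s) :
    Summable (fun n : ℕ => ArithmeticFunction.vonMangoldt n * Real.exp (-s * Real.log n)) := by
  have h := ArithmeticFunction.LSeriesSummable_vonMangoldt (s := s) (by simpa using hs)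
  unfold LSeriesSummable at h
  exact Complex.summable_ofReal.1 (h.congr (VM_term s))

lemma VM_eq {s : ℝ} (hs : 1 < s) : (VM s : ℂ) = - logDeriv riemannZeta s := by
  have h := ArithmeticFunction.LSeries_vonMangoldt_eq_deriv_riemannZeta_div (s := s) (by simpa using hs)
  unfold LSeries at h
  rw [tsum_congr (VM_term s), ← Complex.ofReal_tsum] at h
  unfold VM
  rw [h, logDeriv_apply]; ring

lemma hh_eq {s : ℝ} (hs : 1 < s) :
    hh (s - 1/2) = 1 / (s - 1) - Real.log π / 2 + DG (1 + s / 2) / 2 - VM s := by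
  have hs0 : (0:ℝ) < s := by linarith
  have hev : ∀ᶠ z : ℂ in 𝓝 (s:ℂ), 1 < z.re :=
    (Complex.continuous_re.tendsto (s:ℂ)).eventually (lt_mem_nhds (by simpa using hs))
  have hE : (fun z : ℂ => xiF (z - 1/2)) =ᶠ[𝓝 (s:ℂ)]
      fun z => (2 * (z - 1)) * (((π : ℂ) ^ (-z / 2)) * (Complex.Gamma (z / 2 + 1) * riemannZeta z)) := by
    filter_upwards [hev] with z hz
    have hz0 : z ≠ 0 := by rintro rfl; simp at hz; linarith
    have hz1 : z ≠ 1 := by rintro rfl; simp at hz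
    rw [xiF_eq hz0 hz1, riemannZeta_def_of_ne_zero hz0, Complex.Gammaℝ_def, Complex.Gamma_add_one _ (by simpa using hz0)]
    have h1 : (π : ℂ) ^ (-z / 2) ≠ 0 := by
      rw [Ne, Complex.cpow_eq_zero_iff]; simp [Real.pi_ne_zero]
    have h2 : Complex.Gamma (z / 2) ≠ 0 := Complex.Gamma_ne_zero_of_re_pos (by simp; linarith)
    field_simp
  have hne1 : (s:ℂ) ≠ 1 := by exact_mod_cast hs.ne'
  have hz := riemannZeta_ne_zero_of_one_lt_re (s := s) (by simpa using hs)
  have hdz : DifferentiableAt ℂ riemannZeta s := differentiableAt_riemannZeta hne1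
  have hG0 : Complex.Gamma ((s:ℂ) / 2 + 1) ≠ 0 :=
    Complex.Gamma_ne_zero_of_re_pos (by simp; linarith)
  have hGne : ∀ m : ℕ, (s:ℂ)/2 + 1 ≠ -m := by
    intro m h
    have := congrArg Complex.re h
    simp at this
    have := Nat.cast_nonneg (α := ℝ) m; linarith
  have hdG0 : DifferentiableAt ℂ Complex.Gamma ((s:ℂ)/2+1) := Complex.differentiableAt_Gamma _ hGne
  have hlin : HasDerivAt (fun z : ℂ => z / 2 + 1) (1/2) (s:ℂ) := ((hasDerivAt_id _).div_const 2).add_const 1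
  have hdG : HasDerivAt (fun z : ℂ => Complex.Gamma (z / 2 + 1)) (deriv Complex.Gamma ((s:ℂ)/2+1) * (1/2)) s :=
    HasDerivAt.comp (s:ℂ) (h₂ := Complex.Gamma) hdG0.hasDerivAt hlin
  have hpi0 : (π : ℂ) ^ (-(s:ℂ) / 2) ≠ 0 := by
    rw [Ne, Complex.cpow_eq_zero_iff]; simp [Real.pi_ne_zero]
  have hdpi : HasDerivAt (fun z : ℂ => (π : ℂ) ^ (-z / 2))
      ((π : ℂ) ^ (-(s:ℂ) / 2) * Complex.log π * (-1/2)) s :=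
    HasDerivAt.const_cpow (((hasDerivAt_id (s:ℂ)).neg).div_const 2) (Or.inl (by simp [Real.pi_ne_zero]))
  have hd1 : HasDerivAt (fun z : ℂ => 2 * (z - 1)) (2 * 1) (s:ℂ) := ((hasDerivAt_id _).sub_const 1).const_mul 2
  have h1 : logDeriv (fun z : ℂ => xiF (z - 1/2)) s = 1 / (s - 1) + (-(Complex.log π) / 2 +
      (logDeriv Complex.Gamma ((s:ℂ)/2+1) / 2 + logDeriv riemannZeta s)) := by
    have e0 : logDeriv (fun z : ℂ => xiF (z - 1/2)) s = logDeriv (fun z => (2 * (z - 1)) * (((π : ℂ) ^ (-z / 2)) * (Complex.Gamma (z / 2 + 1) * riemannZeta z))) s := by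
      rw [logDeriv_apply, logDeriv_apply, hE.deriv_eq, hE.eq_of_nhds]
    have hs1 : (s:ℂ) - 1 ≠ 0 := sub_ne_zero.2 hne1
    have m3 := logDeriv_mul (f := fun z : ℂ => Complex.Gamma (z / 2 + 1)) (g := riemannZeta) (s:ℂ) hG0 hz
      hdG.differentiableAt hdz
    have m2 := logDeriv_mul (f := fun z : ℂ => (π : ℂ) ^ (-z / 2))
      (g := fun z => Complex.Gamma (z / 2 + 1) * riemannZeta z) (s:ℂ) hpi0 (mul_ne_zero hG0 hz)
      hdpi.differentiableAt (hdG.differentiableAt.mul hdz)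
    have m1 := logDeriv_mul (f := fun z : ℂ => 2 * (z - 1))
      (g := fun z => (π : ℂ) ^ (-z / 2) * (Complex.Gamma (z / 2 + 1) * riemannZeta z)) (s:ℂ)
      (by simpa using hs1) (mul_ne_zero hpi0 (mul_ne_zero hG0 hz))
      hd1.differentiableAt (hdpi.differentiableAt.mul (hdG.differentiableAt.mul hdz))
    rw [e0, m1, m2, m3]
    congr 1
    · rw [logDeriv_apply, hd1.deriv]; field_simp
    congr 1
    · rw [logDeriv_apply, hdpi.deriv]; field_simp
    congr 1
    rw [logDeriv_apply, hdG.deriv, logDeriv_apply]; ring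
  have h2 : logDeriv (fun z : ℂ => xiF (z - 1/2)) s = deriv xiF ((s - 1/2 : ℝ) : ℂ) / xiF ((s - 1/2 : ℝ) : ℂ) := by
    rw [logDeriv_apply, deriv_comp_sub_const]; push_cast; rfl
  have h3 : logDeriv Complex.Gamma ((s:ℂ)/2+1) = (DG (1 + s/2) : ℂ) := by
    rw [← logDeriv_Gamma_real (by linarith)]; push_cast; rw [add_comm]
  have h4 : logDeriv riemannZeta s = ((-VM s : ℝ) : ℂ) := by push_cast; rw [VM_eq hs, neg_neg]
  unfold hh
  rw [← h2, h1, h3, h4, ← Complex.ofReal_log Real.pi_pos.le,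
    show (1 / ((s:ℂ) - 1) + (-(Real.log π : ℂ) / 2 + ((DG (1 + s/2) : ℂ) / 2 + ((-VM s : ℝ) : ℂ)))) =
    ((1 / (s - 1) + (-(Real.log π) / 2 + (DG (1 + s/2) / 2 + -VM s)) : ℝ) : ℂ) by push_cast; ring,
    Complex.ofReal_re]
  ring
end PB

namespace PB
open Complex Filter Topology MeasureTheory

/-- ordinates of zeros -/
abbrev ZZ := {γ : ℝ // mm γ ≠ 0}

lemma ZZ_countable (hRH : RiemannHypothesis) : Countable ZZ := by
  have h := (mm_sq_summable hRH).1.countable_support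
  refine Set.Countable.to_subtype (h.mono fun γ hγ => ?_)
  have := mm_ne hγ
  simp only [Function.mem_support]
  exact div_ne_zero hγ (by positivity)

lemma ZZ_sum {f : ℝ → ℝ} {a : ℝ} (h : HasSum (fun γ => mm γ * f γ) a) :
    HasSum (fun γ : ZZ => mm γ * f γ) a := by
  refine (hasSum_subtype_iff_of_support_subset (s := {γ | mm γ ≠ 0}) ?_).2 h
  intro γ hγ
  exact left_ne_zero_of_mul hγ

lemma ZZ_summable (hRH : RiemannHypothesis) : Summable (fun γ : ZZ => mm γ / (γ:ℝ) ^ 2) :=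
  (mm_sq_summable hRH).1.comp_injective Subtype.val_injective

noncomputable def rho (γ : ℝ) : ℂ := 1/2 + γ * I

lemma rho_re (γ : ℝ) : (rho γ).re = 1/2 := by simp [rho]

lemma rho_im (γ : ℝ) : (rho γ).im = γ := by simp [rho]

lemma rho_ne (γ : ℝ) : rho γ ≠ 0 := by
  intro h; have := congrArg Complex.re h; simp [rho] at this

lemma rho_normSq (γ : ℝ) : Complex.normSq (rho γ) = 1/4 + γ ^ 2 := by
  rw [Complex.normSq_apply, rho_re, rho_im]; ring

lemma rho_norm_sq (γ : ℝ) : ‖rho γ‖ ^ 2 = 1/4 + γ ^ 2 := by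
  rw [← Complex.normSq_eq_norm_sq, rho_normSq]

lemma sq_le_rho (γ : ℝ) : γ ^ 2 ≤ ‖rho γ‖ ^ 2 := by rw [rho_norm_sq]; linarith

lemma inv_rho_re (γ : ℝ) : (1 / rho γ).re = (1/2) / ((1/2) ^ 2 + γ ^ 2) := by
  rw [one_div, Complex.inv_re, rho_normSq, rho_re]; norm_num

/-- `Re (e^{ρu}/ρ²)` -/
noncomputable def er (γ u : ℝ) : ℝ := (1 / rho γ ^ 2 * Complex.exp (rho γ * u)).re

lemma er_bd {γ : ℝ} (h : mm γ ≠ 0) (u : ℝ) : |er γ u| ≤ Real.exp (u / 2) / γ ^ 2 := by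
  unfold er
  have h0 := mm_ne h
  refine (Complex.abs_re_le_norm _).trans ?_
  rw [norm_mul, Complex.norm_exp, norm_div, norm_pow, norm_one]
  have : (rho γ * u).re = u / 2 := by simp [rho]; ring
  rw [this, one_div_mul_eq_div]
  exact div_le_div_of_nonneg_left (Real.exp_pos _).le (by linarith) (sq_le_rho γ)

noncomputable def EE (u : ℝ) : ℝ := ∑' γ : ZZ, mm γ * er γ u

lemma EE_summable (hRH : RiemannHypothesis) (u : ℝ) : Summable (fun γ : ZZ => mm γ * er γ u) := by
  refine Summable.of_norm_bounded ((ZZ_summable hRH).mul_right (Real.exp (u / 2))) fun γ => ?_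
  rw [norm_mul, Real.norm_eq_abs, Real.norm_eq_abs, abs_of_nonneg (mm_nonneg _)]
  calc _ ≤ mm γ * (Real.exp (u / 2) / (γ:ℝ) ^ 2) :=
        mul_le_mul_of_nonneg_left (er_bd γ.2 u) (mm_nonneg _)
    _ = _ := by ring

lemma EE_abs (hRH : RiemannHypothesis) (u : ℝ) : |EE u| ≤ 0.04792 * Real.exp (u / 2) := by
  have hs := EE_summable hRH u
  have h1 : |EE u| ≤ ∑' γ : ZZ, |mm γ * er γ u| := by
    exact norm_tsum_le_tsum_norm (f := fun γ : ZZ => mm γ * er γ u) hs.abs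
  refine h1.trans ?_
  have h2 : ∑' γ : ZZ, |mm γ * er γ u| ≤ ∑' γ : ZZ, mm γ / (γ:ℝ) ^ 2 * Real.exp (u / 2) := by
    refine hs.abs.tsum_le_tsum (fun γ => ?_) ((ZZ_summable hRH).mul_right _)
    rw [abs_mul, abs_of_nonneg (mm_nonneg _)]
    calc _ ≤ mm γ * (Real.exp (u / 2) / (γ:ℝ) ^ 2) :=
          mul_le_mul_of_nonneg_left (er_bd γ.2 u) (mm_nonneg _)
      _ = _ := by ring
  rw [tsum_mul_right] at h2
  refine h2.trans (mul_le_mul_of_nonneg_right ?_ (Real.exp_pos _).le)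
  refine le_trans ?_ (mm_sq_summable hRH).2
  exact Summable.tsum_subtype_le (fun γ : ℝ => mm γ / γ ^ 2) {γ | mm γ ≠ 0}
    (fun γ => div_nonneg (mm_nonneg γ) (sq_nonneg γ)) (mm_sq_summable hRH).1

noncomputable def PP (u : ℝ) : ℝ :=
  ∑' n : ℕ, ArithmeticFunction.vonMangoldt n * max (u - Real.log n) 0

lemma max_le_exp (x : ℝ) : max x 0 ≤ Real.exp (2 * x) := by
  apply max_le _ (Real.exp_pos _).le
  have := Real.add_one_le_exp (2 * x)
  by_cases h : 0 ≤ x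
  · linarith
  · have := Real.exp_pos (2 * x); linarith

lemma PP_lp : Lp PP (fun s => VM s / s ^ 2) := by
  have h := Lp.tsum (f := fun (n : ℕ) u => ArithmeticFunction.vonMangoldt n * max (u - Real.log n) 0)
    (F := fun (n:ℕ) s => ArithmeticFunction.vonMangoldt n * (Real.exp (-s * Real.log n) / s ^ 2))
    (VM_summable (s := 2) (by norm_num))
    (fun n => (Lp.ramp (Real.log_natCast_nonneg n)).smul _) ?_
  · refine h.congr fun s hs => ?_
    unfold VM
    rw [← tsum_div_const]
    exact tsum_congr fun n => by ring
  · intro n u hu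
    have hL : 0 ≤ ArithmeticFunction.vonMangoldt n := ArithmeticFunction.vonMangoldt_nonneg
    rw [abs_mul, abs_of_nonneg hL, abs_of_nonneg (le_max_right _ _), mul_assoc, ← Real.exp_add]
    refine mul_le_mul_of_nonneg_left ((max_le_exp _).trans (le_of_eq ?_)) hL
    congr 1; ring

lemma Lp.congr_left {g f G : ℝ → ℝ} (h : Lp g G) (e : ∀ u, 0 ≤ u → g u = f u) : Lp f G := by
  refine ⟨h.1.congr fun u hu => (e u hu).symm, ?_, fun s hs => ?_⟩
  · obtain ⟨C, hC⟩ := h.2.1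
    exact ⟨C, fun u hu => by rw [← e u hu]; exact hC u hu⟩
  · rw [← h.2.2 s hs]
    refine setIntegral_congr_fun measurableSet_Ioi fun u hu => ?_
    rw [e u (le_of_lt hu)]

lemma Lp.id : Lp (fun u => u) (fun s => 1 / s ^ 2) := by
  refine ((Lp.ramp le_rfl).congr_left fun u hu => ?_).congr fun s hs => ?_
  · simp [hu]
  · simp

lemma Lp.rexp (c a : ℝ) (ha : a ≤ 2) :
    Lp (fun u => c * Real.exp (a * u)) (fun s => c / (s - a)) := by
  refine ((Lp.exp c a (by simpa using ha)).congr_left fun u hu => ?_).congr fun s hs => ?_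
  · rw [← Complex.ofReal_mul, ← Complex.ofReal_exp, ← Complex.ofReal_mul, Complex.ofReal_re]
  · rw [← Complex.ofReal_sub, ← Complex.ofReal_div, Complex.ofReal_re]

noncomputable def rr (u : ℝ) : ℝ := ∑' k : ℕ, (1 - Real.exp (-(2 * (k + 1)) * u)) / (4 * (k + 1 : ℝ) ^ 2)

lemma sq_summ : Summable (fun k : ℕ => 1 / (k + 1 : ℝ) ^ 2) := by
  have := (summable_nat_add_iff 1).2 (Real.summable_one_div_nat_pow.2 (by norm_num : 1 < 2))
  simpa using this

lemma rr_term_bd (k : ℕ) {u : ℝ} (hu : 0 ≤ u) :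
    |(1 - Real.exp (-(2 * (k + 1)) * u)) / (4 * (k + 1 : ℝ) ^ 2)| ≤ 1 / (k + 1 : ℝ) ^ 2 := by
  have h1 : Real.exp (-(2 * (k + 1)) * u) ≤ 1 := Real.exp_le_one_iff.2 (by
    have : 0 ≤ (2 * (k + 1:ℝ)) * u := by positivity
    linarith)
  have h2 := Real.exp_pos (-(2 * (k + 1)) * u)
  rw [abs_div, abs_of_nonneg (by linarith), abs_of_pos (by positivity : 0 < 4 * (k + 1 : ℝ) ^ 2)]
  rw [div_le_div_iff₀ (by positivity) (by positivity)]
  have : 0 < (k + 1 : ℝ) ^ 2 := by positivity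
  nlinarith

lemma rr_summable {u : ℝ} (hu : 0 ≤ u) :
    Summable (fun k : ℕ => (1 - Real.exp (-(2 * (k + 1)) * u)) / (4 * (k + 1 : ℝ) ^ 2)) :=
  Summable.of_norm_bounded sq_summ fun k => rr_term_bd k hu

lemma rr_lp : Lp rr (fun s => (DG (1 + s / 2) + Real.eulerMascheroniConstant) / 2 / s ^ 2) := by
  have hk : ∀ k : ℕ, Lp (fun u => (1 - Real.exp (-(2 * (k + 1)) * u)) / (4 * (k + 1 : ℝ) ^ 2))
      (fun s => (1 / (k + 1 : ℝ) - 1 / (s / 2 + (k + 1))) / 2 / s ^ 2) := by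
    intro k
    have h := (Lp.rexp (1 / (4 * (k + 1 : ℝ) ^ 2)) 0 (by norm_num)).add
      (Lp.rexp (-1 / (4 * (k + 1 : ℝ) ^ 2)) (-(2 * (k + 1))) (by
        have : (0:ℝ) ≤ k := Nat.cast_nonneg k
        linarith))
    refine (h.congr_left fun u hu => ?_).congr fun s hs => ?_
    · rw [zero_mul, Real.exp_zero]; ring
    · have : (0:ℝ) < s := by linarith
      have h2 : s - -(2 * ((k:ℝ) + 1)) ≠ 0 := by
        have : (0:ℝ) ≤ k := Nat.cast_nonneg k
        linarith
      have h3 : s / 2 + ((k:ℝ) + 1) ≠ 0 := by positivity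
      have h4 : s + 2 * ((k:ℝ) + 1) ≠ 0 := by positivity
      rw [sub_zero, sub_neg_eq_add, show s / 2 + ((k:ℝ) + 1) = (s + 2 * ((k:ℝ) + 1)) / 2 by ring]
      field_simp
      ring
  refine (Lp.tsum sq_summ hk fun k u hu => ?_).congr fun s hs => ?_
  · refine (rr_term_bd k hu).trans (le_mul_of_one_le_right (by positivity) ?_)
    exact Real.one_le_exp (by linarith)
  · have := DG_sum (s/2) (by linarith)
    rw [tsum_div_const, tsum_div_const, this.tsum_eq]

lemma EE_lp (hRH : RiemannHypothesis) :
    Lp (fun u => EE u - EE 0 - KK 1 * u) (fun s => hh (s - 1/2) / s ^ 2) := by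
  have := ZZ_countable hRH
  have hk : ∀ γ : ZZ, Lp (fun u => mm γ * (er γ u - er γ 0 - ((1/2) / ((1/2) ^ 2 + (γ:ℝ) ^ 2)) * u))
      (fun s => mm γ * ((s - 1/2) / ((s - 1/2) ^ 2 + (γ:ℝ) ^ 2)) / s ^ 2) := by
    intro γ
    set ρ := rho γ with hρ
    have h := (((Lp.exp (1 / ρ ^ 2) ρ (by rw [rho_re]; norm_num)).add
      (Lp.exp (-1 / ρ ^ 2) 0 (by norm_num))).add (Lp.id.smul (-(1 / ρ).re))).smul (mm γ)
    refine (h.congr_left fun u hu => ?_).congr fun s hs => ?_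
    · rw [← inv_rho_re]
      unfold er
      simp only [zero_mul, Complex.ofReal_zero, mul_zero, Complex.exp_zero, mul_one]
      rw [neg_div, Complex.neg_re]; ring
    · rw [mul_div_assoc]
      congr 1
      have hs0 : (s:ℂ) ≠ 0 := by exact_mod_cast (by linarith : s ≠ 0)
      have hsr : (s:ℂ) - ρ ≠ 0 := by
        intro h; have := congrArg Complex.re h
        simp [hρ, rho_re] at this; linarith
      have hr := rho_ne γ
      rw [← hρ] at hr
      have e1 : (1 / ρ ^ 2 / (s - ρ) + -1 / ρ ^ 2 / (s - 0)) + -(1 / ρ) * (1 / (s:ℂ) ^ 2) =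
          1 / (s - ρ) * ((1 / s ^ 2 : ℝ) : ℂ) := by
        push_cast
        field_simp
        ring
      have e2 := congrArg Complex.re e1
      rw [Complex.re_mul_ofReal, Complex.add_re, Complex.add_re,
        show (1 / (s:ℂ) ^ 2) = ((1 / s ^ 2 : ℝ) : ℂ) by push_cast; rfl, Complex.re_mul_ofReal,
        Complex.neg_re] at e2
      rw [e2]
      have e3 : (1 / ((s:ℂ) - ρ)).re = (s - 1/2) / ((s - 1/2) ^ 2 + (γ:ℝ) ^ 2) := by
        rw [one_div, Complex.inv_re, Complex.normSq_apply, Complex.sub_re, Complex.sub_im, hρ, rho_re, rho_im]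
        simp; ring
      rw [e3]; ring
  have hS : Summable (fun γ : ZZ => 3 * (mm γ / (γ:ℝ) ^ 2)) := (ZZ_summable hRH).mul_left 3
  refine ((Lp.tsum hS hk fun γ u hu => ?_).congr_left fun u hu => ?_).congr fun s hs => ?_
  · rw [abs_mul, abs_of_nonneg (mm_nonneg _)]
    have h0 := mm_ne γ.2
    have h1 := er_bd γ.2 u
    have h2 := er_bd γ.2 0
    rw [zero_div, Real.exp_zero] at h2
    have h3 : Real.exp (u / 2) ≤ Real.exp (2 * u) := Real.exp_le_exp.2 (by linarith)
    have h4 := Real.add_one_le_exp (2 * u)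
    have h5 : 0 ≤ ((1:ℝ)/2) / ((1/2) ^ 2 + (γ:ℝ) ^ 2) := by positivity
    have h6 : ((1:ℝ)/2) / ((1/2) ^ 2 + (γ:ℝ) ^ 2) ≤ 1 / (γ:ℝ)^2 :=
      div_le_div₀ (by norm_num) (by norm_num) (by linarith) (by linarith)
    have h7 : 0 < 1 / (γ:ℝ)^2 := by have : (0:ℝ) < (γ:ℝ)^2 := by linarith
                                    positivity
    have h8 : |er γ u - er γ 0 - ((1/2) / ((1/2) ^ 2 + (γ:ℝ) ^ 2)) * u| ≤ 3 * (1 / (γ:ℝ)^2) * Real.exp (2 * u) := by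
      have a1 : |er γ u| ≤ 1 / (γ:ℝ)^2 * Real.exp (2 * u) := by
        refine h1.trans ?_
        rw [div_eq_mul_one_div, mul_comm]
        exact mul_le_mul_of_nonneg_left h3 h7.le
      have a2 : |er γ 0| ≤ 1 / (γ:ℝ)^2 * Real.exp (2 * u) := by nlinarith
      have a3 : ((1/2) / ((1/2) ^ 2 + (γ:ℝ) ^ 2)) * u ≤ 1 / (γ:ℝ)^2 * Real.exp (2 * u) :=
        mul_le_mul h6 (by linarith) hu h7.le
      have a4 : 0 ≤ ((1/2) / ((1/2) ^ 2 + (γ:ℝ) ^ 2)) * u := mul_nonneg h5 hu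
      rw [abs_le] at *
      constructor <;> linarith [a1.1, a1.2, a2.1, a2.2]
    calc _ ≤ mm γ * (3 * (1 / (γ:ℝ)^2) * Real.exp (2 * u)) := mul_le_mul_of_nonneg_left h8 (mm_nonneg _)
      _ = _ := by ring
  · have h1 := ZZ_sum (hh_sum hRH (w := 1/2) (by norm_num))
    rw [hh_half] at h1
    have h2 := (((EE_summable hRH u).hasSum.sub (EE_summable hRH 0).hasSum).sub (h1.mul_right u))
    unfold EE
    rw [← h2.tsum_eq]
    exact tsum_congr fun γ => by ring
  · have h1 := ZZ_sum (hh_sum hRH (w := s - 1/2) (by linarith))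
    rw [tsum_div_const, h1.tsum_eq]

noncomputable def cc : ℝ := -1 - (Real.eulerMascheroniConstant / 2 + Real.log π / 2) + KK 1

/-- Explicit formula -/
lemma explicit (hRH : RiemannHypothesis) {u : ℝ} (hu : 0 ≤ u) :
    PP u = Real.exp u + rr u + cc * u + (EE 0 - 1) - EE u := by
  have h1 := (PP_lp.add (EE_lp hRH)).add (Lp.id.smul (Real.eulerMascheroniConstant / 2 + Real.log π / 2))
  have h2 := (((Lp.rexp 1 1 (by norm_num)).add (Lp.rexp (-1) 0 (by norm_num))).add (Lp.id.smul (-1))).add rr_lp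
  have h3 := h1.congr (F := fun s => 1 / (s - 1) + -1 / (s - 0) + -1 * (1 / s ^ 2) +
      (DG (1 + s / 2) + Real.eulerMascheroniConstant) / 2 / s ^ 2) ?_
  · have := h3.unique h2 hu
    unfold cc
    rw [one_mul, zero_mul, Real.exp_zero, one_mul] at this
    linarith
  · intro s hs
    rw [hh_eq (by linarith : 1 < s)]
    have : s ≠ 0 := by linarith
    have : s - 1 ≠ 0 := by linarith
    rw [sub_zero]
    field_simp
    ring

lemma cc_bd : -2 ≤ cc ∧ cc ≤ -1.5 := by
  unfold cc
  have h1 := gamma_bd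
  have h2 := logpi_bd
  have h3 := KK_one_nonneg
  have h4 := KK_one_le
  have h5 := Real.one_half_lt_eulerMascheroniConstant
  have h6 : Real.log π ≤ 1.4 := by
    have a := Real.pi_lt_d2
    have b : Real.log π ≤ Real.log 4 := Real.log_le_log Real.pi_pos (by linarith)
    have c : Real.log 4 = 2 * Real.log 2 := by
      rw [show (4:ℝ) = 2 ^ 2 by norm_num, Real.log_pow]; norm_num
    have := Real.log_two_lt_d9
    linarith
  constructor <;> linarith
end PB

namespace PB
open Complex Filter Topology MeasureTheory

lemma Lp.mono {g f G F : ℝ → ℝ} (h : Lp g G) (k : Lp f F) (hle : ∀ u, 0 ≤ u → g u ≤ f u)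
    {s : ℝ} (hs : 4 ≤ s) : G s ≤ F s := by
  rw [← h.2.2 s hs, ← k.2.2 s hs]
  refine setIntegral_mono_on (h.int hs) (k.int hs) measurableSet_Ioi fun u hu => ?_
  exact mul_le_mul_of_nonneg_left (hle u (le_of_lt hu)) (Real.exp_pos _).le

noncomputable def SS (b : ℝ) : ℝ := ∑' γ : ZZ, mm γ / (|(γ:ℝ)| * √(b ^ 2 + (γ:ℝ) ^ 2))

lemma SS_term_le (b : ℝ) (γ : ZZ) :
    mm γ / (|(γ:ℝ)| * √(b ^ 2 + (γ:ℝ) ^ 2)) ≤ mm γ / (γ:ℝ) ^ 2 := by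
  have h0 := mm_ne γ.2
  have h1 : |(γ:ℝ)| ≤ √(b ^ 2 + (γ:ℝ) ^ 2) := Real.abs_le_sqrt (by nlinarith [sq_nonneg b])
  refine div_le_div_of_nonneg_left (mm_nonneg _) (by linarith) ?_
  calc (γ:ℝ) ^ 2 = |(γ:ℝ)| * |(γ:ℝ)| := by rw [← sq_abs, sq]
    _ ≤ _ := mul_le_mul_of_nonneg_left h1 (abs_nonneg _)

lemma SS_summable (hRH : RiemannHypothesis) (b : ℝ) :
    Summable (fun γ : ZZ => mm γ / (|(γ:ℝ)| * √(b ^ 2 + (γ:ℝ) ^ 2))) :=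
  Summable.of_nonneg_of_le (fun γ => div_nonneg (mm_nonneg _) (by positivity)) (SS_term_le b)
    (ZZ_summable hRH)

lemma SS_nonneg (b : ℝ) : 0 ≤ SS b := tsum_nonneg fun γ => div_nonneg (mm_nonneg _) (by positivity)

lemma EE_shift (hRH : RiemannHypothesis) (u σ : ℝ) (hσ : σ ^ 2 = 1) :
    ∃ T : ℝ → ℝ, Lp (fun t => EE (u + σ * t) - EE u) T ∧
      ∀ s, 4 ≤ s → |T s| ≤ Real.exp (u / 2) / s * SS (s - σ / 2) := by
  have := ZZ_countable hRH
  have hσ' : -1 ≤ σ ∧ σ ≤ 1 := by constructor <;> nlinarith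
  have hk : ∀ γ : ZZ, Lp (fun t => mm γ * (er γ (u + σ * t) - er γ u))
      (fun s => mm γ * (σ * Complex.exp (rho γ * u) / (rho γ * s * (s - σ * rho γ))).re) := by
    intro γ
    set ρ := rho γ with hρ
    have hr : ρ ≠ 0 := rho_ne γ
    have h := ((Lp.exp (1 / ρ ^ 2 * Complex.exp (ρ * u)) (σ * ρ) (by
      simp [hρ, rho_re]; linarith)).add
      (Lp.exp (-1 / ρ ^ 2 * Complex.exp (ρ * u)) 0 (by norm_num))).smul (mm γ)
    refine (h.congr_left fun t ht => ?_).congr fun s hs => ?_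
    · congr 1
      unfold er
      rw [← hρ, sub_eq_add_neg, ← Complex.neg_re]
      congr 2
      · rw [mul_assoc, ← Complex.exp_add]; congr 2; push_cast; ring
      · simp; ring
    · congr 1
      rw [← Complex.add_re]
      congr 1
      have hs0 : (s:ℂ) ≠ 0 := by exact_mod_cast (by linarith : s ≠ 0)
      have hsr : (s:ℂ) - σ * ρ ≠ 0 := by
        intro h; have := congrArg Complex.re h
        simp [hρ, rho_re] at this; linarith
      rw [sub_zero]
      rw [div_mul_eq_mul_div, div_mul_eq_mul_div, div_div, div_div,
        div_add_div _ _ (by positivity) (by positivity), div_eq_div_iff (by positivity) (by positivity)]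
      ring
  have hS : Summable (fun γ : ZZ => 2 * Real.exp (u / 2) * (mm γ / (γ:ℝ) ^ 2)) :=
    (ZZ_summable hRH).mul_left _
  have hL := Lp.tsum hS hk (fun γ t ht => ?_)
  · refine ⟨_, hL.congr_left fun t ht => ?_, fun s hs => ?_⟩
    · unfold EE
      rw [← ((EE_summable hRH (u + σ * t)).hasSum.sub (EE_summable hRH u).hasSum).tsum_eq]
      exact tsum_congr fun γ => by ring
    · have hb : ∀ γ : ZZ, |mm γ * (σ * Complex.exp (rho γ * u) / (rho γ * s * (s - σ * rho γ))).re| ≤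
          Real.exp (u / 2) / s * (mm γ / (|(γ:ℝ)| * √((s - σ / 2) ^ 2 + (γ:ℝ) ^ 2))) := by
        intro γ
        have h0 := mm_ne γ.2
        have hg : 0 < |(γ:ℝ)| := abs_pos.2 (by rintro h; rw [h] at h0; norm_num at h0)
        rw [abs_mul, abs_of_nonneg (mm_nonneg _)]
        have n1 : ‖(s:ℂ) - σ * rho γ‖ = √((s - σ / 2) ^ 2 + (γ:ℝ) ^ 2) := by
          rw [Complex.norm_eq_sqrt_sq_add_sq]
          congr 1
          simp only [Complex.sub_re, Complex.sub_im, Complex.ofReal_re, Complex.ofReal_im,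
            Complex.re_ofReal_mul, Complex.im_ofReal_mul, rho_re, rho_im]
          linear_combination (γ:ℝ)^2 * hσ
        have n2 : |(γ:ℝ)| ≤ ‖rho γ‖ := by have := Complex.abs_im_le_norm (rho γ); rwa [rho_im] at this
        have n3 : |σ| = 1 := by
          rw [← Real.sqrt_sq_eq_abs, hσ, Real.sqrt_one]
        have n4 : |(σ * Complex.exp (rho γ * u) / (rho γ * s * (s - σ * rho γ))).re| ≤
            Real.exp (u / 2) / (|(γ:ℝ)| * s * √((s - σ / 2) ^ 2 + (γ:ℝ) ^ 2)) := by
          refine (Complex.abs_re_le_norm _).trans ?_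
          have : (rho γ * u).re = u / 2 := by simp [rho]; ring
          rw [norm_div, norm_mul, norm_mul, norm_mul, Complex.norm_exp, this, n1, Complex.norm_real,
            Complex.norm_real, Real.norm_eq_abs, Real.norm_eq_abs, n3, one_mul, abs_of_pos (by linarith : 0 < s)]
          have hq : 0 < √((s - σ / 2) ^ 2 + (γ:ℝ) ^ 2) := Real.sqrt_pos.2 (by positivity)
          refine div_le_div_of_nonneg_left (Real.exp_pos _).le (by positivity) ?_
          gcongr
        refine (mul_le_mul_of_nonneg_left n4 (mm_nonneg _)).trans (le_of_eq ?_)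
        ring
      have hsum := (SS_summable hRH (s - σ / 2)).mul_left (Real.exp (u / 2) / s)
      have h1 : Summable (fun γ : ZZ => |mm γ * (σ * Complex.exp (rho γ * u) / (rho γ * s * (s - σ * rho γ))).re|) :=
        Summable.of_nonneg_of_le (fun _ => abs_nonneg _) hb hsum
      have h2 : |∑' γ : ZZ, mm γ * (σ * Complex.exp (rho γ * u) / (rho γ * s * (s - σ * rho γ))).re| ≤
          ∑' γ : ZZ, |mm γ * (σ * Complex.exp (rho γ * u) / (rho γ * s * (s - σ * rho γ))).re| :=
        norm_tsum_le_tsum_norm (f := fun γ : ZZ => mm γ * (σ * Complex.exp (rho γ * u) / (rho γ * s * (s - σ * rho γ))).re) h1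
      refine h2.trans ?_
      refine (h1.tsum_le_tsum hb hsum).trans (le_of_eq ?_)
      rw [tsum_mul_left]; rfl
  · rw [abs_mul, abs_of_nonneg (mm_nonneg _)]
    have h0 := mm_ne γ.2
    have h1 := er_bd γ.2 (u + σ * t)
    have h2 := er_bd γ.2 u
    have h3 : Real.exp ((u + σ * t) / 2) ≤ Real.exp (u / 2) * Real.exp (2 * t) := by
      rw [← Real.exp_add]; apply Real.exp_le_exp.2; nlinarith
    have h4 : Real.exp (u / 2) ≤ Real.exp (u / 2) * Real.exp (2 * t) :=
      le_mul_of_one_le_right (Real.exp_pos _).le (Real.one_le_exp (by linarith))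
    have h5 : |er γ (u + σ * t) - er γ u| ≤ 2 * (Real.exp (u / 2) * Real.exp (2 * t)) / (γ:ℝ) ^ 2 := by
      refine (abs_sub _ _).trans ((add_le_add h1 h2).trans ?_)
      rw [← add_div]
      exact div_le_div_of_nonneg_right (by linarith) (by linarith)
    calc _ ≤ mm γ * (2 * (Real.exp (u / 2) * Real.exp (2 * t)) / (γ:ℝ) ^ 2) :=
          mul_le_mul_of_nonneg_left h5 (mm_nonneg _)
      _ = _ := by ring

lemma PP_summable (u : ℝ) :
    Summable (fun n : ℕ => ArithmeticFunction.vonMangoldt n * max (u - Real.log n) 0) := by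
  refine Summable.of_nonneg_of_le (fun n => mul_nonneg ArithmeticFunction.vonMangoldt_nonneg (le_max_right _ _))
    (fun n => ?_) ((VM_summable (s := 2) (by norm_num)).mul_right (Real.exp (2 * u)))
  rw [mul_assoc, ← Real.exp_add]
  refine mul_le_mul_of_nonneg_left ((max_le_exp _).trans (le_of_eq ?_)) ArithmeticFunction.vonMangoldt_nonneg
  congr 1; ring

lemma psi_hasSum (u : ℝ) : HasSum (fun n : ℕ => ArithmeticFunction.vonMangoldt n *
    (if Real.log n ≤ u then 1 else 0)) (chebyshevPsi (Real.exp u)) := by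
  unfold chebyshevPsi
  have h : ∀ n ∉ Finset.range (⌊Real.exp u⌋₊ + 1), ArithmeticFunction.vonMangoldt n *
    (if Real.log n ≤ u then (1:ℝ) else 0) = 0 := by
    intro n hn
    simp only [Finset.mem_range, not_lt] at hn
    have h1 : Real.exp u < n := (Nat.floor_lt (Real.exp_pos u).le).1 (by omega)
    have h2 : u < Real.log n := (Real.lt_log_iff_exp_lt ((Real.exp_pos u).trans h1)).2 h1
    rw [if_neg (not_le.2 h2), mul_zero]
  have := hasSum_sum_of_ne_finset_zero (L := SummationFilter.unconditional ℕ) h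
  convert this using 1
  refine Finset.sum_congr rfl fun n hn => ?_
  rcases Nat.eq_zero_or_pos n with rfl | h0
  · simp
  · rw [if_pos, mul_one]
    have hn0 : (0:ℝ) < n := by exact_mod_cast h0
    rw [Real.log_le_iff_le_exp hn0]
    have : n ≤ ⌊Real.exp u⌋₊ := by simpa [Nat.lt_succ_iff] using hn
    exact (Nat.le_floor_iff (Real.exp_pos u).le).1 this

lemma PP_up (u : ℝ) {t : ℝ} (ht : 0 ≤ t) : t * chebyshevPsi (Real.exp u) ≤ PP (u + t) - PP u := by
  have h1 := (psi_hasSum u).mul_left t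
  have h2 := (PP_summable (u + t)).hasSum.sub (PP_summable u).hasSum
  refine hasSum_le (fun n => ?_) h1 h2
  have hL : 0 ≤ ArithmeticFunction.vonMangoldt n := ArithmeticFunction.vonMangoldt_nonneg
  rw [← mul_sub, mul_left_comm]
  refine mul_le_mul_of_nonneg_left ?_ hL
  split_ifs with h
  · rw [max_eq_left (by linarith), max_eq_left (by linarith)]; linarith
  · rw [max_eq_right (a := u - Real.log n) (by linarith)]
    simp

lemma PP_down (u : ℝ) {t : ℝ} (ht : 0 ≤ t) : PP u - PP (u - t) ≤ t * chebyshevPsi (Real.exp u) := by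
  have h1 := (psi_hasSum u).mul_left t
  have h2 := (PP_summable u).hasSum.sub (PP_summable (u - t)).hasSum
  refine hasSum_le (fun n => ?_) h2 h1
  have hL : 0 ≤ ArithmeticFunction.vonMangoldt n := ArithmeticFunction.vonMangoldt_nonneg
  rw [← mul_sub, mul_left_comm]
  refine mul_le_mul_of_nonneg_left ?_ hL
  split_ifs with h
  · rw [max_eq_left (a := u - Real.log n) (by linarith)]
    have := le_max_left (u - t - Real.log n) 0
    linarith
  · rw [max_eq_right (a := u - Real.log n) (by linarith)]
    have := le_max_right (u - t - Real.log n) 0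
    linarith

lemma PP_neg {v : ℝ} (hv : v ≤ 0) : PP v = 0 := by
  unfold PP
  refine (tsum_congr fun n => ?_).trans (tsum_zero (β := ℕ))
  rw [max_eq_right, mul_zero]
  have := Real.log_natCast_nonneg n
  linarith

lemma rr_nonneg {u : ℝ} (hu : 0 ≤ u) : 0 ≤ rr u := by
  refine tsum_nonneg fun k => div_nonneg ?_ (by positivity)
  have h1 : Real.exp (-(2 * (k + 1)) * u) ≤ 1 := Real.exp_le_one_iff.2 (by
    have : 0 ≤ (2 * (k + 1:ℝ)) * u := by positivity
    linarith)
  linarith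

lemma rr_mono {u v : ℝ} (hu : 0 ≤ u) (huv : u ≤ v) : rr u ≤ rr v := by
  refine (rr_summable hu).tsum_le_tsum (fun k => ?_) (rr_summable (hu.trans huv))
  refine div_le_div_of_nonneg_right ?_ (by positivity)
  have : Real.exp (-(2 * (k + 1:ℝ)) * v) ≤ Real.exp (-(2 * (k + 1)) * u) := by
    apply Real.exp_le_exp.2
    have : (0:ℝ) ≤ k := Nat.cast_nonneg k
    nlinarith
  linarith

lemma rr_lip {u t : ℝ} (hu : 1 ≤ u) (ht : 0 ≤ t) : rr (u + t) - rr u ≤ t := by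
  have h1 := (rr_summable (u := u + t) (by linarith)).hasSum.sub (rr_summable (u := u) (by linarith)).hasSum
  have h2 : HasSum (fun k : ℕ => t / 2 * (1 / (k + 1 : ℝ) ^ 2)) (t / 2 * (π ^ 2 / 6)) := by
    have := (hasSum_nat_add_iff' 1).2 hasSum_zeta_two
    simpa using this.mul_left (t/2)
  have h3 := hasSum_le (fun k => ?_) h1 h2
  · have h4 : rr (u + t) - rr u ≤ t / 2 * (π ^ 2 / 6) := h3
    have h5 : π ^ 2 ≤ 12 := by nlinarith [Real.pi_lt_d2, Real.pi_pos]
    nlinarith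
  · set K : ℝ := k + 1 with hK
    have hK1 : 1 ≤ K := by have : (0:ℝ) ≤ k := Nat.cast_nonneg k
                           linarith
    rw [← sub_div]
    have e1 : Real.exp (-(2 * K) * (u + t)) = Real.exp (-(2 * K) * u) * Real.exp (-(2 * K) * t) := by
      rw [← Real.exp_add]; congr 1; ring
    have e2 : Real.exp (-(2 * K) * u) ≤ 1 / K := by
      rw [neg_mul, Real.exp_neg, ← one_div]
      apply one_div_le_one_div_of_le (by linarith)
      have := Real.add_one_le_exp (2 * K * u)
      nlinarith
    have e3 := Real.add_one_le_exp (-(2 * K) * t)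
    have e4 := Real.exp_pos (-(2 * K) * u)
    rw [e1]
    calc _ = Real.exp (-(2 * K) * u) * (1 - Real.exp (-(2 * K) * t)) / (4 * K ^ 2) := by ring
      _ ≤ (1 / K) * (2 * K * t) / (4 * K ^ 2) := by
        refine div_le_div_of_nonneg_right ?_ (by positivity)
        calc _ ≤ Real.exp (-(2 * K) * u) * (2 * K * t) := by
              refine mul_le_mul_of_nonneg_left ?_ e4.le
              linarith
          _ ≤ _ := mul_le_mul_of_nonneg_right e2 (by positivity)
      _ = _ := by field_simp; ring

lemma upper_pt (hRH : RiemannHypothesis) {u t : ℝ} (hu : 1 ≤ u) (ht : 0 ≤ t) :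
    t * chebyshevPsi (Real.exp u) ≤ Real.exp u * (Real.exp t - 1) - (EE (u + t) - EE u) := by
  have h1 := PP_up u ht
  rw [explicit hRH (by linarith), explicit hRH (by linarith), Real.exp_add] at h1
  have h2 := rr_lip hu ht
  have h3 := cc_bd
  nlinarith

lemma lower_pt (hRH : RiemannHypothesis) {u t : ℝ} (hu : 1 ≤ u) (ht : 0 ≤ t) :
    Real.exp u * (1 - Real.exp (-t)) - 2 * t + (EE (u - t) - EE u) - 1.1 * (Real.exp (-u) * Real.exp t)
      ≤ t * chebyshevPsi (Real.exp u) := by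
  have h1 := PP_down u ht
  have h3 := cc_bd
  have h4 : 0 < Real.exp (-u) * Real.exp t := by positivity
  have e : Real.exp (u - t) = Real.exp u * Real.exp (-t) := by rw [← Real.exp_add]; rfl
  by_cases h : t ≤ u
  · rw [explicit hRH (by linarith), explicit hRH (by linarith), e] at h1
    have h2 := rr_mono (u := u - t) (v := u) (by linarith) (by linarith)
    nlinarith
  · push Not at h
    rw [explicit hRH (by linarith), PP_neg (by linarith)] at h1
    have h2 := rr_nonneg (u := u) (by linarith)
    have h5 := abs_le.1 (EE_abs hRH 0)
    have h6 := abs_le.1 (EE_abs hRH (u - t))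
    have h7 : Real.exp ((u - t) / 2) ≤ 1 := Real.exp_le_one_iff.2 (by linarith)
    have h8 : 1 ≤ Real.exp (-u) * Real.exp t := by
      rw [← Real.exp_add]; exact Real.one_le_exp (by linarith)
    have h9 : 0 < Real.exp u * Real.exp (-t) := by positivity
    rw [zero_div, Real.exp_zero] at h5
    nlinarith

lemma psi_upper (hRH : RiemannHypothesis) {u b : ℝ} (hu : 1 ≤ u) (hb : 6 ≤ b) :
    chebyshevPsi (Real.exp u) - Real.exp u ≤
      Real.exp u / (b - 1/2) + (b + 1/2) * Real.exp (u / 2) * SS b := by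
  obtain ⟨T, hT, hTb⟩ := EE_shift hRH u 1 (by norm_num)
  have h1 := Lp.id.smul (chebyshevPsi (Real.exp u))
  have h2 := ((Lp.rexp (Real.exp u) 1 (by norm_num)).add (Lp.rexp (-Real.exp u) 0 (by norm_num))).add (hT.smul (-1))
  have h3 := h1.mono h2 (fun t ht => ?_) (s := b + 1/2) (by linarith)
  · have h4 := abs_le.1 (hTb (b + 1/2) (by linarith))
    rw [show b + 1/2 - 1/2 = b by ring] at h4
    set X := Real.exp u
    have hX : 0 < X := Real.exp_pos u
    set l := b + 1/2 with hl
    have hl0 : 0 < l := by linarith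
    have hl1 : 0 < l - 1 := by linarith
    have h5 : chebyshevPsi X ≤ l ^ 2 * (X / (l - 1) + -X / (l - 0) + Real.exp (u/2) / l * SS b) := by
      have : chebyshevPsi X = l ^ 2 * (chebyshevPsi X * (1 / l ^ 2)) := by field_simp
      rw [this]
      refine mul_le_mul_of_nonneg_left (h3.trans ?_) (by positivity)
      linarith [h4.1]
    have h6 : l ^ 2 * (X / (l - 1) + -X / (l - 0) + Real.exp (u/2) / l * SS b) =
        X + X / (l - 1) + l * Real.exp (u/2) * SS b := by
      rw [sub_zero]; field_simp; ring
    rw [h6] at h5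
    rw [show b - 1/2 = l - 1 by rw [hl]; ring]
    linarith
  · have := upper_pt hRH hu ht
    simp only [one_mul, zero_mul, Real.exp_zero]
    linarith

lemma psi_lower (hRH : RiemannHypothesis) {u b : ℝ} (hu : 1 ≤ u) (hb : 6 ≤ b) (hbu : b ≤ Real.exp u / 2) :
    Real.exp u - chebyshevPsi (Real.exp u) ≤
      Real.exp u / (b - 1/2) + (b + 1/2) * Real.exp (u / 2) * SS b + 3 := by
  obtain ⟨T, hT, hTb⟩ := EE_shift hRH u (-1) (by norm_num)
  have h1 := Lp.id.smul (chebyshevPsi (Real.exp u))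
  have h2 := (((Lp.rexp (Real.exp u) 0 (by norm_num)).add (Lp.rexp (-Real.exp u) (-1) (by norm_num))).add hT).add
    ((Lp.id.smul (-2)).add (Lp.rexp (-1.1 * Real.exp (-u)) 1 (by norm_num)))
  have h3 := h2.mono h1 (fun t ht => ?_) (s := b - 1/2) (by linarith)
  · have h4 := abs_le.1 (hTb (b - 1/2) (by linarith))
    rw [show b - 1/2 - -1/2 = b by ring, ] at h4
    rw [Real.exp_neg] at h3
    set X := Real.exp u
    have hX : 0 < X := Real.exp_pos u
    set l := b - 1/2 with hl
    have hl0 : 0 < l := by linarith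
    have hl1 : 0 < l - 1 := by linarith
    have h5 : l ^ 2 * (X / (l - 0) + -X / (l - -1) - Real.exp (u/2) / l * SS b + (-2 * (1 / l ^ 2) + -1.1 * X⁻¹ / (l - 1))) ≤ chebyshevPsi X := by
      have : chebyshevPsi X = l ^ 2 * (chebyshevPsi X * (1 / l ^ 2)) := by field_simp
      rw [this]
      refine mul_le_mul_of_nonneg_left (le_trans ?_ h3) (by positivity)
      linarith [h4.1]
    have h6 : l ^ 2 * (X / (l - 0) + -X / (l - -1) - Real.exp (u/2) / l * SS b + (-2 * (1 / l ^ 2) + -1.1 * X⁻¹ / (l - 1))) =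
        X - X / (l + 1) - l * Real.exp (u/2) * SS b - 2 - 1.1 * (l ^ 2 / (X * (l - 1))) := by
      rw [sub_zero, sub_neg_eq_add]; field_simp; ring
    rw [h6] at h5
    have h7 : l ^ 2 / (X * (l - 1)) ≤ 0.75 := by
      rw [div_le_iff₀ (by positivity)]
      nlinarith
    have h8 : X / (l + 1) ≤ X / l := div_le_div_of_nonneg_left hX.le hl0 (by linarith)
    have h9 : l * Real.exp (u/2) * SS b ≤ (b + 1/2) * Real.exp (u/2) * SS b := by
      refine mul_le_mul_of_nonneg_right (mul_le_mul_of_nonneg_right (by linarith) (Real.exp_pos _).le) (SS_nonneg b)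
    linarith
  · have := lower_pt hRH hu ht
    simp only [one_mul, zero_mul, Real.exp_zero, neg_mul]
    rw [← sub_eq_add_neg u t]
    linarith
end PB

namespace PB
open Complex Filter Topology MeasureTheory

lemma hh_ub {t : ℝ} (ht : 6.28 ≤ t) : hh t ≤ Real.log (t / (2 * π)) / 2 + 1.84 / t := by
  have ht0 : 0 < t := by linarith
  have h := hh_eq (s := t + 1/2) (by linarith)
  rw [show t + 1/2 - 1/2 = t by ring, show t + 1/2 - 1 = t - 1/2 by ring,
    show 1 + (t + 1/2)/2 = (t/2 + 1/4) + 1 by ring] at h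
  rw [DG_rec _ (by linarith)] at h
  have h1 := DG_ub2 (y := t/2 + 1/4) (by linarith)
  have hV : 0 ≤ VM (t + 1/2) := tsum_nonneg fun n => mul_nonneg ArithmeticFunction.vonMangoldt_nonneg (Real.exp_pos _).le
  have h2 : Real.log (t/2 + 1/4) ≤ Real.log (t/2) + 1 / (2 * t) := by
    rw [show t/2 + 1/4 = (t/2) * (1 + 1/(2*t)) by field_simp; ring, Real.log_mul (by positivity) (by positivity)]
    have := Real.log_le_sub_one_of_pos (show 0 < 1 + 1/(2*t) by positivity)
    linarith
  have h3 : Real.log (t / (2 * π)) = Real.log (t/2) - Real.log π := by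
    rw [← Real.log_div (by positivity) (by positivity)]; congr 1; field_simp
  have h4 : 1 / (t - 1/2) ≤ 1.09 / t := by
    rw [div_le_div_iff₀ (by linarith) ht0]; linarith
  have h5 : 1 / (t/2 + 1/4) - 1 / (2 * (t/2+1/4)) ≤ 1 / t := by
    rw [show 1 / (t/2 + 1/4) - 1 / (2 * (t/2+1/4)) = 1 / (2 * (t/2+1/4)) by field_simp; ring]
    exact one_div_le_one_div_of_le ht0 (by linarith)
  have h6 : (1.84:ℝ) / t = 1.09 / t + (1/t)/2 + (1/(2*t))/2 := by field_simp; norm_num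
  rw [h, h3, h6]
  linarith

lemma J_deriv {b γ θ : ℝ} (hγ : γ ≠ 0) (hs : 0 < Real.sin θ) :
    HasDerivAt (fun θ => -Real.arctan (|γ| / √(b^2+γ^2) * (Real.cos θ / Real.sin θ)) / (|γ| * √(b^2+γ^2)))
      (1 / (γ^2 + b^2 * Real.sin θ ^ 2)) θ := by
  have h1 : HasDerivAt (fun θ => Real.cos θ / Real.sin θ) _ θ :=
    (Real.hasDerivAt_cos θ).div (Real.hasDerivAt_sin θ) hs.ne'
  have h2 := (((h1.const_mul (|γ| / √(b^2+γ^2))).arctan).neg).div_const (|γ| * √(b^2+γ^2))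
  refine h2.congr_deriv ?_
  have hp : 0 < b^2 + γ^2 := by positivity
  have hq : √(b^2+γ^2) ^ 2 = b^2 + γ^2 := Real.sq_sqrt hp.le
  have hq0 : 0 < √(b^2+γ^2) := Real.sqrt_pos.2 hp
  have ha : |γ|^2 = γ^2 := sq_abs γ
  have ha0 : 0 < |γ| := abs_pos.2 hγ
  have hcs := Real.sin_sq_add_cos_sq θ
  have hne : 0 < γ^2 + b^2 * Real.sin θ ^ 2 := by positivity
  generalize √(b^2+γ^2) = q at *
  generalize |γ| = a at *
  generalize Real.sin θ = s at *
  generalize Real.cos θ = c at *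
  have h3 : 1 + (a / q * (c / s))^2 = (γ^2 + b^2 * s^2) / (q^2 * s^2) := by
    field_simp
    rw [ha, hq]; linear_combination γ^2 * hcs
  have h4 : -s * s - c * c = -1 := by linear_combination -hcs
  rw [h3, h4]
  field_simp

noncomputable def qq (t : ℝ) : ℝ := Real.log (t / (2 * π)) / 2 + 1.84 / t

lemma qq_mono {t b : ℝ} (ht : 6.28 ≤ t) (hb : t ≤ b) : qq t ≤ qq b := by
  have ht0 : 0 < t := by linarith
  have hb0 : 0 < b := by linarith
  unfold qq
  rw [Real.log_div ht0.ne' (by positivity), Real.log_div hb0.ne' (by positivity)]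
  have h1 := Real.log_le_sub_one_of_pos (show 0 < t / b by positivity)
  rw [Real.log_div ht0.ne' hb0.ne'] at h1
  have h2 : 1.84 / t - 1.84 / b ≤ (1 - t / b) / 2 := by
    rw [show 1.84 / t - 1.84 / b = 1.84 / t * (1 - t / b) by field_simp]
    have : 1.84 / t ≤ 1/2 := by rw [div_le_iff₀ ht0]; linarith
    have h3 : t / b ≤ 1 := by rw [div_le_one hb0]; exact hb
    nlinarith
  linarith

noncomputable def Phi (b θ : ℝ) : ℝ := (Real.log (b * Real.sin θ / (2 * π)))^2 / 4 - 1.84 / (b * Real.sin θ)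
  + qq b * (-2 * Real.log (Real.cos (θ / 2)))

lemma Phi_deriv {b θ : ℝ} (hb : 0 < b) (hs : 0 < Real.sin θ) (hc : 0 < Real.cos (θ / 2)) :
    HasDerivAt (Phi b) (qq (b * Real.sin θ) * (Real.cos θ / Real.sin θ) + qq b * ((1 - Real.cos θ) / Real.sin θ)) θ := by
  have h1 := (Real.hasDerivAt_sin θ).const_mul b
  have h2 := (((h1.div_const (2 * π)).log (by positivity)).pow 2).div_const 4
  have h3 := (h1.inv (by positivity)).const_mul 1.84
  have h4 : HasDerivAt (fun θ : ℝ => θ / 2) (1/2) θ := (hasDerivAt_id θ).div_const 2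
  have h5 := (((h4.cos).log hc.ne').const_mul (-2)).const_mul (qq b)
  have h6 := (h2.sub h3).add h5
  have hP : HasDerivAt (Phi b) _ θ := h6.congr_of_eventuallyEq (Eventually.of_forall fun y => by simp [Phi, div_eq_mul_inv])
  refine hP.congr_deriv ?_
  have e1 : Real.sin θ = 2 * Real.sin (θ/2) * Real.cos (θ/2) := by rw [← Real.sin_two_mul]; congr 1; ring
  have e2 : Real.cos θ = 2 * Real.cos (θ/2)^2 - 1 := by rw [← Real.cos_two_mul]; congr 1; ring
  have e3 := Real.sin_sq_add_cos_sq (θ/2)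
  have hs2 : Real.sin (θ/2) ≠ 0 := by intro h; rw [e1, h] at hs; simp at hs
  have h7 : (1 - Real.cos θ) / Real.sin θ = Real.sin (θ/2) / Real.cos (θ/2) := by
    rw [e2, e1]; field_simp; linear_combination -2 * e3
  rw [h7]
  unfold qq
  have hpi := Real.pi_pos
  simp only [Nat.cast_ofNat]
  field_simp
  ring

lemma S_fin (hRH : RiemannHypothesis) {b : ℝ} (hb : 100 ≤ b) (F : Finset ZZ) :
    b * ∑ γ ∈ F, mm γ / (|(γ:ℝ)| * √(b ^ 2 + (γ:ℝ) ^ 2)) ≤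
      2 / π * ((Real.log (b / (2 * π)))^2 / 4 + Real.log 2 * Real.log (b / (2 * π)) / 2 + 0.595) := by
  have hb0 : 0 < b := by linarith
  have hpi := Real.pi_gt_d6
  have hpi2 := Real.pi_lt_d6
  set τ : ℝ := 6.3 / b with hτ
  have hτ0 : 0 < τ := by positivity
  have hτ1 : τ ≤ 0.063 := by rw [hτ, div_le_iff₀ hb0]; linarith
  set θ₀ := Real.arctan τ with hθ
  have hθ0 : 0 < θ₀ := Real.arctan_pos.2 hτ0
  have hθ1 : θ₀ < π / 2 := Real.arctan_lt_pi_div_two τ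
  have hs : ∀ θ ∈ Set.Icc θ₀ (π/2), 0 < Real.sin θ := fun θ h => Real.sin_pos_of_pos_of_lt_pi (by linarith [h.1]) (by linarith [h.2])
  have hc2 : ∀ θ ∈ Set.Icc θ₀ (π/2), 0 < Real.cos (θ/2) := fun θ h => Real.cos_pos_of_mem_Ioo ⟨by linarith [h.1], by linarith [h.2]⟩
  have hs0 : 2 * π ≤ b * Real.sin θ₀ := by
    rw [hθ, Real.sin_arctan]
    have h1 : √(1 + τ^2) ≤ 1.002 := by
      rw [Real.sqrt_le_left (by norm_num)]; nlinarith
    have h2 : 0 < √(1 + τ^2) := by positivity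
    rw [hτ] at *
    rw [show b * (6.3 / b / √(1 + (6.3/b)^2)) = 6.3 / √(1 + (6.3/b)^2) by field_simp, le_div_iff₀ h2]
    nlinarith
  have hmono : MonotoneOn (fun θ => Phi b θ - b * ∑ γ ∈ F, mm γ * (-Real.arctan (|(γ:ℝ)| / √(b^2+(γ:ℝ)^2) * (Real.cos θ / Real.sin θ)) / (|(γ:ℝ)| * √(b^2+(γ:ℝ)^2)))) (Set.Icc θ₀ (π/2)) := by
    have hγ : ∀ γ : ZZ, (γ:ℝ) ≠ 0 := fun γ h => by have := mm_ne γ.2; rw [h] at this; norm_num at this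
    have hd : ∀ θ ∈ Set.Icc θ₀ (π/2), HasDerivAt (fun θ => Phi b θ - b * ∑ γ ∈ F, mm γ * (-Real.arctan (|(γ:ℝ)| / √(b^2+(γ:ℝ)^2) * (Real.cos θ / Real.sin θ)) / (|(γ:ℝ)| * √(b^2+(γ:ℝ)^2)))) ((qq (b * Real.sin θ) * (Real.cos θ / Real.sin θ) + qq b * ((1 - Real.cos θ) / Real.sin θ)) - b * ∑ γ ∈ F, mm γ * (1 / ((γ:ℝ)^2 + b^2 * Real.sin θ ^ 2))) θ := by
      intro θ h
      refine (Phi_deriv hb0 (hs θ h) (hc2 θ h)).sub (HasDerivAt.const_mul b (HasDerivAt.fun_sum fun γ _ => ?_))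
      exact (J_deriv (hγ γ) (hs θ h)).const_mul _
    refine monotoneOn_of_deriv_nonneg (convex_Icc _ _) (fun θ h => (hd θ h).continuousAt.continuousWithinAt)
      (fun θ h => ((hd θ (interior_subset h)).differentiableAt.differentiableWithinAt)) ?_
    intro θ h
    have h' := interior_subset h
    rw [(hd θ h').deriv]
    have hsp := hs θ h'
    have hs1 := Real.sin_le_one θ
    have hcp : Real.cos θ ≤ 1 := Real.cos_le_one θ
    have hss : Real.sin θ₀ ≤ Real.sin θ := Real.sin_le_sin_of_le_of_le_pi_div_two (by linarith) h'.2 h'.1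
    have hbs : 2 * π ≤ b * Real.sin θ := hs0.trans (mul_le_mul_of_nonneg_left hss hb0.le)
    have hbs1 : b * Real.sin θ ≤ b := by nlinarith
    have h1 : b * ∑ γ ∈ F, mm γ * (1 / ((γ:ℝ)^2 + b^2 * Real.sin θ ^ 2)) ≤ hh (b * Real.sin θ) / Real.sin θ := by
      rw [le_div_iff₀ hsp, Finset.mul_sum, Finset.sum_mul]
      refine (Finset.sum_le_sum fun γ _ => ?_).trans (sum_le_hasSum F (fun γ _ => ?_) (ZZ_sum (hh_sum hRH (w := b * Real.sin θ) (by positivity))))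
      · rw [mul_pow]
        apply le_of_eq
        have : (γ:ℝ)^2 + b^2 * Real.sin θ ^ 2 ≠ 0 := by positivity
        rw [add_comm (b^2 * Real.sin θ^2)]; field_simp
      · exact mul_nonneg (mm_nonneg _) (by positivity)
    have h2 : hh (b * Real.sin θ) ≤ qq (b * Real.sin θ) := hh_ub (by linarith)
    have h3 : qq (b * Real.sin θ) ≤ qq b := qq_mono (by linarith) hbs1
    have h4 : hh (b * Real.sin θ) / Real.sin θ ≤ qq (b * Real.sin θ) * (Real.cos θ / Real.sin θ) + qq b * ((1 - Real.cos θ) / Real.sin θ) := by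
      rw [show qq (b * Real.sin θ) * (Real.cos θ / Real.sin θ) + qq b * ((1 - Real.cos θ) / Real.sin θ) = (qq (b * Real.sin θ) * Real.cos θ + qq b * (1 - Real.cos θ)) / Real.sin θ by ring]
      refine div_le_div_of_nonneg_right ?_ hsp.le
      nlinarith
    linarith
  have hm := hmono (Set.left_mem_Icc.2 hθ1.le) (Set.right_mem_Icc.2 hθ1.le) hθ1.le
  simp only [Real.cos_pi_div_two, zero_div, mul_zero, Real.arctan_zero, neg_zero, Finset.sum_const_zero, sub_zero] at hm
  have hcot : Real.cos θ₀ / Real.sin θ₀ = τ⁻¹ := by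
    rw [← inv_div, ← Real.tan_eq_sin_div_cos, Real.tan_arctan]
  rw [hcot] at hm
  have key : ∀ γ ∈ F, mm γ / (|(γ:ℝ)| * √(b ^ 2 + (γ:ℝ) ^ 2)) * (π / 2) ≤ τ * (mm γ * (1 / (γ:ℝ)^2)) - mm γ * (-Real.arctan (|(γ:ℝ)| / √(b^2+(γ:ℝ)^2) * τ⁻¹) / (|(γ:ℝ)| * √(b^2+(γ:ℝ)^2))) := by
    intro γ _
    have h40 := mm_ne γ.2
    have ha0 : 0 < |(γ:ℝ)| := abs_pos.2 (fun h => by rw [h] at h40; norm_num at h40)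
    have ha : |(γ:ℝ)|^2 = (γ:ℝ)^2 := sq_abs _
    have hq0 : 0 < √(b^2+(γ:ℝ)^2) := Real.sqrt_pos.2 (by positivity)
    rw [← ha] at *
    generalize |(γ:ℝ)| = a at *
    generalize √(b^2+a^2) = q at *
    have hi := Real.arctan_inv_of_pos (show 0 < q / a * τ by positivity)
    rw [show (q / a * τ)⁻¹ = a / q * τ⁻¹ by field_simp] at hi
    rw [hi]
    have hle : Real.arctan (q / a * τ) ≤ q / a * τ := by
      have h := Real.le_tan (Real.arctan_nonneg.2 (show 0 ≤ q / a * τ by positivity)) (Real.arctan_lt_pi_div_two _)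
      rwa [Real.tan_arctan] at h
    have h1 : τ * (mm γ * (1 / a^2)) - mm γ * (-(π / 2 - Real.arctan (q / a * τ)) / (a * q)) - mm γ / (a * q) * (π / 2) = mm γ / (a * q) * (q / a * τ - Real.arctan (q / a * τ)) := by
      field_simp; ring
    have h2 : 0 ≤ mm γ / (a * q) * (q / a * τ - Real.arctan (q / a * τ)) := mul_nonneg (div_nonneg (mm_nonneg _) (by positivity)) (by linarith)
    linarith
  have hsum := Finset.sum_le_sum key
  rw [← Finset.sum_mul, Finset.sum_sub_distrib, ← Finset.mul_sum] at hsum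
  have hc1 : ∑ γ ∈ F, mm γ * (1 / (γ:ℝ)^2) ≤ 0.04792 := by
    have h1 := (mm_sq_summable hRH)
    have h2 := h1.1.hasSum
    simp only [div_eq_mul_one_div (mm _)] at h2 h1
    exact (sum_le_hasSum F (fun γ _ => mul_nonneg (mm_nonneg _) (by positivity)) (ZZ_sum h2)).trans h1.2
  have hPhi : Phi b (π/2) - Phi b θ₀ ≤ (Real.log (b / (2 * π)))^2 / 4 + Real.log 2 * Real.log (b / (2 * π)) / 2 + 0.293 := by
    unfold Phi
    rw [Real.sin_pi_div_two, mul_one, show π / 2 / 2 = π / 4 by ring, Real.cos_pi_div_four, Real.log_div (x := √2) (by positivity) (by norm_num), Real.log_sqrt (by norm_num)]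
    have h1 : Real.log (Real.cos (θ₀/2)) ≤ 0 := Real.log_nonpos (hc2 θ₀ (Set.left_mem_Icc.2 hθ1.le)).le (Real.cos_le_one _)
    have h2 : 0 ≤ qq b := by
      unfold qq
      have := Real.log_nonneg (show 1 ≤ b / (2 * π) by rw [one_le_div (by positivity)]; linarith)
      positivity
    have h3 := mul_nonpos_of_nonneg_of_nonpos h2 h1
    have h4 : 1.84 / (b * Real.sin θ₀) ≤ 0.293 := by
      rw [div_le_iff₀ (by linarith)]; linarith
    have h5 : qq b * (-2 * (Real.log 2 / 2 - Real.log 2)) = Real.log 2 * Real.log (b / (2 * π)) / 2 + Real.log 2 * (1.84 / b) := by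
      unfold qq; ring
    have h6 : Real.log 2 * (1.84 / b) ≤ 1.84 / b := by
      have := Real.log_two_lt_d9
      have h7 : 0 < 1.84 / b := by positivity
      nlinarith
    have h8 := sq_nonneg (Real.log (b * Real.sin θ₀ / (2 * π)))
    rw [h5]
    linarith
  have hbt : b * τ = 6.3 := by rw [hτ]; field_simp
  have hfin := mul_le_mul_of_nonneg_left hsum hb0.le
  rw [show 2 / π * ((Real.log (b / (2 * π)))^2 / 4 + Real.log 2 * Real.log (b / (2 * π)) / 2 + 0.595) = ((Real.log (b / (2 * π)))^2 / 4 + Real.log 2 * Real.log (b / (2 * π)) / 2 + 0.595) / (π / 2) by field_simp, le_div_iff₀ (by positivity)]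
  have : b * (τ * ∑ γ ∈ F, mm γ * (1 / (γ:ℝ)^2)) ≤ 6.3 * 0.04792 := by
    rw [← mul_assoc, hbt]; linarith
  rw [mul_sub] at hfin
  linarith

lemma SS_bd (hRH : RiemannHypothesis) {b : ℝ} (hb : 100 ≤ b) :
    b * SS b ≤ 2 / π * ((Real.log (b / (2 * π)))^2 / 4 + Real.log 2 * Real.log (b / (2 * π)) / 2 + 0.595) := by
  have hb0 : 0 < b := by linarith
  rw [mul_comm, ← le_div_iff₀ hb0]
  refine (SS_summable hRH b).tsum_le_of_sum_le fun F => ?_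
  rw [le_div_iff₀ hb0, mul_comm]
  exact S_fin hRH hb F
end PB

namespace PB
open Complex Filter Topology MeasureTheory

lemma large_ineq {L y : ℝ} (hL : 15.94 ≤ L) (hy0 : 2.768 ≤ y) (hy1 : y ≤ L / 5) :
    3.1416 * L + 4 * ((L / 2 - y + 0.2417)^2 + 1.3863 * (L / 2 - y + 0.2417) + 2.38) + 0.2 ≤ L * (L - y) := by
  have h1 : 0 ≤ (y - 2.768) * (3 * L - 4 * (y + 2.768) + 7.4) := mul_nonneg (by linarith) (by linarith)
  nlinarith

lemma exp_big {L : ℝ} (hL : 15.94 ≤ L) (hx : 2 ^ 23 ≤ Real.exp L) : 2896 ≤ Real.exp (L / 2) ∧ 5 * L ^ 3 ≤ 8 * Real.exp (L / 2) := by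
  have hE : Real.exp L = Real.exp (L/2) ^ 2 := by rw [← Real.exp_nat_mul]; congr 1; push_cast; ring
  have h1 : 2896 ≤ Real.exp (L/2) := by
    rw [hE] at hx
    have := Real.exp_pos (L/2)
    nlinarith
  refine ⟨h1, ?_⟩
  by_cases hc : L ≤ 16
  · have : L ^ 3 ≤ 16 ^ 3 := pow_le_pow_left₀ (by linarith) hc 3
    linarith
  push Not at hc
  have h16 : 2980 ≤ Real.exp 8 := by
    rw [show (8:ℝ) = (8:ℕ) * 1 by norm_num, Real.exp_nat_mul]
    have h := Real.exp_one_gt_d9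
    calc (2980:ℝ) ≤ 2.7182818283 ^ 8 := by norm_num
      _ ≤ _ := pow_le_pow_left₀ (by norm_num) h.le 8
  set z := (L - 16) / 2 with hz
  have hz0 : 0 ≤ z := by rw [hz]; linarith
  have h2 : Real.exp (L/2) = Real.exp 8 * Real.exp z := by rw [← Real.exp_add, hz]; congr 1; ring
  have h3 := Real.sum_le_exp_of_nonneg hz0 4
  simp [Finset.sum_range_succ, Nat.factorial] at h3
  have hLz : L = 16 + 2 * z := by rw [hz]; ring
  rw [h2, hLz]
  have h4 : 2980 * (1 + z + z^2/2 + z^3/6) ≤ Real.exp 8 * Real.exp z := by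
    apply mul_le_mul h16 h3 (by positivity) (by positivity)
  nlinarith [pow_nonneg hz0 2, pow_nonneg hz0 3]

set_option maxHeartbeats 1000000 in
lemma large_core {L : ℝ} (hL : 15.94 ≤ L) (hx : 2 ^ 23 ≤ Real.exp L) (S b : ℝ) (hb : b = 8 * Real.exp (L / 2) / L)
    (hS0 : 0 ≤ S)
    (hS : b * S ≤ 2 / π * ((Real.log (b / (2 * π)))^2 / 4 + Real.log 2 * Real.log (b / (2 * π)) / 2 + 0.595)) :
    Real.exp L / (b - 1/2) + (b + 1/2) * Real.exp (L/2) * S + 3 ≤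
      Real.exp (L/2) * L * (L - Real.log L) / (8 * π) := by
  obtain ⟨hE1, hE2⟩ := exp_big hL hx
  have hE : Real.exp L = Real.exp (L/2) ^ 2 := by rw [← Real.exp_nat_mul]; congr 1; push_cast; ring
  have hlE : Real.log (Real.exp (L/2)) = L / 2 := Real.log_exp _
  rw [hE]
  generalize Real.exp (L/2) = E at *
  have hE0 : 0 < E := by linarith
  have hL0 : 0 < L := by linarith
  have hb5 : 5 * L^2 ≤ b := by
    rw [hb, le_div_iff₀ hL0]; linarith
  have hb1000 : 1000 ≤ b := by nlinarith
  have hb0 : 0 < b := by linarith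
  have hpi := Real.pi_gt_d6
  have hpi2 := Real.pi_lt_d6
  have hl2 := Real.log_two_lt_d9
  have hl2' := Real.log_two_gt_d9
  have hlpi := logpi_bd
  set y := Real.log L with hy
  have hl16 : Real.log 16 = 4 * Real.log 2 := by
    rw [show (16:ℝ) = 2 ^ 4 by norm_num, Real.log_pow]; norm_num
  have hy1 : y ≤ L / 5 := by
    have h := Real.log_le_sub_one_of_pos (show 0 < L / 16 by positivity)
    rw [Real.log_div hL0.ne' (by norm_num), hl16] at h
    linarith
  have hy0 : 2.768 ≤ y := by
    have h := Real.log_le_sub_one_of_pos (show 0 < 16 / L by positivity)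
    rw [Real.log_div (by norm_num) hL0.ne', hl16] at h
    have h2 : 16 / L ≤ 1.0038 := by rw [div_le_iff₀ hL0]; linarith
    linarith
  have hlb : Real.log (b / (2 * π)) ≤ L / 2 - y + 0.2417 := by
    rw [Real.log_div hb0.ne' (by positivity), hb, Real.log_div (by positivity) hL0.ne', Real.log_mul (by norm_num) hE0.ne', hlE,
      Real.log_mul (by norm_num) (by positivity), show (8:ℝ) = 2 ^ 3 by norm_num, Real.log_pow]
    push_cast
    linarith
  have hl0 : 0 ≤ Real.log (b / (2 * π)) := Real.log_nonneg (by rw [one_le_div (by positivity)]; linarith)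
  set l := Real.log (b / (2 * π))
  set m := L / 2 - y + 0.2417 with hm
  have hmL : m ≤ L / 2 := by rw [hm]; linarith
  have hq : l^2 / 4 + Real.log 2 * l / 2 + 0.595 ≤ (m^2 + 1.3863 * m + 2.38) / 4 := by
    have h1 : l^2 ≤ m^2 := pow_le_pow_left₀ hl0 hlb 2
    have h2 : Real.log 2 * l ≤ 0.69315 * m := mul_le_mul (by linarith) hlb hl0 (by norm_num)
    linarith
  set Q := m^2 + 1.3863 * m + 2.38 with hQ
  have hm0 : 0 ≤ m := hl0.trans hlb
  have hQ0 : 0 ≤ Q := by positivity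
  have hQ1 : 4 * Q ≤ 1.4 * L^2 := by
    have h1 : m^2 ≤ (L/2)^2 := pow_le_pow_left₀ hm0 hmL 2
    nlinarith
  have hSb : b * S * (8 * π) ≤ 4 * Q := by
    have h1 : b * S ≤ 2 / π * (Q / 4) := hS.trans (mul_le_mul_of_nonneg_left hq (by positivity))
    have h2 : 2 / π * (Q / 4) * (8 * π) = 4 * Q := by field_simp; ring
    rw [← h2]
    exact mul_le_mul_of_nonneg_right h1 (by positivity)
  have hmain := large_ineq hL hy0 hy1
  rw [← hm, ← hQ] at hmain
  rw [le_div_iff₀ (by positivity)]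
  have e1 : E^2 / (b - 1/2) * (8 * π) ≤ E * (3.1416 * L + 0.02) := by
    have hEb : E = b * L / 8 := by rw [hb]; field_simp
    rw [div_mul_eq_mul_div, div_le_iff₀ (by linarith)]
    have h1 : E * (8 * π) ≤ (3.1416 * L + 0.02) * (b - 1/2) := by
      have : E * (8 * π) = b * L * π := by rw [hEb]; ring
      rw [this]
      have h3 : b * L * π ≤ b * L * 3.141593 := mul_le_mul_of_nonneg_left hpi2.le (by positivity)
      have h4 : 0 ≤ b * L := by positivity
      have h5 : 15.94 * L ≤ L^2 := by nlinarith
      linarith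
    calc E^2 * (8 * π) = E * (E * (8 * π)) := by ring
      _ ≤ E * ((3.1416 * L + 0.02) * (b - 1/2)) := mul_le_mul_of_nonneg_left h1 hE0.le
      _ = _ := by ring
  have e2 : (b + 1/2) * E * S * (8 * π) ≤ E * (4 * Q + 0.14) := by
    have h1 : (b + 1/2) * E * S * (8 * π) = E * (b * S * (8 * π) + (1/2) * (S * (8 * π))) := by ring
    rw [h1]
    refine mul_le_mul_of_nonneg_left ?_ hE0.le
    have h2 : S * (8 * π) ≤ 0.28 := by
      have h3 : b * (S * (8 * π)) ≤ 1.4 * L^2 := by linarith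
      have h4 : 0 ≤ S * (8 * π) := by positivity
      have h5 : 5 * L^2 * (S * (8 * π)) ≤ b * (S * (8 * π)) := mul_le_mul_of_nonneg_right hb5 h4
      have h6 : 0 < L^2 := by positivity
      exact le_of_mul_le_mul_left (by linarith : L^2 * (S * (8 * π)) ≤ L^2 * 0.28) h6
    linarith
  have e3 : 3 * (8 * π) ≤ E * 0.03 := by linarith
  have e4 := mul_le_mul_of_nonneg_left hmain hE0.le
  rw [add_mul, add_mul]
  linarith

theorem psi_large (hRH : RiemannHypothesis) {x : ℝ} (hx : 2 ^ 23 ≤ x) :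
    |chebyshevPsi x - x| ≤ √x * Real.log x * (Real.log x - Real.log (Real.log x)) / (8 * π) := by
  have hx0 : 0 < x := by linarith
  obtain ⟨L, rfl⟩ : ∃ L, x = Real.exp L := ⟨Real.log x, (Real.exp_log hx0).symm⟩
  have hL : 15.94 ≤ L := by
    have h := Real.log_le_log (by norm_num) hx
    rw [Real.log_exp, Real.log_pow] at h
    have := Real.log_two_gt_d9
    push_cast at h
    linarith
  rw [Real.log_exp, ← Real.exp_half]
  obtain ⟨hE1, hE2⟩ := exp_big hL hx
  have hb100 : 100 ≤ 8 * Real.exp (L / 2) / L := by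
    rw [le_div_iff₀ (by linarith)]
    have h20 : 20 ≤ L^2 := by nlinarith
    nlinarith
  have hc := large_core hL hx (SS (8 * Real.exp (L / 2) / L)) _ rfl (SS_nonneg _) (SS_bd hRH hb100)
  have h1 := psi_upper hRH (u := L) (by linarith) (b := 8 * Real.exp (L / 2) / L) (by linarith)
  have h2 := psi_lower hRH (u := L) (by linarith) (b := 8 * Real.exp (L / 2) / L) (by linarith) (by
    rw [div_le_div_iff₀ (by linarith) (by norm_num)]
    have hE : Real.exp L = Real.exp (L/2) ^ 2 := by rw [← Real.exp_nat_mul]; congr 1; push_cast; ring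
    rw [hE]
    nlinarith)
  rw [abs_le]
  constructor <;> linarith
end PB

namespace PQ
open ArithmeticFunction

def fc {α : Type} (n : Nat) (k : Nat → α) : α :=
  Nat.rec (motive := fun _ => α) (k 0) (fun m _ => k (Nat.succ m)) n

lemma fc_eq {α : Type} (n : Nat) (k : Nat → α) : fc n k = k n := by cases n <;> rfl

structure St where
  n : Nat
  lo : Nat
  hi : Nat
  tl : Nat
  th : Nat

def iter (f : St → Option St) (k : Nat) : St → Option St :=
  Nat.rec (motive := fun _ => St → Option St) f (fun _ ih s => (ih s).bind ih) k

def isSt (o : Option St) (s : St) : Bool :=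
  Option.rec (motive := fun _ => Bool) false (fun u => Nat.beq u.n s.n && Nat.beq u.lo s.lo && Nat.beq u.hi s.hi &&
    Nat.beq u.tl s.tl && Nat.beq u.th s.th) o

lemma isSt_eq {o : Option St} {s : St} (h : isSt o s = true) : o = some s := by
  cases o with
  | none => simp [isSt] at h
  | some u =>
    cases u; cases s
    simp [isSt, Nat.beq_eq] at h
    simp [h]

lemma iter_sound {f : St → Option St} {I : St → Prop} {C : ℝ → ℝ → Prop}
    (hC : ∀ a b c, C a b → C b c → C a c)
    (hf : ∀ s s', f s = some s' → I s → I s' ∧ C s.n s'.n) (k : ℕ) :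
    ∀ s s', iter f k s = some s' → I s → I s' ∧ C s.n s'.n := by
  induction k with
  | zero => exact hf
  | succ k ih =>
    intro s s' h hI
    have h' : (iter f k s).bind (iter f k) = some s' := h
    obtain ⟨u, hu, hu'⟩ := Option.bind_eq_some_iff.1 h'
    obtain ⟨h1, h2⟩ := ih s u hu hI
    obtain ⟨h3, h4⟩ := ih u s' hu' h1
    exact ⟨h3, hC _ _ _ h2 h4⟩

lemma log_step_lo {a D : ℝ} (ha : 0 < a) (hD : 0 ≤ D) : 2 * D / (2 * a + D) ≤ Real.log (a + D) - Real.log a := by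
  have h := Real.le_log_one_add_of_nonneg (x := D / a) (by positivity)
  rw [← Real.log_div (by positivity) ha.ne', show (a + D) / a = 1 + D / a by field_simp]
  refine le_trans (le_of_eq ?_) h
  field_simp
  ring

lemma log_step_hi {a D : ℝ} (ha : 0 < a) (hD : 0 ≤ D) :
    Real.log (a + D) - Real.log a ≤ D * (2 * a + D) / (2 * a * (a + D)) := by
  have h0 : 0 < a + D := by linarith
  rw [← Real.log_div (by positivity) ha.ne']
  have h1 : 0 ≤ Real.log ((a + D) / a) := Real.log_nonneg (by rw [one_le_div ha]; linarith)
  have h := Real.self_le_sinh_iff.2 h1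
  rw [Real.sinh_eq, Real.exp_neg, Real.exp_log (by positivity)] at h
  refine h.trans (le_of_eq ?_)
  field_simp
  ring


lemma div_lo (a b : ℕ) : ((a / b : ℕ) : ℝ) ≤ (a : ℝ) / b := Nat.cast_div_le

lemma div_hi (a b : ℕ) (hb : 0 < b) : (a : ℝ) / b ≤ ((a / b : ℕ) : ℝ) + 1 := by
  have hb' : (0:ℝ) < b := by exact_mod_cast hb
  rw [div_le_iff₀ hb']
  have h1 := Nat.lt_div_mul_add (a := a) hb
  have h2 : (a:ℝ) < ((a / b : ℕ) : ℝ) * b + b := by exact_mod_cast h1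
  linarith

lemma log_upd {S a D lo hi : ℕ} (hS0 : 0 < S) (ha : 0 < a) (h1 : (lo:ℝ) ≤ S * Real.log a) (h2 : S * Real.log a ≤ hi) :
    ((lo + 2 * S * D / (2 * a + D) : ℕ) : ℝ) ≤ S * Real.log ((a + D : ℕ) : ℝ) ∧
    S * Real.log ((a + D : ℕ) : ℝ) ≤ ((hi + S * D * (2 * a + D) / (2 * a * (a + D)) + 1 : ℕ) : ℝ) := by
  have ha' : (0:ℝ) < a := by exact_mod_cast ha
  have hD' : (0:ℝ) ≤ D := Nat.cast_nonneg D
  have hS : (0:ℝ) < S := by exact_mod_cast hS0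
  have e1 := log_step_lo ha' hD'
  have e2 := log_step_hi ha' hD'
  have f1 := div_lo (2 * S * D) (2 * a + D)
  have f2 := div_hi (S * D * (2 * a + D)) (2 * a * (a + D)) (by positivity)
  have g1 := mul_le_mul_of_nonneg_left e1 hS.le
  have g2 := mul_le_mul_of_nonneg_left e2 hS.le
  rw [show (S:ℝ) * (2 * D / (2 * a + D)) = 2 * S * D / (2 * a + D) by ring] at g1
  rw [show (S:ℝ) * (D * (2 * a + D) / (2 * a * (a + D))) = S * D * (2 * a + D) / (2 * a * (a + D)) by ring] at g2
  push_cast at f1 f2 ⊢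
  constructor <;> linarith

/- phase one -/

def pl : List Nat := [2, 3, 5, 7, 11, 13, 17, 19, 23, 29, 31, 37, 41, 43, 47, 53, 59, 61, 67, 71, 73, 79, 83, 89, 97,
  101, 103, 107, 109, 113, 127]

def mf (m : Nat) (l : List Nat) : Nat :=
  List.rec (motive := fun _ => Nat) m (fun p _ ih => cond (Nat.beq (Nat.mod m p) 0) p ih) l

def kpr (m p f : Nat) : Nat → Nat → Nat :=
  Nat.rec (motive := fun _ => Nat → Nat → Nat) (fun _ _ => 0)
    (fun _ ih q k => cond (Nat.beq q m) k (ih (Nat.mul q p) (Nat.succ k))) f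

def kap (m p : Nat) : Nat := cond (Nat.beq (Nat.mod (Nat.pow p 13) m) 0) (kpr m p 13 p 1) 0

def step1 (S t r : Nat) (s : St) : Option St :=
  cond (Nat.ble t s.n) (some s)
  (fc (s.n + 1) fun m =>
   fc (s.lo + 2 * S * 1 / (2 * s.n + 1)) fun lo =>
   fc (s.hi + S * 1 * (2 * s.n + 1) / (2 * s.n * m) + 1) fun hi =>
   fc (mf m pl) fun p =>
   fc (kap m p) fun k =>
   fc (s.tl + lo / k) fun tl =>
   fc (s.th + hi / k + 1) fun th =>
   cond (Nat.ble th (S * m + r) && Nat.ble (S * (m + 1)) (tl + r) && Nat.ble (100 * th) (105 * (S * m)) && Nat.ble m 16380)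
     (some ⟨m, lo, hi, tl, th⟩) none)

lemma mf_cases (m : ℕ) (l : List ℕ) : (mf m l ∈ l ∧ mf m l ∣ m) ∨ (mf m l = m ∧ ∀ p ∈ l, ¬ p ∣ m) := by
  induction l with
  | nil => right; simp [mf]
  | cons p l ih =>
    have hd : mf m (p :: l) = cond (Nat.beq (Nat.mod m p) 0) p (mf m l) := rfl
    by_cases h : m % p = 0
    · left
      have hb : Nat.beq (Nat.mod m p) 0 = true := by rw [Nat.beq_eq]; exact h
      rw [hd, hb]
      simp [Nat.dvd_of_mod_eq_zero h]
    · have hb : Nat.beq (Nat.mod m p) 0 = false := by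
        rw [Bool.eq_false_iff]; intro h'; rw [Nat.beq_eq] at h'; exact h h'
      rw [hd, hb]
      simp only [cond_false]
      rcases ih with ⟨h1, h2⟩ | ⟨h1, h2⟩
      · left; exact ⟨List.mem_cons_of_mem _ h1, h2⟩
      · right
        refine ⟨h1, ?_⟩
        intro q hq
        rcases List.mem_cons.1 hq with rfl | hq
        · intro hdv; exact h (Nat.mod_eq_zero_of_dvd hdv)
        · exact h2 q hq

lemma pl_prime : ∀ p ∈ pl, p.Prime := by
  unfold pl
  simp only [List.forall_mem_cons, List.not_mem_nil, false_imp_iff, implies_true, and_true]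
  norm_num

lemma pl_complete : ∀ p < 131, p.Prime → p ∈ pl := by
  unfold pl
  decide +kernel

lemma mf_spec {m : ℕ} (h1 : 1 < m) (h2 : m < 17161) : (mf m pl).Prime ∧ mf m pl ∣ m := by
  rcases mf_cases m pl with ⟨h, h'⟩ | ⟨h, h'⟩
  · exact ⟨pl_prime _ h, h'⟩
  · rw [h]
    refine ⟨?_, dvd_rfl⟩
    by_contra hc
    have h3 := Nat.minFac_sq_le_self (by omega) hc
    have h4 : m.minFac < 131 := by nlinarith
    exact h' _ (pl_complete _ h4 (Nat.minFac_prime (by omega))) (Nat.minFac_dvd m)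

lemma kpr_spec (m p f : ℕ) : ∀ q k, (kpr m p f q k = 0 ∧ ∀ i < f, q * p ^ i ≠ m) ∨
    ∃ i, q * p ^ i = m ∧ kpr m p f q k = k + i := by
  induction f with
  | zero => intro q k; left; exact ⟨rfl, fun i hi => absurd hi (Nat.not_lt_zero _)⟩
  | succ f ih =>
    intro q k
    have hd : kpr m p (f+1) q k = cond (Nat.beq q m) k (kpr m p f (q * p) (k+1)) := rfl
    by_cases h : q = m
    · right
      have hb : Nat.beq q m = true := by rw [Nat.beq_eq]; exact h
      refine ⟨0, by simpa using h, ?_⟩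
      rw [hd, hb]; rfl
    · have hb : Nat.beq q m = false := by
        rw [Bool.eq_false_iff]; intro h'; rw [Nat.beq_eq] at h'; exact h h'
      rw [hd, hb]
      simp only [cond_false]
      rcases ih (q * p) (k + 1) with ⟨h1, h2⟩ | ⟨i, h1, h2⟩
      · left
        refine ⟨h1, fun i hi => ?_⟩
        cases i with
        | zero => simpa using h
        | succ i => have := h2 i (by omega); rwa [mul_assoc, ← pow_succ'] at this
      · right
        exact ⟨i + 1, by rw [pow_succ', ← mul_assoc]; exact h1, by rw [h2]; ring⟩

lemma kap_spec {m : ℕ} (h1 : 1 < m) (h2 : m < 16384) :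
    (vonMangoldt m : ℝ) = Real.log m / (kap m (mf m pl) : ℕ) := by
  obtain ⟨hp, hd⟩ := mf_spec h1 (by omega)
  set p := mf m pl
  have hzero : (∀ i < 13, p * p ^ i ≠ m) → (vonMangoldt m : ℝ) = 0 := by
    intro h
    rw [vonMangoldt_eq_zero_iff, isPrimePow_nat_iff]
    rintro ⟨q, k, hq, hk, rfl⟩
    have hpq : p = q := (Nat.prime_dvd_prime_iff_eq hp hq).1 (hp.dvd_of_dvd_pow hd)
    have hk14 : k < 14 := by
      by_contra hc
      have : 2 ^ 14 ≤ q ^ k := (Nat.pow_le_pow_left hq.two_le 14).trans (Nat.pow_le_pow_right hq.pos (by omega))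
      omega
    apply h (k - 1) (by omega)
    rw [hpq, ← pow_succ', Nat.sub_add_cancel hk]
  unfold kap
  by_cases hb : Nat.beq (Nat.mod (Nat.pow p 13) m) 0 = true
  · rw [hb]
    simp only [cond_true]
    rcases kpr_spec m p 13 p 1 with ⟨h3, h4⟩ | ⟨i, h3, h4⟩
    · rw [h3, hzero h4]; simp
    · rw [h4, ← h3, ← pow_succ', vonMangoldt_apply_pow (by omega), vonMangoldt_apply_prime hp]
      push_cast
      rw [Real.log_pow]
      push_cast
      have : (1 + (i:ℝ)) ≠ 0 := by positivity
      field_simp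
      ring
  · have hb' : Nat.beq (Nat.mod (Nat.pow p 13) m) 0 = false := by rwa [Bool.eq_false_iff]
    rw [hb', hzero]
    · simp
    · intro i hi hc
      apply hb
      rw [Nat.beq_eq]
      refine Nat.mod_eq_zero_of_dvd (show m ∣ p ^ 13 from ?_)
      rw [← hc, ← pow_succ']
      exact pow_dvd_pow p (by omega)

noncomputable def ps (n : ℕ) : ℝ := ∑ i ∈ Finset.range (n + 1), vonMangoldt i

lemma ps_succ (n : ℕ) : ps (n + 1) = ps n + vonMangoldt (n + 1) := Finset.sum_range_succ _ _

def Inv1 (S : ℕ) (s : St) : Prop := 2 ≤ s.n ∧ (s.lo : ℝ) ≤ S * Real.log s.n ∧ S * Real.log s.n ≤ s.hi ∧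
  (s.tl : ℝ) ≤ S * ps s.n ∧ S * ps s.n ≤ s.th

def Con1 (S r : ℕ) (a b : ℝ) : Prop := ∀ m : ℕ, a < m → (m:ℝ) ≤ b →
  S * ps m ≤ S * m + r ∧ S * (m + 1) ≤ S * ps m + r ∧ ps m ≤ 1.05 * m

lemma Con1_trans (S r : ℕ) (a b c : ℝ) (h1 : Con1 S r a b) (h2 : Con1 S r b c) : Con1 S r a c := by
  intro m hm hm'
  rcases le_or_gt (m:ℝ) b with h | h
  · exact h1 m hm h
  · exact h2 m h hm'

lemma step1_sound {S : ℕ} (hS0 : 0 < S) (t r : ℕ) (s s' : St) (h : step1 S t r s = some s') (hI : Inv1 S s) : Inv1 S s' ∧ Con1 S r s.n s'.n := by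
  obtain ⟨n, lo, hi, tl, th⟩ := s
  obtain ⟨i1, i2, i3, i4, i5⟩ := hI
  simp only [step1, fc_eq] at h
  simp only at i1 i2 i3 i4 i5
  cases hb : Nat.ble t n with
  | true =>
    rw [hb] at h
    simp only [cond_true, Option.some.injEq] at h
    subst h
    exact ⟨⟨i1, i2, i3, i4, i5⟩, fun m h1 h2 => absurd h1 (not_lt.2 h2)⟩
  | false =>
    rw [hb] at h
    simp only [cond_false] at h
    have hc := Bool.eq_false_or_eq_true (Nat.ble (th + (hi + S * 1 * (2 * n + 1) / (2 * n * (n + 1)) + 1) / kap (n + 1) (mf (n + 1) pl) + 1) (S * (n + 1) + r) && Nat.ble (S * (n + 1 + 1)) (tl + (lo + 2 * S * 1 / (2 * n + 1)) / kap (n + 1) (mf (n + 1) pl) + r) && Nat.ble (100 * (th + (hi + S * 1 * (2 * n + 1) / (2 * n * (n + 1)) + 1) / kap (n + 1) (mf (n + 1) pl) + 1)) (105 * (S * (n + 1))) && Nat.ble (n + 1) 16380)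
    rcases hc with hc | hc
    swap
    · rw [hc] at h; simp at h
    rw [hc] at h
    simp only [cond_true, Option.some.injEq] at h
    simp only [Bool.and_eq_true, Nat.ble_eq] at hc
    obtain ⟨⟨⟨c1, c2⟩, c3⟩, c4⟩ := hc
    obtain ⟨l1, l2⟩ := log_upd hS0 (D := 1) (by omega : 0 < n) i2 i3
    have hk := kap_spec (m := n + 1) (by omega) (by omega)
    subst h
    set k := kap (n + 1) (mf (n + 1) pl)
    set lo' := lo + 2 * S * 1 / (2 * n + 1)
    set hi' := hi + S * 1 * (2 * n + 1) / (2 * n * (n + 1)) + 1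
    have hS : (0:ℝ) < S := by exact_mod_cast hS0
    have hps := ps_succ n
    have j1 : ((tl + lo' / k : ℕ) : ℝ) ≤ S * ps (n + 1) := by
      rw [hps, hk, mul_add]
      have := div_lo lo' k
      have h2 : (lo':ℝ) / k ≤ S * Real.log ((n + 1 : ℕ) : ℝ) / k := div_le_div_of_nonneg_right l1 (Nat.cast_nonneg _)
      rw [mul_div_assoc] at h2
      push_cast at *
      linarith
    have j2 : S * ps (n + 1) ≤ ((th + hi' / k + 1 : ℕ) : ℝ) := by
      rw [hps, hk, mul_add]
      have h2 : S * Real.log ((n + 1 : ℕ) : ℝ) / k ≤ (hi':ℝ) / k := div_le_div_of_nonneg_right l2 (Nat.cast_nonneg _)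
      have h3 : (hi':ℝ) / k ≤ ((hi' / k : ℕ) : ℝ) + 1 := by
        rcases Nat.eq_zero_or_pos k with h0 | h0
        · rw [h0]; simp
        · exact div_hi _ _ h0
      rw [mul_div_assoc] at h2
      push_cast at *
      linarith
    refine ⟨⟨by simp only; omega, l1, l2, j1, j2⟩, ?_⟩
    intro m hm hm'
    simp only at hm hm'
    have hmn : m = n + 1 := by
      have h1 : n < m := by exact_mod_cast hm
      have h2 : m ≤ n + 1 := by exact_mod_cast hm'
      omega
    subst hmn
    have d1 : ((th + hi' / k + 1 : ℕ) : ℝ) ≤ S * ((n + 1 : ℕ) : ℝ) + r := by exact_mod_cast c1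
    have d2 : (S:ℝ) * (((n + 1 : ℕ) : ℝ) + 1) ≤ ((tl + lo' / k : ℕ) : ℝ) + r := by exact_mod_cast c2
    have d3 : 100 * ((th + hi' / k + 1 : ℕ) : ℝ) ≤ 105 * (S * ((n + 1 : ℕ) : ℝ)) := by exact_mod_cast c3
    refine ⟨j2.trans d1, by linarith, ?_⟩
    have : (S:ℝ) * ps (n + 1) ≤ S * (1.05 * ((n + 1 : ℕ) : ℝ)) := by linarith
    exact le_of_mul_le_mul_left this hS

lemma iter1 {S : ℕ} (hS0 : 0 < S) {t r k : ℕ} {s s' : St} (h : isSt (iter (step1 S t r) k s) s' = true) (hI : Inv1 S s) :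
    Inv1 S s' ∧ Con1 S r s.n s'.n :=
  iter_sound (Con1_trans S r) (step1_sound hS0 t r) k s s' (isSt_eq h) hI
end PQ

namespace PQ
lemma sa0 : isSt (iter (step1 10000000000 100 10000000000000000) 7 ⟨16, 27725887210, 27725887234, 134800000000, 134900000000⟩) ⟨100, 46050116978, 46054872522, 940345835960, 940527502689⟩ = true := by decide +kernel
lemma sa1 : isSt (iter (step1 10000000000 146 56350000000) 6 ⟨100, 46050116978, 46054872522, 940345835960, 940527502689⟩) ⟨146, 49834459192, 49839281140, 1416487250681, 1416716692369⟩ = true := by decide +kernel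
lemma sa2 : isSt (iter (step1 10000000000 218 80850000000) 7 ⟨146, 49834459192, 49839281140, 1416487250681, 1416716692369⟩) ⟨218, 53843332787, 53848187146, 2114832177012, 2115126952964⟩ = true := by decide +kernel
lemma sa3 : isSt (iter (step1 10000000000 553 116970000000) 9 ⟨218, 53843332787, 53848187146, 2114832177012, 2115126952964⟩) ⟨553, 63151954609, 63156831518, 5430233659010, 5430802458391⟩ = true := by decide +kernel
lemma sa4 : isSt (iter (step1 10000000000 1418 264060000000) 10 ⟨553, 63151954609, 63156831518, 5430233659010, 5430802458391⟩) ⟨1418, 72568400098, 72573281313, 13926559801076, 13927735394895⟩ = true := by decide +kernel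
lemma sa5 : isSt (iter (step1 10000000000 11671 573100000000) 14 ⟨1418, 72568400098, 72573281313, 13926559801076, 13927735394895⟩) ⟨11671, 93646991839, 93651883877, 116151711732180, 116158687602690⟩ = true := by decide +kernel
lemma sa6 : isSt (iter (step1 10000000000 16380 2867010000000) 13 ⟨11671, 93646991839, 93651883877, 116151711732180, 116158687602690⟩) ⟨16380, 97036528964, 97041425717, 163977987192380, 163987416367533⟩ = true := by decide +kernel
end PQ

namespace PQ
open ArithmeticFunction

def lf (P n : Nat) : Nat :=
  Nat.rec (motive := fun _ => Nat) (nat_lit 0) (fun m _ => Nat.add (Nat.add (Nat.add (Nat.add (Nat.add (Nat.add (Nat.add (Nat.div (nat_lit 1) (Nat.gcd (Nat.mod P (Nat.add m (nat_lit 2))) (Nat.add m (nat_lit 2))))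
      (Nat.div (nat_lit 1) (Nat.gcd (Nat.mod P (Nat.add m (nat_lit 8))) (Nat.add m (nat_lit 8)))))
      (Nat.div (nat_lit 1) (Nat.gcd (Nat.mod P (Nat.add m (nat_lit 12))) (Nat.add m (nat_lit 12)))))
      (Nat.div (nat_lit 1) (Nat.gcd (Nat.mod P (Nat.add m (nat_lit 14))) (Nat.add m (nat_lit 14)))))
      (Nat.div (nat_lit 1) (Nat.gcd (Nat.mod P (Nat.add m (nat_lit 18))) (Nat.add m (nat_lit 18)))))
      (Nat.div (nat_lit 1) (Nat.gcd (Nat.mod P (Nat.add m (nat_lit 20))) (Nat.add m (nat_lit 20)))))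
      (Nat.div (nat_lit 1) (Nat.gcd (Nat.mod P (Nat.add m (nat_lit 24))) (Nat.add m (nat_lit 24)))))
      (Nat.div (nat_lit 1) (Nat.gcd (Nat.mod P (Nat.add m (nat_lit 30))) (Nat.add m (nat_lit 30))))) n

def bk (P j : Nat) : Nat → Nat :=
  Nat.rec (motive := fun _ => Nat → Nat) (lf P)
    (fun k ih n => Nat.add (ih n) (ih (Nat.add n (Nat.mul (nat_lit 30) (Nat.pow (nat_lit 2) k))))) j

def Pok (P : ℕ) : Prop := (∀ q : ℕ, q.Prime → q < 2903 → q ∣ P) ∧ (∀ q : ℕ, q.Prime → q ∣ P → q < 16380)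

lemma cn_spec {P m : ℕ} (hP : Pok P) (h1 : 16380 ≤ m) (h2 : m < 8427409) :
    Nat.div 1 (Nat.gcd (Nat.mod P m) m) = if m.Prime then 1 else 0 := by
  change 1 / Nat.gcd (P % m) m = _
  have hg : Nat.gcd (P % m) m = Nat.gcd m P := (Nat.gcd_rec m P).symm
  rw [hg]
  split_ifs with hm
  · have : Nat.Coprime m P := by
      rw [hm.coprime_iff_not_dvd]
      intro hd
      have := hP.2 m hm hd
      omega
    rw [this]
  · have h3 := Nat.minFac_sq_le_self (by omega) hm
    have h4 : m.minFac < 2903 := by nlinarith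
    have hp := Nat.minFac_prime (n := m) (by omega)
    have h5 := hP.1 _ hp h4
    have h6 : m.minFac ∣ Nat.gcd m P := Nat.dvd_gcd (Nat.minFac_dvd m) h5
    have h7 : 0 < Nat.gcd m P := Nat.gcd_pos_of_pos_left _ (by omega)
    have h8 := Nat.le_of_dvd h7 h6
    have h9 := hp.two_le
    exact Nat.div_eq_of_lt (by omega)

def wp (m : ℕ) : ℕ := if m.Prime then 1 else 0

lemma wp_zero {m d : ℕ} (hd : 2 ≤ d) (h : d < m) (hm : m % d = 0) : wp m = 0 := by
  unfold wp
  rw [if_neg]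
  intro hp
  have := (Nat.dvd_prime hp).1 (Nat.dvd_of_mod_eq_zero hm)
  omega

lemma lf_spec {P n : ℕ} (hP : Pok P) (h0 : n % 30 = 0) (h1 : 16380 ≤ n) (h2 : n + 30 < 8427409) :
    lf P n = ∑ i ∈ Finset.range 30, wp (n + 1 + i) := by
  obtain ⟨m, rfl⟩ : ∃ m, n = m + 1 := ⟨n - 1, by omega⟩
  have hd : lf P (m + 1) = 1 / Nat.gcd (P % (m + 2)) (m + 2) + 1 / Nat.gcd (P % (m + 8)) (m + 8) + 1 / Nat.gcd (P % (m + 12)) (m + 12)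
    + 1 / Nat.gcd (P % (m + 14)) (m + 14) + 1 / Nat.gcd (P % (m + 18)) (m + 18) + 1 / Nat.gcd (P % (m + 20)) (m + 20)
    + 1 / Nat.gcd (P % (m + 24)) (m + 24) + 1 / Nat.gcd (P % (m + 30)) (m + 30) := rfl
  have hc : ∀ c, c ≤ 30 → 1 / Nat.gcd (P % (m + (c + 1))) (m + (c + 1)) = wp (m + (c + 1)) := fun c hc =>
    cn_spec hP (by omega) (by omega)
  rw [hd, hc 1 (by omega), hc 7 (by omega), hc 11 (by omega), hc 13 (by omega), hc 17 (by omega), hc 19 (by omega), hc 23 (by omega), hc 29 (by omega)]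
  have e2 : ∀ c, c < 30 → c % 2 = 1 → wp (m + 1 + 1 + c) = 0 := fun c _ h => wp_zero (d := 2) (by omega) (by omega) (by omega)
  have e3 : ∀ c, c < 30 → c % 3 = 2 → wp (m + 1 + 1 + c) = 0 := fun c _ h => wp_zero (d := 3) (by omega) (by omega) (by omega)
  have e5 : ∀ c, c < 30 → c % 5 = 4 → wp (m + 1 + 1 + c) = 0 := fun c _ h => wp_zero (d := 5) (by omega) (by omega) (by omega)
  have ez : ∀ c, c < 30 → (c % 2 = 1 ∨ c % 3 = 2 ∨ c % 5 = 4) → wp (m + 1 + 1 + c) = 0 := by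
    rintro c h (h' | h' | h')
    · exact e2 c h h'
    · exact e3 c h h'
    · exact e5 c h h'
  simp only [Finset.sum_range_succ, Finset.sum_range_zero]
  rw [ez 1 (by omega) (by omega), ez 2 (by omega) (by omega), ez 3 (by omega) (by omega), ez 4 (by omega) (by omega),
    ez 5 (by omega) (by omega), ez 7 (by omega) (by omega), ez 8 (by omega) (by omega), ez 9 (by omega) (by omega),
    ez 11 (by omega) (by omega), ez 13 (by omega) (by omega), ez 14 (by omega) (by omega), ez 15 (by omega) (by omega),
    ez 17 (by omega) (by omega), ez 19 (by omega) (by omega), ez 20 (by omega) (by omega), ez 21 (by omega) (by omega),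
    ez 23 (by omega) (by omega), ez 24 (by omega) (by omega), ez 25 (by omega) (by omega), ez 26 (by omega) (by omega),
    ez 27 (by omega) (by omega), ez 29 (by omega) (by omega)]
  simp only [add_assoc, zero_add, add_zero]
  rfl

lemma bk_spec {P : ℕ} (hP : Pok P) (j : ℕ) : ∀ n : ℕ, n % 30 = 0 → 16380 ≤ n → n + 30 * 2 ^ j < 8427409 →
    bk P j n = ∑ i ∈ Finset.range (30 * 2 ^ j), wp (n + 1 + i) := by
  induction j with
  | zero => intro n h0 h1 h2; exact lf_spec hP h0 h1 (by simpa using h2)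
  | succ j ih =>
    intro n h0 h1 h2
    have hd : bk P (j + 1) n = bk P j n + bk P j (n + 30 * 2 ^ j) := rfl
    have hp : 30 * 2 ^ (j + 1) = 30 * 2 ^ j + 30 * 2 ^ j := by ring
    rw [hp] at h2 ⊢
    rw [hd, ih n h0 h1 (by omega), ih (n + 30 * 2 ^ j) (by omega) (by omega) (by omega), Finset.sum_range_add]
    congr 1
    refine Finset.sum_congr rfl fun i _ => ?_
    congr 1
    ring

lemma theta_succ (n : ℕ) : Chebyshev.theta ((n + 1 : ℕ) : ℝ) = Chebyshev.theta n + wp (n + 1) * Real.log ((n + 1 : ℕ) : ℝ) := by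
  unfold Chebyshev.theta wp
  rw [Nat.floor_natCast, Nat.floor_natCast, Finset.sum_filter, Finset.sum_filter, Finset.sum_Ioc_succ_top (by omega)]
  split_ifs <;> simp

lemma theta_block (a D : ℕ) (ha : 1 ≤ a) : ∀ i ≤ D,
    (∑ i ∈ Finset.range i, wp (a + 1 + i) : ℕ) * Real.log a ≤ Chebyshev.theta ((a + i : ℕ) : ℝ) - Chebyshev.theta a ∧
    Chebyshev.theta ((a + i : ℕ) : ℝ) - Chebyshev.theta a ≤ (∑ i ∈ Finset.range i, wp (a + 1 + i) : ℕ) * Real.log ((a + D : ℕ) : ℝ) := by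
  intro i
  induction i with
  | zero => intro _; simp
  | succ i ih =>
    intro hi
    obtain ⟨h1, h2⟩ := ih (by omega)
    rw [Finset.sum_range_succ, show a + (i + 1) = a + i + 1 by ring, theta_succ, show a + 1 + i = a + i + 1 by ring]
    have hw : (0:ℝ) ≤ (wp (a + i + 1) : ℝ) := Nat.cast_nonneg _
    have ha' : (0:ℝ) < a := by exact_mod_cast ha
    have l1 : Real.log a ≤ Real.log ((a + i + 1 : ℕ) : ℝ) := Real.log_le_log ha' (by exact_mod_cast (by omega))
    have l2 : Real.log ((a + i + 1 : ℕ) : ℝ) ≤ Real.log ((a + D : ℕ) : ℝ) :=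
      Real.log_le_log (by positivity) (by exact_mod_cast (by omega))
    have m1 := mul_le_mul_of_nonneg_left l1 hw
    have m2 := mul_le_mul_of_nonneg_left l2 hw
    rw [Nat.cast_add, add_mul, add_mul]
    constructor <;> linarith

def step2 (S P j g r t : Nat) (s : St) : Option St :=
  cond (Nat.ble t s.n) (some s)
  (fc (30 * 2 ^ j) fun D =>
   fc (s.n + D) fun b =>
   fc (s.lo + 2 * S * D / (2 * s.n + D)) fun lo =>
   fc (s.hi + S * D * (2 * s.n + D) / (2 * s.n * b) + 1) fun hi =>
   fc (bk P j s.n) fun c =>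
   fc (s.tl + c * s.lo) fun tl =>
   fc (s.th + c * hi) fun th =>
   cond (Nat.ble (th + g) (S * s.n + r) && Nat.ble (S * b) (s.tl + r) && Nat.ble (24336 * b * (S * S)) (10000 * (g * g)) && Nat.ble b 8427408)
     (some ⟨b, lo, hi, tl, th⟩) none)

noncomputable def TT (x : ℝ) : ℝ := Chebyshev.psi 16380 + Chebyshev.theta x - Chebyshev.theta 16380

def Inv2 (S : ℕ) (s : St) : Prop := 16380 ≤ s.n ∧ s.n % 30 = 0 ∧ (s.lo : ℝ) ≤ S * Real.log s.n ∧ S * Real.log s.n ≤ s.hi ∧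
  (s.tl : ℝ) ≤ S * TT s.n ∧ S * TT s.n ≤ s.th

def Con2 (S r : ℕ) (a b : ℝ) : Prop := ∀ x : ℝ, a < x → x ≤ b →
  S * Chebyshev.psi x ≤ S * x + r ∧ S * x ≤ S * Chebyshev.psi x + r

lemma Con2_trans (S r : ℕ) (a b c : ℝ) (h1 : Con2 S r a b) (h2 : Con2 S r b c) : Con2 S r a c := by
  intro m hm hm'
  rcases le_or_gt m b with h | h
  · exact h1 m hm h
  · exact h2 m h hm'

lemma TT_le {x : ℝ} (hx : 16380 ≤ x) : TT x ≤ Chebyshev.psi x := by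
  have h1 := Chebyshev.psi_sub_theta_eq_sum_not_prime x
  have h2 := Chebyshev.psi_sub_theta_eq_sum_not_prime 16380
  have h3 : Chebyshev.psi 16380 - Chebyshev.theta 16380 ≤ Chebyshev.psi x - Chebyshev.theta x := by
    rw [h1, h2]
    refine Finset.sum_le_sum_of_subset_of_nonneg ?_ (fun _ _ _ => vonMangoldt_nonneg)
    exact Finset.filter_subset_filter _ (Finset.Ioc_subset_Ioc_right (Nat.floor_mono hx))
  unfold TT
  linarith

lemma TT_mono {x y : ℝ} (h : x ≤ y) : TT x ≤ TT y := by
  have := Chebyshev.theta_mono h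
  unfold TT
  linarith

lemma step2_sound {S P : ℕ} (hS0 : 0 < S) (hP : Pok P)
    (hD : ∀ x : ℝ, 16380 ≤ x → x ≤ 8427408 → Chebyshev.psi x ≤ TT x + 1.56 * √x)
    (j g r t : ℕ) (s s' : St) (h : step2 S P j g r t s = some s') (hI : Inv2 S s) : Inv2 S s' ∧ Con2 S r s.n s'.n := by
  obtain ⟨n, lo, hi, tl, th⟩ := s
  obtain ⟨i1, i0, i2, i3, i4, i5⟩ := hI
  simp only [step2, fc_eq] at h
  simp only at i1 i0 i2 i3 i4 i5
  cases hb : Nat.ble t n with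
  | true =>
    rw [hb] at h
    simp only [cond_true, Option.some.injEq] at h
    subst h
    exact ⟨⟨i1, i0, i2, i3, i4, i5⟩, fun m h1 h2 => absurd h1 (not_lt.2 h2)⟩
  | false =>
    rw [hb] at h
    simp only [cond_false] at h
    have hbk := bk_spec hP j n i0 i1
    generalize bk P j n = c at h hbk
    have hD30 : (n + 30 * 2 ^ j) % 30 = 0 := by omega
    generalize 30 * 2 ^ j = D at h hbk hD30
    obtain ⟨l1, l2⟩ := log_upd hS0 (D := D) (by omega : 0 < n) i2 i3
    generalize lo + 2 * S * D / (2 * n + D) = lo' at h l1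
    generalize hi + S * D * (2 * n + D) / (2 * n * (n + D)) + 1 = hi' at h l2
    have hc := Bool.eq_false_or_eq_true (Nat.ble (th + c * hi' + g) (S * n + r) && Nat.ble (S * (n + D)) (tl + r) && Nat.ble (24336 * (n + D) * (S * S)) (10000 * (g * g)) && Nat.ble (n + D) 8427408)
    rcases hc with hc | hc
    swap
    · rw [hc] at h; simp at h
    rw [hc] at h
    simp only [cond_true, Option.some.injEq] at h
    simp only [Bool.and_eq_true, Nat.ble_eq] at hc
    obtain ⟨⟨⟨c1, c2⟩, c3⟩, c4⟩ := hc
    subst h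
    have hS : (0:ℝ) < S := by exact_mod_cast hS0
    have hc := hbk (by omega)
    obtain ⟨t1, t2⟩ := theta_block n D (by omega) D le_rfl
    rw [← hc] at t1 t2
    have hc0 : (0:ℝ) ≤ c := Nat.cast_nonneg _
    have u1 := mul_le_mul_of_nonneg_left t1 hS.le
    have u2 := mul_le_mul_of_nonneg_left t2 hS.le
    have v1 := mul_le_mul_of_nonneg_left i2 hc0
    have v2 := mul_le_mul_of_nonneg_left l2 hc0
    have eT : TT ((n + D : ℕ) : ℝ) = TT n + (Chebyshev.theta ((n + D : ℕ) : ℝ) - Chebyshev.theta n) := by unfold TT; ring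
    have j1 : ((tl + c * lo : ℕ) : ℝ) ≤ S * TT ((n + D : ℕ) : ℝ) := by
      rw [eT, Nat.cast_add, Nat.cast_mul]; linarith
    have j2 : S * TT ((n + D : ℕ) : ℝ) ≤ ((th + c * hi' : ℕ) : ℝ) := by
      rw [eT, Nat.cast_add th, Nat.cast_mul]; linarith
    refine ⟨⟨by simp only; omega, hD30, l1, l2, j1, j2⟩, ?_⟩
    intro x hx hx'
    simp only at hx hx'
    have d1 : ((th + c * hi' : ℕ) : ℝ) + g ≤ S * n + r := by exact_mod_cast c1
    have d2 : (S:ℝ) * ((n + D : ℕ) : ℝ) ≤ tl + r := by exact_mod_cast c2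
    have d3 : 24336 * ((n + D : ℕ) : ℝ) * (S * S) ≤ 10000 * ((g:ℝ) * g) := by exact_mod_cast c3
    have d4 : ((n + D : ℕ) : ℝ) ≤ 8427408 := by exact_mod_cast c4
    have d0 : (16380:ℝ) ≤ n := by exact_mod_cast i1
    have e1 : S * x ≤ S * ((n + D : ℕ) : ℝ) := mul_le_mul_of_nonneg_left hx' hS.le
    have e2 : (S:ℝ) * n ≤ S * x := mul_le_mul_of_nonneg_left hx.le hS.le
    have e3 : (S:ℝ) * TT n ≤ S * Chebyshev.psi x := mul_le_mul_of_nonneg_left ((TT_mono hx.le).trans (TT_le (by linarith))) hS.le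
    have e4 : (S:ℝ) * Chebyshev.psi x ≤ S * (TT ((n + D : ℕ) : ℝ) + 1.56 * √((n + D : ℕ) : ℝ)) := by
      refine mul_le_mul_of_nonneg_left ?_ hS.le
      exact (Chebyshev.psi_mono hx').trans (hD _ (by linarith) d4)
    have e5 : (S:ℝ) * (1.56 * √((n + D : ℕ) : ℝ)) ≤ g := by
      have hs := Real.sq_sqrt (Nat.cast_nonneg (α := ℝ) (n + D))
      refine le_of_sq_le_sq ?_ (Nat.cast_nonneg g)
      rw [mul_pow, mul_pow, hs]
      nlinarith
    constructor
    · linarith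
    · linarith

lemma iter2 {S P : ℕ} (hS0 : 0 < S) (hP : Pok P)
    (hD : ∀ x : ℝ, 16380 ≤ x → x ≤ 8427408 → Chebyshev.psi x ≤ TT x + 1.56 * √x)
    {j g r t k : ℕ} {s s' : St} (h : isSt (iter (step2 S P j g r t) k s) s' = true) (hI : Inv2 S s) :
    Inv2 S s' ∧ Con2 S r s.n s'.n :=
  iter_sound (Con2_trans S r) (step2_sound hS0 hP hD j g r t) k s s' (isSt_eq h) hI
end PQ

namespace PQ
def PP : Nat := nat_lit 2217887147722984164804371136655725830810667369723084827645230996005483098595370077973076108304996602675605263492765272473731045564212018318984891562213280152346142135278842130454101363716611500694967517658625812698861757199882562468535168654256943918770361886176528084621281199199363646123608217958145258428609758696739370525461927826796299729483713934064084314863592083693504669769538366480673227133108213851247061056222921396709120812981151991639820797138360432384229728796125706850438173381954890049256673921754648093122172594327133819674761736512164680328463473449807801205325383771530438726811391911063211125835328341001151866211456622372411732798415546610544738071120149088549855846852225984416103224251585034943916642701026759417726506011980322449916667300209948929015273376081374218387732679120928822374257137180727770648982604324258341779313305891008028474104172218792108394961324979850267083430004116690606817635277080503709848031697899444646414468172044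23427101928310651260259196054873133478039767451822426712155802839182385503283525666369462885611207668850438294755871671816711634810795023055874930994377837766676143996462072802290051195660842610879903405716921886125786528595075469811915049383041370260431507570436814322970

def pt (j : Nat) : Nat → Nat :=
  Nat.rec (motive := fun _ => Nat → Nat) (fun n => n)
    (fun k ih n => Nat.mul (ih n) (ih (Nat.add n (Nat.pow (nat_lit 2) k)))) j

def al (P j : Nat) : Nat → Bool :=
  Nat.rec (motive := fun _ => Nat → Bool) (fun n => cond (Nat.beq (Nat.gcd (Nat.mod P n) n) (nat_lit 1)) false true)
    (fun k ih n => cond (ih n) (ih (Nat.add n (Nat.pow (nat_lit 2) k))) false) j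

lemma pt_spec (j : ℕ) : ∀ n q : ℕ, 1 ≤ n → q.Prime → q ∣ pt j n → q < n + 2 ^ j := by
  induction j with
  | zero => intro n q hn _ h; have := Nat.le_of_dvd hn h; simp; omega
  | succ j ih =>
    intro n q hn hq h
    have hd : pt (j + 1) n = pt j n * pt j (n + 2 ^ j) := rfl
    rw [hd, hq.dvd_mul] at h
    have hp : 2 ^ (j + 1) = 2 ^ j + 2 ^ j := by ring
    rw [hp]
    have hp0 : 0 < 2 ^ j := by positivity
    rcases h with h | h
    · have := ih n q hn hq h; omega
    · have := ih (n + 2 ^ j) q (by omega) hq h; omega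

lemma al_spec (P j : ℕ) : ∀ n q : ℕ, al P j n = true → n ≤ q → q < n + 2 ^ j → q.Prime → q ∣ P := by
  induction j with
  | zero =>
    intro n q h h1 h2 hq
    obtain rfl : n = q := by simp at h2; omega
    have hd : al P 0 n = cond (Nat.beq (Nat.gcd (P % n) n) 1) false true := rfl
    rw [hd, (Nat.gcd_rec n P).symm] at h
    by_contra hc
    have : Nat.gcd n P = 1 := (hq.coprime_iff_not_dvd).2 hc
    rw [this] at h
    simp at h
  | succ j ih =>
    intro n q h h1 h2 hq
    have hd : al P (j + 1) n = cond (al P j n) (al P j (n + 2 ^ j)) false := rfl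
    rw [hd] at h
    have hp : 2 ^ (j + 1) = 2 ^ j + 2 ^ j := by ring
    rw [hp] at h2
    cases ha : al P j n with
    | false => rw [ha] at h; simp at h
    | true =>
      rw [ha] at h
      rcases lt_or_ge q (n + 2 ^ j) with h3 | h3
      · exact ih n q ha h1 h3 hq
      · exact ih (n + 2 ^ j) q h h3 (by omega) hq

lemma PPa : Nat.beq (Nat.mod (pt 12 1) PP) 0 = true := by decide +kernel
lemma PPb : al PP 11 2 = true := by decide +kernel
lemma PPc : al PP 11 855 = true := by decide +kernel

lemma PP_ok : Pok PP := by
  constructor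
  · intro q hq h
    have := hq.two_le
    rcases lt_or_ge q (2 + 2 ^ 11) with h1 | h1
    · exact al_spec PP 11 2 q PPb this h1 hq
    · exact al_spec PP 11 855 q PPc (by omega) (by omega) hq
  · intro q hq h
    have h1 : PP ∣ pt 12 1 := Nat.dvd_of_mod_eq_zero (Nat.eq_of_beq_eq_true PPa)
    have := pt_spec 12 1 q le_rfl hq (h.trans h1)
    omega
end PQ

namespace PQ
lemma sb0 : isSt (iter (step2 10000000000 PP 1 2410000000000 3669240000000 23700) 7 ⟨16380, 97036528964, 97041425717, 163977987192380, 163987416367533⟩) ⟨23700, 100730665685, 100735571315, 237030541369484, 237065923004617⟩ = true := by decide +kernel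
lemma sb1 : isSt (iter (step2 10000000000 PP 1 2900000000000 4786350000000 34320) 8 ⟨23700, 100730665685, 100735571315, 237030541369484, 237065923004617⟩) ⟨34320, 104433196464, 104438106469, 342903112183221, 342965113964324⟩ = true := by decide +kernel
lemma sb2 : isSt (iter (step2 10000000000 PP 3 3480000000000 6228490000000 49680) 6 ⟨34320, 104433196464, 104438106469, 342903112183221, 342965113964324⟩) ⟨49680, 108131927411, 108136869434, 495422937992618, 495574945969441⟩ = true := by decide +kernel
lemma sb3 : isSt (iter (step2 10000000000 PP 3 4190000000000 8080230000000 72000) 7 ⟨49680, 108131927411, 108136869434, 495422937992618, 495574945969441⟩) ⟨72000, 111842559084, 111847516488, 718425327478643, 718668298305913⟩ = true := by decide +kernel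
lemma sb4 : isSt (iter (step2 10000000000 PP 4 5040000000000 10463740000000 104160) 7 ⟨72000, 111842559084, 111847516488, 718425327478643, 718668298305913⟩) ⟨104160, 115535169974, 115540156456, 1039241647351028, 1039654219015926⟩ = true := by decide +kernel
lemma sb5 : isSt (iter (step2 10000000000 PP 4 6060000000000 13500300000000 150720) 7 ⟨104160, 115535169974, 115540156456, 1039241647351028, 1039654219015926⟩) ⟨150720, 119230121628, 119235122079, 1504423110560240, 1505006411681722⟩ = true := by decide +kernel
lemma sb6 : isSt (iter (step2 10000000000 PP 5 7290000000000 17381120000000 217920) 7 ⟨150720, 119230121628, 119235122079, 1504423110560240, 1505006411681722⟩) ⟨217920, 122917154896, 122922181872, 2174388565549702, 2175291148178060⟩ = true := by decide +kernel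
lemma sb7 : isSt (iter (step2 10000000000 PP 5 8770000000000 22317680000000 315840) 7 ⟨217920, 122917154896, 122922181872, 2174388565549702, 2175291148178060⟩) ⟨315840, 126628227944, 126633267734, 3151141641704992, 3152368593196279⟩ = true := by decide +kernel
lemma sb8 : isSt (iter (step2 10000000000 PP 5 10560000000000 28644920000000 457920) 8 ⟨315840, 126628227944, 126633267734, 3151141641704992, 3152368593196279⟩) ⟨457920, 130342813259, 130347859239, 4571893226032821, 4573453613932924⟩ = true := by decide +kernel
lemma sb9 : isSt (iter (step2 10000000000 PP 6 12710000000000 36704240000000 663360) 7 ⟨457920, 130342813259, 130347859239, 4571893226032821, 4573453613932924⟩) ⟨663360, 134049042698, 134054100289, 6623189844293433, 6625366290802019⟩ = true := by decide +kernel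
lemma sb10 : isSt (iter (step2 10000000000 PP 6 15300000000000 46920170000000 960960) 8 ⟨663360, 134049042698, 134054100289, 6623189844293433, 6625366290802019⟩) ⟨960960, 137755190348, 137760253574, 9596404391246465, 9599214831538973⟩ = true := by decide +kernel
lemma sb11 : isSt (iter (step2 10000000000 PP 7 18410000000000 59877230000000 1391040) 7 ⟨960960, 137755190348, 137760253574, 9596404391246465, 9599214831538973⟩) ⟨1391040, 141453928445, 141459002216, 13896424186423477, 13900408161778555⟩ = true := by decide +kernel
lemma sb12 : isSt (iter (step2 10000000000 PP 7 22010000000000 76252730000000 1990080) 8 ⟨1391040, 141453928445, 141459002216, 13896424186423477, 13900408161778555⟩) ⟨1990080, 145035158442, 145040237249, 19882097948059824, 19887253397009370⟩ = true := by decide +kernel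
lemma sb13 : isSt (iter (step2 10000000000 PP 7 25110000000000 96224260000000 2589120) 8 ⟨1990080, 145035158442, 145040237249, 19882097948059824, 19887253397009370⟩) ⟨2589120, 147666589839, 147671670699, 25871867424581697, 25877921208411815⟩ = true := by decide +kernel
lemma sb14 : isSt (iter (step2 10000000000 PP 8 27860000000000 114062540000000 3188160) 7 ⟨2589120, 147666589839, 147671670699, 25871867424581697, 25877921208411815⟩) ⟨3188160, 149747847539, 149752932219, 31859640524354628, 31866973451416005⟩ = true := by decide +kernel
lemma sb15 : isSt (iter (step2 10000000000 PP 8 30370000000000 130419420000000 3787200) 7 ⟨3188160, 149747847539, 149752932219, 31859640524354628, 31866973451416005⟩) ⟨3787200, 151469676916, 151474763785, 37847090496718032, 37855503320338442⟩ = true := by decide +kernel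
lemma sb16 : isSt (iter (step2 10000000000 PP 8 32680000000000 145663190000000 4386240) 7 ⟨3787200, 151469676916, 151474763785, 37847090496718032, 37855503320338442⟩) ⟨4386240, 152938130528, 152943218783, 43829570446440727, 43838923330980373⟩ = true := by decide +kernel
lemma sb17 : isSt (iter (step2 10000000000 PP 8 34840000000000 160027450000000 4985280) 7 ⟨4386240, 152938130528, 152943218783, 43829570446440727, 43838923330980373⟩) ⟨4985280, 154218302217, 154223391427, 49834209998728138, 49844403552184542⟩ = true := by decide +kernel
lemma sb18 : isSt (iter (step2 10000000000 PP 8 36870000000000 173671980000000 5584320) 7 ⟨4985280, 154218302217, 154223391427, 49834209998728138, 49844403552184542⟩) ⟨5584320, 155353032978, 155358122867, 55815227957947927, 55826180348931784⟩ = true := by decide +kernel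
lemma sb19 : isSt (iter (step2 10000000000 PP 8 38800000000000 186712080000000 6183360) 7 ⟨5584320, 155353032978, 155358122867, 55815227957947927, 55826180348931784⟩) ⟨6183360, 156372024218, 156377114623, 61798241895550709, 61809891159613814⟩ = true := by decide +kernel
lemma sb20 : isSt (iter (step2 10000000000 PP 9 40640000000000 199234390000000 6782400) 6 ⟨6183360, 156372024218, 156377114623, 61798241895550709, 61809891159613814⟩) ⟨6782400, 157296715850, 157301807594, 67787395607140015, 67800144790566091⟩ = true := by decide +kernel
lemma sb21 : isSt (iter (step2 10000000000 PP 9 42390000000000 211306050000000 7381440) 6 ⟨6782400, 157296715850, 157301807594, 67787395607140015, 67800144790566091⟩) ⟨7381440, 158143092698, 158148185478, 73787314976358390, 73801083565887412⟩ = true := by decide +kernel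
lemma sb22 : isSt (iter (step2 10000000000 PP 9 44080000000000 222980430000000 7980480) 6 ⟨7381440, 158143092698, 158148185478, 73787314976358390, 73801083565887412⟩) ⟨7980480, 158923390603, 158928484202, 79772081820310316, 79786798004721916⟩ = true := by decide +kernel
lemma sb23 : isSt (iter (step2 10000000000 PP 9 45210000000000 234300820000000 8395200) 5 ⟨7980480, 158923390603, 158928484202, 79772081820310316, 79786798004721916⟩) ⟨8395200, 159430005981, 159435100052, 83913836221478823, 83929173187378908⟩ = true := by decide +kernel
end PQ

namespace PQ
open ArithmeticFunction

noncomputable def RR (x : ℝ) : ℝ := √x * Real.log x * (Real.log x - Real.log (Real.log x)) / (8 * π)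

lemma ps_psi (x : ℝ) : Chebyshev.psi x = ps ⌊x⌋₊ := by
  rw [Chebyshev.psi_eq_sum_Icc, ps, Nat.range_succ_eq_Icc_zero]

def kn (S n lo r q s : Nat) : Bool :=
  Nat.ble S lo && Nat.ble (lo ^ 1000 * 10000000000 ^ q) (S ^ 1000 * 27182818283 ^ q) && Nat.ble (s * s) (n * 100000000) &&
  Nat.ble (r * 251328 * 1000 * S + s * lo * (q * S)) (s * lo * (1000 * lo))

lemma kn_spec {S n lo r q s : ℕ} (hS0 : 0 < S) (h : kn S n lo r q s = true) (hlo : (lo:ℝ) ≤ S * Real.log n) :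
    ∀ x : ℝ, (n:ℝ) ≤ x → (r:ℝ) ≤ S * RR x := by
  simp only [kn, Bool.and_eq_true, Nat.ble_eq] at h
  obtain ⟨⟨⟨h1, h2⟩, h3⟩, h4⟩ := h
  intro x hx
  have hS : (0:ℝ) < S := by exact_mod_cast hS0
  have k1 : (S:ℝ) ≤ lo := by exact_mod_cast h1
  have k2 : (lo:ℝ) ^ 1000 * 10000000000 ^ q ≤ S ^ 1000 * 27182818283 ^ q := by exact_mod_cast h2
  have k3 : (s:ℝ) * s ≤ n * 100000000 := by exact_mod_cast h3
  have k4 : (r:ℝ) * 251328 * 1000 * S + s * lo * (q * S) ≤ s * lo * (1000 * lo) := by exact_mod_cast h4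
  obtain ⟨l, hl⟩ : ∃ l : ℝ, l = lo / S := ⟨_, rfl⟩
  have hlo' : (lo:ℝ) = S * l := by rw [hl]; field_simp
  have l1 : 1 ≤ l := by rw [hl, le_div_iff₀ hS]; linarith
  rw [hlo'] at hlo k2 k4
  have lL : l ≤ Real.log n := le_of_mul_le_mul_left hlo hS
  have hn : (0:ℝ) < n := by
    rcases Nat.eq_zero_or_pos n with h0 | h0
    · rw [h0] at lL; simp at lL; linarith
    · exact_mod_cast h0
  have lx : l ≤ Real.log x := lL.trans (Real.log_le_log hn hx)
  have hlq : 1000 * Real.log l ≤ q := by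
    rw [mul_pow, mul_assoc] at k2
    have k5 := le_of_mul_le_mul_left k2 (pow_pos hS 1000)
    have k6 : l ^ 1000 ≤ Real.exp q := by
      have : l ^ 1000 ≤ (2.7182818283:ℝ) ^ q := by
        rw [show (2.7182818283:ℝ) = 27182818283 / 10000000000 by norm_num, div_pow, le_div_iff₀ (by positivity)]
        exact k5
      refine this.trans ?_
      rw [show (q:ℝ) = q * 1 by ring, Real.exp_nat_mul]
      exact pow_le_pow_left₀ (by norm_num) Real.exp_one_gt_d9.le q
    have := Real.log_le_log (by positivity) k6
    rw [Real.log_pow, Real.log_exp] at this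
    exact_mod_cast this
  have hLL : l - Real.log l ≤ Real.log x - Real.log (Real.log x) := by
    have hx0 : 0 < Real.log x := by linarith
    have e1 := Real.log_le_sub_one_of_pos (show 0 < Real.log x / l by positivity)
    rw [Real.log_div hx0.ne' (by positivity)] at e1
    have e2 : Real.log x / l - 1 ≤ Real.log x - l := by
      rw [div_sub_one (by positivity), div_le_iff₀ (by positivity)]
      nlinarith
    linarith
  have hs : (s:ℝ) / 10000 ≤ √x := by
    apply Real.le_sqrt_of_sq_le
    rw [div_pow, div_le_iff₀ (by norm_num)]
    nlinarith
  have hs0 : (0:ℝ) ≤ (s:ℝ) / 10000 := by positivity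
  have hlq0 : l - q / 1000 ≤ l - Real.log l := by linarith
  have hll0 : 0 ≤ l - Real.log l := by
    have := Real.log_le_sub_one_of_pos (show 0 < l by linarith); linarith
  have hpi : 8 * π ≤ 25.1328 := by have := Real.pi_lt_d4; linarith
  have hsl0 : 0 ≤ (s:ℝ) / 10000 * l := by positivity
  have A : (s:ℝ) / 10000 * l * (l - q / 1000) ≤ √x * Real.log x * (Real.log x - Real.log (Real.log x)) := by
    calc _ ≤ (s:ℝ) / 10000 * l * (l - Real.log l) := mul_le_mul_of_nonneg_left hlq0 hsl0
      _ ≤ √x * Real.log x * (Real.log x - Real.log (Real.log x)) := by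
        apply mul_le_mul _ hLL hll0 (mul_nonneg (Real.sqrt_nonneg _) (by linarith))
        exact mul_le_mul hs lx (by linarith) (Real.sqrt_nonneg _)
  unfold RR
  rw [← mul_div_assoc, le_div_iff₀ (by positivity)]
  have B : (r:ℝ) * 25.1328 ≤ S * ((s:ℝ) / 10000 * l * (l - q / 1000)) := by
    have : ((r:ℝ) * 25.1328) * (10000000 * S) ≤ S * ((s:ℝ) / 10000 * l * (l - q / 1000)) * (10000000 * S) := by
      linarith
    exact le_of_mul_le_mul_right this (by positivity)
  calc (r:ℝ) * (8 * π) ≤ r * 25.1328 := mul_le_mul_of_nonneg_left hpi (Nat.cast_nonneg _)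
    _ ≤ _ := B
    _ ≤ _ := mul_le_mul_of_nonneg_left A hS.le

def Fx (x : ℝ) : Prop := |Chebyshev.psi x - x| ≤ RR x

lemma Fx_of {S r : ℕ} (hS0 : 0 < S) {x : ℝ} (h1 : S * Chebyshev.psi x ≤ S * x + r) (h2 : S * x ≤ S * Chebyshev.psi x + r)
    (h3 : (r:ℝ) ≤ S * RR x) : Fx x := by
  have hS : (0:ℝ) < S := by exact_mod_cast hS0
  unfold Fx
  rw [abs_le]
  constructor
  · have : S * (-RR x) ≤ S * (Chebyshev.psi x - x) := by linarith
    exact le_of_mul_le_mul_left this hS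
  · have : S * (Chebyshev.psi x - x) ≤ S * RR x := by linarith
    exact le_of_mul_le_mul_left this hS

def Acc1 (S : ℕ) (s : St) : Prop := Inv1 S s ∧ (∀ m : ℕ, 16 < m → m ≤ s.n → ps m ≤ 1.05 * m) ∧
  ∀ x : ℝ, 101 ≤ x → x < s.n + 1 → Fx x

def Acc2 (S : ℕ) (s : St) : Prop := Inv2 S s ∧ ∀ x : ℝ, 101 ≤ x → x ≤ s.n → Fx x

lemma stage1 {S t r k q w : ℕ} {s s' : St} (hA : Acc1 S s) (hS0 : 0 < S)
    (h : isSt (iter (step1 S t r) k s) s' = true) (hk : kn S s.n s.lo r q w = true) : Acc1 S s' := by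
  obtain ⟨hI, hm, hx⟩ := hA
  obtain ⟨hI', hC⟩ := iter1 hS0 h hI
  have hr := kn_spec hS0 hk hI.2.1
  refine ⟨hI', ?_, ?_⟩
  · intro m h1 h2
    rcases le_or_gt m s.n with h3 | h3
    · exact hm m h1 h3
    · exact (hC m (by exact_mod_cast h3) (by exact_mod_cast h2)).2.2
  · intro x h1 h2
    rcases lt_or_ge x (s.n + 1) with h3 | h3
    · exact hx x h1 h3
    · have hx0 : 0 ≤ x := by linarith
      have f1 : s.n + 1 ≤ ⌊x⌋₊ := by rw [Nat.le_floor_iff hx0]; exact_mod_cast h3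
      have f2 : ⌊x⌋₊ < s'.n + 1 := by rw [Nat.floor_lt hx0]; exact_mod_cast h2
      have f3 := Nat.floor_le hx0
      have f4 := (Nat.lt_floor_add_one x).le
      obtain ⟨c1, c2, -⟩ := hC ⌊x⌋₊ (by exact_mod_cast f1) (by exact_mod_cast (by omega : ⌊x⌋₊ ≤ s'.n))
      rw [← ps_psi] at c1 c2
      have hS : (0:ℝ) < S := by exact_mod_cast hS0
      have g1 := mul_le_mul_of_nonneg_left f3 hS.le
      have g2 := mul_le_mul_of_nonneg_left f4 hS.le
      exact Fx_of hS0 (by linarith) (by linarith) (hr x (by linarith))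

lemma stage0 {S t r k : ℕ} {s s' : St} (hI : Inv1 S s) (hn : s.n = 16) (hn' : s'.n = 100) (hS0 : 0 < S)
    (h : isSt (iter (step1 S t r) k s) s' = true) : Acc1 S s' := by
  obtain ⟨hI', hC⟩ := iter1 hS0 h hI
  refine ⟨hI', ?_, ?_⟩
  · intro m h1 h2
    exact (hC m (by rw [hn]; exact_mod_cast h1) (by exact_mod_cast h2)).2.2
  · intro x h1 h2
    rw [hn'] at h2
    norm_num at h2
    linarith

lemma stage2 {S P j g t r k q w : ℕ} {s s' : St} (hA : Acc2 S s) (hS0 : 0 < S) (hP : Pok P)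
    (hD : ∀ x : ℝ, 16380 ≤ x → x ≤ 8427408 → Chebyshev.psi x ≤ TT x + 1.56 * √x)
    (h : isSt (iter (step2 S P j g r t) k s) s' = true) (hk : kn S s.n s.lo r q w = true) : Acc2 S s' := by
  obtain ⟨hI, hx⟩ := hA
  obtain ⟨hI', hC⟩ := iter2 hS0 hP hD h hI
  have hr := kn_spec hS0 hk hI.2.2.1
  refine ⟨hI', ?_⟩
  intro x h1 h2
  rcases le_or_gt x s.n with h3 | h3
  · exact hx x h1 h3
  · obtain ⟨c1, c2⟩ := hC x h3 h2
    exact Fx_of hS0 c1 c2 (hr x h3.le)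

lemma Acc12 {S : ℕ} {s : St} (h : Acc1 S s) (hn : s.n = 16380) : Acc2 S s := by
  obtain ⟨⟨i1, i2, i3, i4, i5⟩, -, hx⟩ := h
  have hT : TT s.n = ps s.n := by
    rw [hn]
    unfold TT
    rw [ps_psi, Nat.floor_ofNat]
    push_cast
    ring
  exact ⟨⟨hn.ge, by rw [hn], i2, i3, by rw [hT]; exact i4, by rw [hT]; exact i5⟩, fun x h1 h2 => hx x h1 (by linarith)⟩

lemma psi_105 {s : St} {S : ℕ} (h : Acc1 S s) (hn : s.n = 16380) {y : ℝ} (h1 : 17 ≤ y) (h2 : y ≤ 16380) :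
    Chebyshev.psi y ≤ 1.05 * y := by
  obtain ⟨-, hm, -⟩ := h
  have hy0 : 0 ≤ y := by linarith
  have f1 : 17 ≤ ⌊y⌋₊ := by rw [Nat.le_floor_iff hy0]; exact_mod_cast h1
  have f2 : ⌊y⌋₊ ≤ 16380 := Nat.floor_le_of_le (by exact_mod_cast h2)
  have := hm ⌊y⌋₊ (by omega) (by omega)
  rw [ps_psi]
  have := Nat.floor_le hy0
  linarith

lemma D_bd {s : St} {S : ℕ} (h : Acc1 S s) (hn : s.n = 16380) (x : ℝ) (h1 : 16380 ≤ x) (h2 : x ≤ 8427408) :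
    Chebyshev.psi x ≤ TT x + 1.56 * √x := by
  have h0 : 0 ≤ x := by linarith
  have hT : Chebyshev.theta x ≤ TT x := by
    have := Chebyshev.theta_le_psi 16380
    unfold TT; linarith
  have hP := Chebyshev.psi_sub_theta_le_psi_add_psi_add_psi x
  obtain ⟨z, hz⟩ : ∃ z : ℝ, z = x ^ (30:ℝ)⁻¹ := ⟨_, rfl⟩
  have hz0 : 0 < z := by rw [hz]; positivity
  have zx : z ^ 30 = x := by
    rw [hz, ← Real.rpow_natCast, ← Real.rpow_mul h0]; norm_num
  have z2 : x ^ (2:ℝ)⁻¹ = z ^ 15 := by rw [hz, ← Real.rpow_natCast, ← Real.rpow_mul h0]; norm_num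
  have z3 : x ^ (3:ℝ)⁻¹ = z ^ 10 := by rw [hz, ← Real.rpow_natCast, ← Real.rpow_mul h0]; norm_num
  have z5 : x ^ (5:ℝ)⁻¹ = z ^ 6 := by rw [hz, ← Real.rpow_natCast, ← Real.rpow_mul h0]; norm_num
  have zs : √x = z ^ 15 := by rw [Real.sqrt_eq_rpow, one_div, z2]
  have b5 : 5 ≤ z ^ 5 := by
    refine le_of_pow_le_pow_left₀ (n := 6) (by norm_num) (by positivity) ?_
    rw [← pow_mul, zx]; norm_num; linarith
  have b9 : 18 ≤ z ^ 9 := by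
    refine le_of_pow_le_pow_left₀ (n := 10) (by norm_num) (by positivity) ?_
    rw [← pow_mul, show z ^ (9 * 10) = (z ^ 30) ^ 3 by ring, zx]
    calc (18:ℝ) ^ 10 ≤ 16380 ^ 3 := by norm_num
      _ ≤ x ^ 3 := pow_le_pow_left₀ (by norm_num) h1 3
  have c15 : z ^ 15 ≤ 16380 := by
    refine le_of_pow_le_pow_left₀ (n := 2) (by norm_num) (by positivity) ?_
    rw [← pow_mul, zx]; norm_num; linarith
  have d10 : 25 ≤ z ^ 10 := by nlinarith
  have d15 : z ^ 10 * 5 ≤ z ^ 15 := by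
    rw [show z ^ 15 = z ^ 10 * z ^ 5 by ring]
    exact mul_le_mul_of_nonneg_left b5 (by positivity)
  have d6 : z ^ 6 * 18 ≤ z ^ 15 := by
    rw [show z ^ 15 = z ^ 6 * z ^ 9 by ring]
    exact mul_le_mul_of_nonneg_left b9 (by positivity)
  rw [z2, z3, z5] at hP
  have p2 := psi_105 h hn (y := z ^ 15) (by linarith) c15
  have p3 := psi_105 h hn (y := z ^ 10) (by linarith) (by linarith)
  have p5 := Chebyshev.psi_le_const_mul_self (x := z ^ 6) (by positivity)
  have l4 : Real.log 4 ≤ 1.3863 := by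
    rw [show (4:ℝ) = 2 ^ 2 by norm_num, Real.log_pow]
    have := Real.log_two_lt_d9
    push_cast; linarith
  have p6 : (Real.log 4 + 4) * z ^ 6 ≤ 5.3863 * z ^ 6 := mul_le_mul_of_nonneg_right (by linarith) (by positivity)
  rw [zs]
  linarith

lemma ps16 : ps 16 = Real.log 720720 := by
  have h := Chebyshev.psi_eq_log_lcmUpto 16
  rw [ps_psi, Nat.floor_natCast] at h
  rw [h]
  congr 1

set_option exponentiation.threshold 2000 in
lemma inv0 : Inv1 10000000000 ⟨16, 27725887210, 27725887234, 134800000000, 134900000000⟩ := by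
  have l16 : Real.log 16 = 4 * Real.log 2 := by
    rw [show (16:ℝ) = 2 ^ 4 by norm_num, Real.log_pow]; norm_num
  have g1 := Real.log_two_gt_d9
  have g2 := Real.log_two_lt_d9
  have e1 : (13.48:ℝ) ≤ Real.log 720720 := by
    have : (1348:ℝ) ≤ Real.log (720720 ^ 100) := by
      rw [Real.le_log_iff_exp_le (by positivity), show (1348:ℝ) = (1348:ℕ) * 1 by norm_num, Real.exp_nat_mul]
      refine (pow_le_pow_left₀ (Real.exp_pos 1).le Real.exp_one_lt_d9.le 1348).trans ?_
      norm_num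
    rw [Real.log_pow] at this
    push_cast at this
    linarith
  have e2 : Real.log 720720 ≤ (13.49:ℝ) := by
    have : Real.log (720720 ^ 100) ≤ (1349:ℝ) := by
      rw [Real.log_le_iff_le_exp (by positivity), show (1349:ℝ) = (1349:ℕ) * 1 by norm_num, Real.exp_nat_mul]
      refine le_trans ?_ (pow_le_pow_left₀ (by norm_num) Real.exp_one_gt_d9.le 1349)
      norm_num
    rw [Real.log_pow] at this
    push_cast at this
    linarith
  refine ⟨by norm_num, ?_, ?_, ?_, ?_⟩
  · push_cast; rw [l16]; linarith
  · push_cast; rw [l16]; linarith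
  · simp only [ps16]; push_cast; linarith
  · simp only [ps16]; push_cast; linarith
end PQ

namespace PQ
lemma S0 : 0 < 10000000000 := by norm_num
lemma ac0 : Acc1 10000000000 ⟨100, 46050116978, 46054872522, 940345835960, 940527502689⟩ := stage0 inv0 rfl rfl S0 sa0
lemma ac1 : Acc1 10000000000 ⟨146, 49834459192, 49839281140, 1416487250681, 1416716692369⟩ := stage1 (q := 1528) (w := 100000) ac0 S0 sa1 (by decide +kernel)
lemma ac2 : Acc1 10000000000 ⟨218, 53843332787, 53848187146, 2114832177012, 2115126952964⟩ := stage1 (q := 1607) (w := 120830) ac1 S0 sa2 (by decide +kernel)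
lemma ac3 : Acc1 10000000000 ⟨553, 63151954609, 63156831518, 5430233659010, 5430802458391⟩ := stage1 (q := 1684) (w := 147648) ac2 S0 sa3 (by decide +kernel)
lemma ac4 : Acc1 10000000000 ⟨1418, 72568400098, 72573281313, 13926559801076, 13927735394895⟩ := stage1 (q := 1843) (w := 235159) ac3 S0 sa4 (by decide +kernel)
lemma ac5 : Acc1 10000000000 ⟨11671, 93646991839, 93651883877, 116151711732180, 116158687602690⟩ := stage1 (q := 1982) (w := 376563) ac4 S0 sa5 (by decide +kernel)
lemma ac6 : Acc1 10000000000 ⟨16380, 97036528964, 97041425717, 163977987192380, 163987416367533⟩ := stage1 (q := 2237) (w := 1080324) ac5 S0 sa6 (by decide +kernel)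
lemma ad0 : Acc2 10000000000 ⟨16380, 97036528964, 97041425717, 163977987192380, 163987416367533⟩ := Acc12 ac6 rfl
lemma ad1 : Acc2 10000000000 ⟨23700, 100730665685, 100735571315, 237030541369484, 237065923004617⟩ := stage2 (q := 2273) (w := 1279843) ad0 S0 PP_ok (D_bd ac6 rfl) sb0 (by decide +kernel)
lemma ad2 : Acc2 10000000000 ⟨34320, 104433196464, 104438106469, 342903112183221, 342965113964324⟩ := stage2 (q := 2310) (w := 1539480) ad1 S0 PP_ok (D_bd ac6 rfl) sb1 (by decide +kernel)
lemma ad3 : Acc2 10000000000 ⟨49680, 108131927411, 108136869434, 495422937992618, 495574945969441⟩ := stage2 (q := 2346) (w := 1852565) ad2 S0 PP_ok (D_bd ac6 rfl) sb2 (by decide +kernel)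
lemma ad4 : Acc2 10000000000 ⟨72000, 111842559084, 111847516488, 718425327478643, 718668298305913⟩ := stage2 (q := 2381) (w := 2228901) ad3 S0 PP_ok (D_bd ac6 rfl) sb3 (by decide +kernel)
lemma ad5 : Acc2 10000000000 ⟨104160, 115535169974, 115540156456, 1039241647351028, 1039654219015926⟩ := stage2 (q := 2415) (w := 2683281) ad4 S0 PP_ok (D_bd ac6 rfl) sb4 (by decide +kernel)
lemma ad6 : Acc2 10000000000 ⟨150720, 119230121628, 119235122079, 1504423110560240, 1505006411681722⟩ := stage2 (q := 2447) (w := 3227382) ad5 S0 PP_ok (D_bd ac6 rfl) sb5 (by decide +kernel)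
lemma ad7 : Acc2 10000000000 ⟨217920, 122917154896, 122922181872, 2174388565549702, 2175291148178060⟩ := stage2 (q := 2479) (w := 3882267) ad6 S0 PP_ok (D_bd ac6 rfl) sb6 (by decide +kernel)
lemma ad8 : Acc2 10000000000 ⟨315840, 126628227944, 126633267734, 3151141641704992, 3152368593196279⟩ := stage2 (q := 2509) (w := 4668190) ad7 S0 PP_ok (D_bd ac6 rfl) sb7 (by decide +kernel)
lemma ad9 : Acc2 10000000000 ⟨457920, 130342813259, 130347859239, 4571893226032821, 4573453613932924⟩ := stage2 (q := 2539) (w := 5619964) ad8 S0 PP_ok (D_bd ac6 rfl) sb8 (by decide +kernel)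
lemma ad10 : Acc2 10000000000 ⟨663360, 134049042698, 134054100289, 6623189844293433, 6625366290802019⟩ := stage2 (q := 2568) (w := 6766978) ad9 S0 PP_ok (D_bd ac6 rfl) sb9 (by decide +kernel)
lemma ad11 : Acc2 10000000000 ⟨960960, 137755190348, 137760253574, 9596404391246465, 9599214831538973⟩ := stage2 (q := 2596) (w := 8144691) ad10 S0 PP_ok (D_bd ac6 rfl) sb10 (by decide +kernel)
lemma ad12 : Acc2 10000000000 ⟨1391040, 141453928445, 141459002216, 13896424186423477, 13900408161778555⟩ := stage2 (q := 2623) (w := 9802856) ad11 S0 PP_ok (D_bd ac6 rfl) sb11 (by decide +kernel)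
lemma ad13 : Acc2 10000000000 ⟨1990080, 145035158442, 145040237249, 19882097948059824, 19887253397009370⟩ := stage2 (q := 2650) (w := 11794235) ad12 S0 PP_ok (D_bd ac6 rfl) sb12 (by decide +kernel)
lemma ad14 : Acc2 10000000000 ⟨2589120, 147666589839, 147671670699, 25871867424581697, 25877921208411815⟩ := stage2 (q := 2675) (w := 14107019) ad13 S0 PP_ok (D_bd ac6 rfl) sb13 (by decide +kernel)
lemma ad15 : Acc2 10000000000 ⟨3188160, 149747847539, 149752932219, 31859640524354628, 31866973451416005⟩ := stage2 (q := 2693) (w := 16090742) ad14 S0 PP_ok (D_bd ac6 rfl) sb14 (by decide +kernel)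
lemma ad16 : Acc2 10000000000 ⟨3787200, 151469676916, 151474763785, 37847090496718032, 37855503320338442⟩ := stage2 (q := 2707) (w := 17855419) ad15 S0 PP_ok (D_bd ac6 rfl) sb15 (by decide +kernel)
lemma ad17 : Acc2 10000000000 ⟨4386240, 152938130528, 152943218783, 43829570446440727, 43838923330980373⟩ := stage2 (q := 2718) (w := 19460729) ad16 S0 PP_ok (D_bd ac6 rfl) sb16 (by decide +kernel)
lemma ad18 : Acc2 10000000000 ⟨4985280, 154218302217, 154223391427, 49834209998728138, 49844403552184542⟩ := stage2 (q := 2728) (w := 20943352) ad17 S0 PP_ok (D_bd ac6 rfl) sb17 (by decide +kernel)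
lemma ad19 : Acc2 10000000000 ⟨5584320, 155353032978, 155358122867, 55815227957947927, 55826180348931784⟩ := stage2 (q := 2736) (w := 22327740) ad18 S0 PP_ok (D_bd ac6 rfl) sb18 (by decide +kernel)
lemma ad20 : Acc2 10000000000 ⟨6183360, 156372024218, 156377114623, 61798241895550709, 61809891159613814⟩ := stage2 (q := 2744) (w := 23631165) ad19 S0 PP_ok (D_bd ac6 rfl) sb19 (by decide +kernel)
lemma ad21 : Acc2 10000000000 ⟨6782400, 157296715850, 157301807594, 67787395607140015, 67800144790566091⟩ := stage2 (q := 2750) (w := 24866362) ad20 S0 PP_ok (D_bd ac6 rfl) sb20 (by decide +kernel)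
lemma ad22 : Acc2 10000000000 ⟨7381440, 158143092698, 158148185478, 73787314976358390, 73801083565887412⟩ := stage2 (q := 2756) (w := 26043041) ad21 S0 PP_ok (D_bd ac6 rfl) sb21 (by decide +kernel)
lemma ad23 : Acc2 10000000000 ⟨7980480, 158923390603, 158928484202, 79772081820310316, 79786798004721916⟩ := stage2 (q := 2761) (w := 27168805) ad22 S0 PP_ok (D_bd ac6 rfl) sb22 (by decide +kernel)
lemma ad24 : Acc2 10000000000 ⟨8395200, 159430005981, 159435100052, 83913836221478823, 83929173187378908⟩ := stage2 (q := 2766) (w := 28249743) ad23 S0 PP_ok (D_bd ac6 rfl) sb23 (by decide +kernel)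
lemma psi_small {x : ℝ} (h1 : 101 ≤ x) (h2 : x ≤ 2 ^ 23) : Fx x := by
  refine ad24.2 x h1 ?_
  exact h2.trans (by norm_num)
end PQ


theorem psi_bound_RH (hRH : RiemannHypothesis) :
    ∀ x : ℝ, 101 ≤ x →
      |chebyshevPsi x - x| ≤
        Real.sqrt x * Real.log x * (Real.log x - Real.log (Real.log x)) / (8 * π) := by
  intro x hx
  rcases le_total x (2 ^ 23) with h | h
  · have h1 := PQ.psi_small hx h
    have h2 : chebyshevPsi x = Chebyshev.psi x := (PQ.ps_psi x).symm
    rw [h2]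
    exact h1
  · exact PB.psi_large hRH h
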